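/- Let d > 4. There exist β0 > 0 and C > 0 such that for all β ∈ (0, β0], all integers r ≥ 3 and all z ∈ ℂ with |z| ≤ ζ = z_c(1 − V^{−1/2}), one has χ(z) ≠ 0, χ^𝕋(z) ≠ 0, and the complex derivative of Δ(z) = 1/χ^𝕋(z) − 1/χ(z) satisfies |z Δ'(z)| ≤ C β χ(|z|) (r² + χ(|z|)) / V. -/

import Mathlib

open scoped BigOperators

/-- A unit step in `ℤ^d`: a coordinate direction together with a sign. -/
def wsawStep (d : ℕ) (e : Fin d × Bool) : Fin d → ℤ :=
  fun i => if i = e.1 then (if e.2 then 1 else -1) else 0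

/-- The position after `k` steps of the walk on `ℤ^d` with step sequence `s`.
(An `n`-step nearest-neighbour walk on `ℤ^d` started at `0` is the same thing as a
sequence of `n` unit steps.) -/
def wsawPos {d n : ℕ} (s : Fin n → Fin d × Bool) (k : ℕ) : Fin d → ℤ :=
  ∑ j ∈ Finset.univ.filter (fun j : Fin n => (j : ℕ) < k), wsawStep d (s j)

/-- The weakly self-avoiding walk weight `∏_{0 ≤ s < t ≤ n} (1 + β U_{st}(ω))`
of the `ℤ^d` walk with step sequence `s`. -/
noncomputable def wsawWeight {d : ℕ} (β : ℝ) (n : ℕ) (s : Fin n → Fin d × Bool) : ℝ :=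
  ∏ p ∈ (Finset.range (n + 1) ×ˢ Finset.range (n + 1)).filter (fun p => p.1 < p.2),
    (1 + β * (if wsawPos s p.1 = wsawPos s p.2 then (-1 : ℝ) else 0))

/-- The two-point partition function `c_n(x)` on `ℤ^d`. -/
noncomputable def cZx (d : ℕ) (β : ℝ) (n : ℕ) (x : Fin d → ℤ) : ℝ :=
  ∑ s ∈ Finset.univ.filter (fun s : Fin n → Fin d × Bool => wsawPos s n = x),
    wsawWeight β n s

/-- The partition function `c_n = Σ_x c_n(x)` on `ℤ^d`. -/
noncomputable def cZ (d : ℕ) (β : ℝ) (n : ℕ) : ℝ :=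
  ∑ s : Fin n → Fin d × Bool, wsawWeight β n s

/-- The position after `k` steps of the torus walk with step sequence `s`:
the mod-`r` projection of the `ℤ^d` position (for `r ≥ 3`, `n`-step torus walks
started at `0` correspond bijectively to step sequences). -/
def wsawPosT {d : ℕ} (r : ℕ) {n : ℕ} (s : Fin n → Fin d × Bool) (k : ℕ) : Fin d → ZMod r :=
  fun i => ((wsawPos s k i : ℤ) : ZMod r)

/-- The weakly self-avoiding walk weight of the torus walk with step sequence `s`. -/
noncomputable def wsawWeightT {d : ℕ} (r : ℕ) (β : ℝ) (n : ℕ) (s : Fin n → Fin d × Bool) : ℝ :=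
  ∏ p ∈ (Finset.range (n + 1) ×ˢ Finset.range (n + 1)).filter (fun p => p.1 < p.2),
    (1 + β * (if wsawPosT r s p.1 = wsawPosT r s p.2 then (-1 : ℝ) else 0))

/-- The torus partition function `c_n^𝕋`. -/
noncomputable def cT (d r : ℕ) (β : ℝ) (n : ℕ) : ℝ :=
  ∑ s : Fin n → Fin d × Bool, wsawWeightT r β n s

/-- `μ` is the growth constant: `μ = lim_{n→∞} c_n^{1/n}`. -/
def HasGrowthConst (d : ℕ) (β μ : ℝ) : Prop :=
  Filter.Tendsto (fun n : ℕ => (cZ d β n) ^ ((n : ℝ)⁻¹)) Filter.atTop (nhds μ)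

/-- The susceptibility `χ(z)` on `ℤ^d`, for complex `z`. -/
noncomputable def chi (d : ℕ) (β : ℝ) (z : ℂ) : ℂ := ∑' n : ℕ, (cZ d β n : ℂ) * z ^ n

/-- The susceptibility `χ(z)` on `ℤ^d`, for real `z`. -/
noncomputable def chiR (d : ℕ) (β : ℝ) (z : ℝ) : ℝ := ∑' n : ℕ, cZ d β n * z ^ n

/-- The torus susceptibility `χ^𝕋(z)`, for complex `z`. -/
noncomputable def chiT (d r : ℕ) (β : ℝ) (z : ℂ) : ℂ := ∑' n : ℕ, (cT d r β n : ℂ) * z ^ n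

/-- The torus susceptibility `χ^𝕋(z)`, for real `z`. -/
noncomputable def chiTR (d r : ℕ) (β : ℝ) (z : ℝ) : ℝ := ∑' n : ℕ, cT d r β n * z ^ n

/-- The sup norm `‖x‖_∞` of `x ∈ ℤ^d`, as a real number. -/
noncomputable def nInf {d : ℕ} (x : Fin d → ℤ) : ℝ :=
  ((Finset.univ.sup fun i => (x i).natAbs : ℕ) : ℝ)

/-- `⟨x⟩ = max {1, ‖x‖_∞}`. -/
noncomputable def vee {d : ℕ} (x : Fin d → ℤ) : ℝ := max 1 (nInf x)

/-- The two-point function `G_z(x) = Σ_n c_n(x) z^n` on `ℤ^d`. -/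
noncomputable def Gpt (d : ℕ) (β z : ℝ) (x : Fin d → ℤ) : ℝ := ∑' n : ℕ, cZx d β n x * z ^ n

/-- The bubble diagram `B_z = G_z * G_z`. -/
noncomputable def Bpt (d : ℕ) (β z : ℝ) (x : Fin d → ℤ) : ℝ :=
  ∑' y : Fin d → ℤ, Gpt d β z (x - y) * Gpt d β z y

/-- The triangle diagram `T_z = G_z * G_z * G_z`. -/
noncomputable def Tpt (d : ℕ) (β z : ℝ) (x : Fin d → ℤ) : ℝ :=
  ∑' y : Fin d → ℤ, Bpt d β z (x - y) * Gpt d β z y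

/-- The representative in `[-r/2, r/2) ∩ ℤ` of `x ∈ ℤ/rℤ`. -/
def repC (r : ℕ) (x : ZMod r) : ℤ :=
  if 2 * (x.val : ℤ) < (r : ℤ) then (x.val : ℤ) else (x.val : ℤ) - (r : ℤ)

open scoped ENNReal

namespace WSAW

section Combinatorics

variable {σ M : Type*} [AddCommGroup M]

/-- Total displacement of a list of steps. -/
def disp (st : σ → M) (ω : List σ) : M := (ω.map st).sum

@[simp] lemma disp_nil (st : σ → M) : disp st [] = 0 := rfl

@[simp] lemma disp_cons (st : σ → M) (e : σ) (ω : List σ) :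
    disp st (e :: ω) = st e + disp st ω := by simp [disp]

@[simp] lemma disp_append (st : σ → M) (u v : List σ) :
    disp st (u ++ v) = disp st u + disp st v := by simp [disp]

/-- Interaction of all proper starting times of `A` with a single later point at
displacement `c` from the endpoint of `A`. -/
def pointInt (st : σ → M) (w : M → ℝ) : List σ → M → ℝ
  | [], _ => 1
  | e :: A, c => (1 - w (disp st (e :: A) + c)) * pointInt st w A c

/-- Interaction between the starting times of `A` and the later points of a walk `C`
that starts at displacement `c` from the endpoint of `A`. -/
def crossInt (st : σ → M) (w : M → ℝ) (A : List σ) : M → List σ → ℝ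
  | _, [] => 1
  | c, f :: C => pointInt st w A (c + st f) * crossInt st w A (c + st f) C

/-- The weight of a walk; immediate neighbours do not interact. -/
def walkInt (st : σ → M) (w : M → ℝ) : List σ → ℝ
  | [] => 1
  | e :: ω => crossInt st w [e] 0 ω * walkInt st w ω

variable (st : σ → M) (w : M → ℝ)

lemma crossInt_append (A : List σ) (c : M) (C D : List σ) :
    crossInt st w A c (C ++ D) = crossInt st w A c C * crossInt st w A (c + disp st C) D := by
  induction C generalizing c with
  | nil => simp [crossInt]
  | cons f C ih => simp [crossInt, ih, mul_assoc, add_assoc]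

lemma crossInt_cons_left (e : σ) (A : List σ) (c : M) (C : List σ) :
    crossInt st w (e :: A) c C = crossInt st w [e] (disp st A + c) C * crossInt st w A c C := by
  induction C generalizing c with
  | nil => simp [crossInt]
  | cons f C ih =>
    simp only [crossInt, pointInt, ih, disp_cons, disp_nil]
    rw [show st e + 0 + (disp st A + c + st f) = st e + disp st A + (c + st f) by abel,
      show disp st A + (c + st f) = disp st A + c + st f by abel]
    ring

lemma crossInt_nil_left (c : M) (C : List σ) : crossInt st w [] c C = 1 := by
  induction C generalizing c with
  | nil => rfl
  | cons f C ih => simp [crossInt, pointInt, ih]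

lemma walkInt_append (A C : List σ) :
    walkInt st w (A ++ C) = walkInt st w A * crossInt st w A 0 C * walkInt st w C := by
  induction A with
  | nil => simp [walkInt, crossInt_nil_left]
  | cons e A ih =>
    simp only [List.cons_append, walkInt, ih, crossInt_append]
    rw [crossInt_cons_left st w e A 0 C]
    simp only [zero_add, add_zero]
    ring

variable {w}

lemma pointInt_mem (hw : ∀ x, 0 ≤ w x ∧ w x ≤ 1) (A : List σ) (c : M) :
    0 ≤ pointInt st w A c ∧ pointInt st w A c ≤ 1 := by
  induction A with
  | nil => simp [pointInt]
  | cons e A ih =>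
    obtain ⟨h0, h1⟩ := hw (disp st (e :: A) + c)
    exact ⟨mul_nonneg (by linarith) ih.1, mul_le_one₀ (by linarith) ih.1 ih.2⟩

lemma crossInt_mem (hw : ∀ x, 0 ≤ w x ∧ w x ≤ 1) (A : List σ) (c : M) (C : List σ) :
    0 ≤ crossInt st w A c C ∧ crossInt st w A c C ≤ 1 := by
  induction C generalizing c with
  | nil => simp [crossInt]
  | cons e C ih =>
    exact ⟨mul_nonneg (pointInt_mem st hw _ _).1 (ih _).1,
      mul_le_one₀ (pointInt_mem st hw _ _).2 (ih _).1 (ih _).2⟩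

lemma walkInt_mem (hw : ∀ x, 0 ≤ w x ∧ w x ≤ 1) (A : List σ) :
    0 ≤ walkInt st w A ∧ walkInt st w A ≤ 1 := by
  induction A with
  | nil => simp [walkInt]
  | cons e C ih =>
    exact ⟨mul_nonneg (crossInt_mem st hw _ _ _).1 ih.1,
      mul_le_one₀ (crossInt_mem st hw _ _ _).2 ih.1 ih.2⟩

lemma walkInt_append_le (hw : ∀ x, 0 ≤ w x ∧ w x ≤ 1) (A C : List σ) :
    walkInt st w (A ++ C) ≤ walkInt st w A * walkInt st w C := by
  rw [walkInt_append]
  have h1 := walkInt_mem st hw A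
  have h2 := walkInt_mem st hw C
  have h3 := crossInt_mem st hw A 0 C
  exact mul_le_mul_of_nonneg_right (mul_le_of_le_one_right h1.1 h3.2) h2.1

lemma one_sub_pointInt_le (hw : ∀ x, 0 ≤ w x ∧ w x ≤ 1) (A : List σ) (c : M) :
    1 - pointInt st w A c ≤ ∑ n ∈ Finset.range A.length, w (disp st (A.drop n) + c) := by
  induction A with
  | nil => simp [pointInt]
  | cons e A ih =>
    rw [List.length_cons, Finset.sum_range_succ']
    simp only [List.drop_succ_cons, List.drop_zero, pointInt]
    obtain ⟨h0, h1⟩ := hw (disp st (e :: A) + c)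
    have := pointInt_mem st hw A c
    nlinarith

variable (w)

/-- Increment of the cross interaction when the last step of `D` is added. -/
def crossInc (A D : List σ) : ℝ :=
  crossInt st w A 0 D - crossInt st w A 0 D.dropLast

lemma crossInt_eq_sum (A C : List σ) :
    crossInt st w A 0 C
      = 1 + ∑ i : Fin C.length, crossInc st w A (C.take (i + 1)) := by
  have h : ∑ i ∈ Finset.range C.length,
      (crossInt st w A 0 (C.take (i + 1)) - crossInt st w A 0 (C.take i))
      = crossInt st w A 0 (C.take C.length) - crossInt st w A 0 (C.take 0) :=
    Finset.sum_range_sub (fun i => crossInt st w A 0 (C.take i)) _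
  rw [Finset.sum_range] at h
  have h2 : ∑ i : Fin C.length, crossInc st w A (C.take (i + 1))
      = crossInt st w A 0 C - 1 := by
    simp only [List.take_length, List.take_zero] at h
    rw [show crossInt st w A 0 [] = 1 from rfl] at h
    rw [← h]
    refine Finset.sum_congr rfl fun i _ => ?_
    have hi : (i : ℕ) + 1 ≤ C.length := i.2
    rw [crossInc, List.dropLast_eq_take, List.take_take, List.length_take,
      min_eq_left hi, Nat.add_sub_cancel, min_eq_left (Nat.le_succ _)]
  rw [h2]; ring

lemma crossInc_eq (A D : List σ) (hD : D ≠ []) :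
    crossInc st w A D
      = crossInt st w A 0 D.dropLast * (pointInt st w A (disp st D) - 1) := by
  have h : D.dropLast ++ [D.getLast hD] = D := List.dropLast_append_getLast hD
  have h1 : crossInt st w A 0 D
      = crossInt st w A 0 D.dropLast * pointInt st w A (disp st D) := by
    conv_lhs => rw [← h]
    rw [crossInt_append]
    conv_rhs => rw [← h]
    simp [crossInt]
  rw [crossInc, h1]; ring

/-- The connected part of the interaction of `C` with the segment `A` preceding it. -/
noncomputable def connInt (A C : List σ) : ℝ :=
  if C = [] then 1 else
    ∑ i : Fin C.length, crossInc st w A (C.take (i + 1)) * walkInt st w (C.take (i + 1)) *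
      connInt (C.take (i + 1)) (C.drop (i + 1))
termination_by C.length
decreasing_by
  have := i.2
  simp only [List.length_drop]; omega

lemma connInt_nil (A : List σ) : connInt st w A [] = 1 := by
  rw [connInt]; simp

lemma connInt_of_ne_nil (A C : List σ) (hC : C ≠ []) : connInt st w A C =
    ∑ i : Fin C.length, crossInc st w A (C.take (i + 1)) * walkInt st w (C.take (i + 1)) *
      connInt st w (C.take (i + 1)) (C.drop (i + 1)) := by
  rw [connInt]; simp [hC]

lemma connInt_expansion (A C : List σ) :
    crossInt st w A 0 C * walkInt st w C
      = ∑ n ∈ Finset.range (C.length + 1),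
          connInt st w A (C.take n) * walkInt st w (C.drop n) := by
  induction hn : C.length using Nat.strong_induction_on generalizing A C with
  | _ N ih =>
  subst hn
  rw [Finset.sum_range_succ']
  simp only [List.take_zero, List.drop_zero, connInt_nil, one_mul]
  have h1 : ∀ n ∈ Finset.range C.length,
      connInt st w A (C.take (n + 1)) * walkInt st w (C.drop (n + 1))
      = ∑ i ∈ Finset.range (n + 1), crossInc st w A (C.take (i + 1)) *
        walkInt st w (C.take (i + 1)) *
        (connInt st w (C.take (i + 1)) ((C.drop (i + 1)).take (n - i)) *
          walkInt st w ((C.drop (i + 1)).drop (n - i))) := by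
    intro n hn
    rw [Finset.mem_range] at hn
    have hne : C.take (n + 1) ≠ [] := by
      rw [Ne, List.take_eq_nil_iff]
      rintro (h | h)
      · omega
      · simp [h] at hn
    have hl : (C.take (n + 1)).length = n + 1 := by simp; omega
    rw [connInt_of_ne_nil st w A _ hne, Finset.sum_mul, Finset.sum_range]
    refine Fintype.sum_equiv (finCongr hl) _ _ fun i => ?_
    have hi : (i : ℕ) < n + 1 := by simpa [hl] using i.2
    simp only [finCongr_apply, Fin.val_cast]
    rw [List.take_take, List.drop_take, List.drop_drop, min_eq_left (by omega),
      show n + 1 - ((i : ℕ) + 1) = n - i by omega, show (i : ℕ) + 1 + (n - i) = n + 1 by omega]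
    ring
  rw [Finset.sum_congr rfl h1]
  have h2 : ∑ n ∈ Finset.range C.length, ∑ i ∈ Finset.range (n + 1),
        crossInc st w A (C.take (i + 1)) * walkInt st w (C.take (i + 1)) *
        (connInt st w (C.take (i + 1)) ((C.drop (i + 1)).take (n - i)) *
          walkInt st w ((C.drop (i + 1)).drop (n - i)))
      = ∑ i ∈ Finset.range C.length, ∑ m ∈ Finset.range (C.length - i),
        crossInc st w A (C.take (i + 1)) * walkInt st w (C.take (i + 1)) *
        (connInt st w (C.take (i + 1)) ((C.drop (i + 1)).take m) *
          walkInt st w ((C.drop (i + 1)).drop m)) := by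
    rw [Finset.sum_sigma', Finset.sum_sigma']
    refine Finset.sum_bij' (fun x _ => ⟨x.2, x.1 - x.2⟩) (fun x _ => ⟨x.1 + x.2, x.1⟩)
      ?_ ?_ ?_ ?_ ?_
    · rintro ⟨a, b⟩ h
      simp only [Finset.mem_sigma, Finset.mem_range] at h ⊢; omega
    · rintro ⟨a, b⟩ h
      simp only [Finset.mem_sigma, Finset.mem_range] at h ⊢; omega
    · rintro ⟨a, b⟩ h
      simp only [Finset.mem_sigma, Finset.mem_range] at h
      simp; omega
    · rintro ⟨a, b⟩ h
      simp
    · rintro ⟨a, b⟩ h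
      rfl
  rw [h2]
  have h3 : ∀ i ∈ Finset.range C.length, ∑ m ∈ Finset.range (C.length - i),
        crossInc st w A (C.take (i + 1)) * walkInt st w (C.take (i + 1)) *
        (connInt st w (C.take (i + 1)) ((C.drop (i + 1)).take m) *
          walkInt st w ((C.drop (i + 1)).drop m))
      = crossInc st w A (C.take (i + 1)) * walkInt st w C := by
    intro i hi
    rw [Finset.mem_range] at hi
    have hlen : (C.drop (i + 1)).length + 1 = C.length - i := by simp; omega
    rw [← Finset.mul_sum, ← hlen,
      ← ih (C.drop (i + 1)).length (by simp; omega) (C.take (i + 1)) (C.drop (i + 1)) rfl]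
    have := walkInt_append st w (C.take (i + 1)) (C.drop (i + 1))
    rw [List.take_append_drop] at this
    rw [this]; ring
  rw [Finset.sum_congr rfl h3, ← Finset.sum_mul, Finset.sum_range, crossInt_eq_sum]
  ring

/-- The (signed) weight of an irreducible piece of walk. A single step has weight one. -/
noncomputable def irrInt : List σ → ℝ
  | [] => 0
  | e :: C => connInt st w [e] C

lemma walkInt_renewal (ω : List σ) :
    walkInt st w ω = (if ω = [] then 1 else 0) +
      ∑ n ∈ Finset.range (ω.length + 1), irrInt st w (ω.take n) * walkInt st w (ω.drop n) := by
  cases ω with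
  | nil => simp [walkInt, irrInt]
  | cons e C =>
    rw [walkInt, connInt_expansion, List.length_cons, Finset.sum_range_succ' _ (C.length + 1)]
    simp [irrInt]

end Combinatorics

section Majorant

variable {σ M : Type*} [AddCommGroup M] (st : σ → M) {w : M → ℝ}

/-- The contribution with `N` laces to the majorant of the connected interaction. -/
noncomputable def laceMaj (κ : List σ → ℝ≥0∞) (w' : M → ℝ≥0∞) :
    ℕ → List σ → List σ → ℝ≥0∞
  | 0, A, C => if C = [] then κ A else 0
  | N + 1, A, C => ∑ n ∈ Finset.range (A.length + 1), κ (A.take n) * κ (A.drop n) *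
      ∑ m ∈ Finset.range (C.length + 1), w' (disp st (A.drop n) + disp st (C.take m)) *
        laceMaj κ w' N (C.take m) (C.drop m)

lemma abs_crossInc_le (hw : ∀ x, 0 ≤ w x ∧ w x ≤ 1) (A D : List σ) (hD : D ≠ []) :
    |crossInc st w A D| ≤ ∑ n ∈ Finset.range A.length, w (disp st (A.drop n) + disp st D) := by
  rw [crossInc_eq st w A D hD, abs_mul]
  have h1 := crossInt_mem st hw A 0 D.dropLast
  have h2 := pointInt_mem st hw A (disp st D)
  have h3 := one_sub_pointInt_le st hw A (disp st D)
  rw [abs_of_nonneg h1.1, abs_of_nonpos (by linarith)]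
  nlinarith

lemma ofReal_walkInt_le_split (hw : ∀ x, 0 ≤ w x ∧ w x ≤ 1) {κ : List σ → ℝ≥0∞}
    (hκ : ∀ ω, ENNReal.ofReal (walkInt st w ω) ≤ κ ω) (A : List σ) (n : ℕ) :
    ENNReal.ofReal (walkInt st w A) ≤ κ (A.take n) * κ (A.drop n) := by
  have h := walkInt_append_le st hw (A.take n) (A.drop n)
  rw [List.take_append_drop] at h
  refine (ENNReal.ofReal_le_ofReal h).trans ?_
  rw [ENNReal.ofReal_mul (walkInt_mem st hw _).1]
  exact mul_le_mul' (hκ _) (hκ _)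

lemma connInt_le_laceMaj (hw : ∀ x, 0 ≤ w x ∧ w x ≤ 1) {κ : List σ → ℝ≥0∞} {w' : M → ℝ≥0∞}
    (hκ : ∀ ω, ENNReal.ofReal (walkInt st w ω) ≤ κ ω)
    (hw' : ∀ x, ENNReal.ofReal (w x) ≤ w' x) (C P A : List σ) :
    ENNReal.ofReal (walkInt st w (P ++ A)) * ENNReal.ofReal |connInt st w A C|
      ≤ ∑' N, laceMaj st κ w' N (P ++ A) C := by
  induction hn : C.length using Nat.strong_induction_on generalizing P A C with
  | _ L ih =>
  subst hn
  by_cases hC : C = []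
  · subst hC
    rw [connInt_nil]
    refine le_trans ?_ (ENNReal.le_tsum 0)
    simpa [laceMaj] using hκ _
  have hstep : ∀ i : Fin C.length, ENNReal.ofReal (walkInt st w (P ++ A)) *
      ENNReal.ofReal |crossInc st w A (C.take (i + 1))| ≤
      ∑ n ∈ Finset.range ((P ++ A).length + 1), κ ((P ++ A).take n) * κ ((P ++ A).drop n) *
        w' (disp st ((P ++ A).drop n) + disp st (C.take (i + 1))) := by
    intro i
    have hne : C.take ((i : ℕ) + 1) ≠ [] := by
      rw [Ne, List.take_eq_nil_iff]; simp [hC]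
    have h1 := abs_crossInc_le st hw A _ hne
    calc _ ≤ ENNReal.ofReal (walkInt st w (P ++ A)) * ∑ n ∈ Finset.range A.length,
          w' (disp st (A.drop n) + disp st (C.take (i + 1))) := by
          gcongr
          refine (ENNReal.ofReal_le_ofReal h1).trans ?_
          rw [ENNReal.ofReal_sum_of_nonneg (fun _ _ => (hw _).1)]
          exact Finset.sum_le_sum fun _ _ => hw' _
      _ = ∑ n ∈ Finset.range A.length, ENNReal.ofReal (walkInt st w (P ++ A)) *
          w' (disp st (A.drop n) + disp st (C.take (i + 1))) := Finset.mul_sum _ _ _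
      _ ≤ ∑ n ∈ Finset.range A.length, κ ((P ++ A).take (P.length + n)) *
          κ ((P ++ A).drop (P.length + n)) *
          w' (disp st ((P ++ A).drop (P.length + n)) + disp st (C.take (i + 1))) := by
          refine Finset.sum_le_sum fun n _ => ?_
          rw [List.drop_length_add_append]
          gcongr
          have := ofReal_walkInt_le_split st hw hκ (P ++ A) (P.length + n)
          rwa [List.drop_length_add_append] at this
      _ ≤ _ := by
          rw [List.length_append, add_assoc, Finset.sum_range_add _ P.length (A.length + 1),
            Finset.sum_range_succ _ A.length, ← add_assoc]
          exact le_add_right (le_add_left le_rfl)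
  rw [connInt_of_ne_nil st w A C hC]
  have hrec : ∀ i : Fin C.length, ENNReal.ofReal (walkInt st w (C.take (i + 1))) *
      ENNReal.ofReal |connInt st w (C.take (i + 1)) (C.drop (i + 1))|
      ≤ ∑' N, laceMaj st κ w' N (C.take (i + 1)) (C.drop (i + 1)) := by
    intro i
    have hi := i.2
    exact ih _ (by rw [List.length_drop]; omega) (C.drop (i + 1)) [] (C.take (i + 1)) rfl
  have hK := fun D => (walkInt_mem st hw D).1
  calc _ ≤ ENNReal.ofReal (walkInt st w (P ++ A)) * ∑ i : Fin C.length,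
        ENNReal.ofReal |crossInc st w A (C.take (i + 1))| *
        (ENNReal.ofReal (walkInt st w (C.take (i + 1))) *
        ENNReal.ofReal |connInt st w (C.take (i + 1)) (C.drop (i + 1))|) := by
        gcongr
        refine (ENNReal.ofReal_le_ofReal (Finset.abs_sum_le_sum_abs _ _)).trans ?_
        rw [ENNReal.ofReal_sum_of_nonneg (fun _ _ => abs_nonneg _)]
        refine Finset.sum_le_sum fun i _ => ?_
        rw [abs_mul, abs_mul, abs_of_nonneg (hK _), ENNReal.ofReal_mul (by
          have := hK (C.take (i + 1)); positivity), ENNReal.ofReal_mul (abs_nonneg _), mul_assoc]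
    _ ≤ ∑ i : Fin C.length, (∑ n ∈ Finset.range ((P ++ A).length + 1),
        κ ((P ++ A).take n) * κ ((P ++ A).drop n) *
        w' (disp st ((P ++ A).drop n) + disp st (C.take (i + 1)))) *
        ∑' N, laceMaj st κ w' N (C.take (i + 1)) (C.drop (i + 1)) := by
        rw [Finset.mul_sum]
        refine Finset.sum_le_sum fun i _ => ?_
        rw [← mul_assoc]
        exact mul_le_mul' (hstep i) (hrec i)
    _ ≤ ∑ n ∈ Finset.range ((P ++ A).length + 1), κ ((P ++ A).take n) * κ ((P ++ A).drop n) *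
          ∑ m ∈ Finset.range (C.length + 1),
          w' (disp st ((P ++ A).drop n) + disp st (C.take m)) *
        ∑' N, laceMaj st κ w' N (C.take m) (C.drop m) := by
        simp_rw [Finset.sum_mul]
        rw [Finset.sum_comm]
        refine Finset.sum_le_sum fun n _ => ?_
        rw [Finset.sum_range_succ', mul_add, Finset.sum_range]
        refine le_add_right ?_
        rw [Finset.mul_sum]
        exact Finset.sum_le_sum fun i _ => by rw [mul_assoc]
    _ = ∑' N, laceMaj st κ w' (N + 1) (P ++ A) C := by
        simp only [laceMaj]
        rw [Summable.tsum_finsetSum (fun _ _ => ENNReal.summable)]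
        refine Finset.sum_congr rfl fun n _ => ?_
        rw [ENNReal.tsum_mul_left, Summable.tsum_finsetSum (fun _ _ => ENNReal.summable)]
        simp_rw [ENNReal.tsum_mul_left]
    _ ≤ _ := by
        exact ENNReal.tsum_comp_le_tsum_of_injective Nat.succ_injective
          (fun N => laceMaj st κ w' N (P ++ A) C)

lemma irrInt_le_laceMaj (hw : ∀ x, 0 ≤ w x ∧ w x ≤ 1 / 2) {κ : List σ → ℝ≥0∞} {w' : M → ℝ≥0∞}
    (hκ : ∀ ω, ENNReal.ofReal (walkInt st w ω) ≤ κ ω)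
    (hw' : ∀ x, ENNReal.ofReal (w x) ≤ w' x) (e : σ) (C : List σ) (hC : C ≠ []) :
    ENNReal.ofReal |irrInt st w (e :: C)| ≤ 2 * ∑ m ∈ Finset.range ((e :: C).length + 1),
      w' (disp st ((e :: C).take m)) *
        ∑' N, laceMaj st κ w' N ((e :: C).take m) ((e :: C).drop m) := by
  have hw1 : ∀ x, 0 ≤ w x ∧ w x ≤ 1 := fun x => ⟨(hw x).1, (hw x).2.trans (by norm_num)⟩
  have hterm : ∀ i : Fin C.length, |crossInc st w [e] (C.take (i + 1)) *
      walkInt st w (C.take (i + 1)) * connInt st w (C.take (i + 1)) (C.drop (i + 1))| ≤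
      2 * (w (disp st (e :: C.take (i + 1))) * (walkInt st w (e :: C.take (i + 1)) *
        |connInt st w (C.take (i + 1)) (C.drop (i + 1))|)) := by
    intro i
    have hne : C.take ((i : ℕ) + 1) ≠ [] := by
      rw [Ne, List.take_eq_nil_iff]; simp [hC]
    set D := C.take ((i : ℕ) + 1) with hD
    have h : D.dropLast ++ [D.getLast hne] = D := List.dropLast_append_getLast hne
    have hp : pointInt st w [e] (disp st D) = 1 - w (disp st (e :: D)) := by
      simp [pointInt]
    have h1 : crossInt st w [e] 0 D
        = crossInt st w [e] 0 D.dropLast * pointInt st w [e] (disp st D) := by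
      conv_lhs => rw [← h]
      rw [crossInt_append]
      conv_rhs => rw [← h]
      simp [crossInt]
    have hK := walkInt_mem st hw1 D
    have hc := crossInt_mem st hw1 [e] 0 D.dropLast
    obtain ⟨hw0, hw2⟩ := hw (disp st (e :: D))
    rw [crossInc_eq st w _ _ hne, abs_mul, abs_mul, abs_mul, abs_of_nonneg hK.1,
      abs_of_nonneg hc.1, hp, walkInt, h1, hp,
      show 1 - w (disp st (e :: D)) - 1 = -w (disp st (e :: D)) by ring, abs_neg,
      abs_of_nonneg hw0]
    have h2 : crossInt st w [e] 0 D.dropLast * w (disp st (e :: D)) ≤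
      2 * (w (disp st (e :: D)) * (crossInt st w [e] 0 D.dropLast *
        (1 - w (disp st (e :: D))))) := by
      have := mul_nonneg (mul_nonneg hc.1 hw0) (by linarith : 0 ≤ 1 - 2 * w (disp st (e :: D)))
      linarith
    calc _ ≤ 2 * (w (disp st (e :: D)) * (crossInt st w [e] 0 D.dropLast *
        (1 - w (disp st (e :: D))))) * walkInt st w D *
          |connInt st w D (C.drop (i + 1))| := by
          gcongr
          exact hK.1
      _ = _ := by ring
  have hbound : |irrInt st w (e :: C)| ≤ 2 * ∑ i : Fin C.length,
      w (disp st (e :: C.take (i + 1))) * (walkInt st w (e :: C.take (i + 1)) *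
        |connInt st w (C.take (i + 1)) (C.drop (i + 1))|) := by
    rw [irrInt, connInt_of_ne_nil st w _ C hC, Finset.mul_sum]
    exact (Finset.abs_sum_le_sum_abs _ _).trans (Finset.sum_le_sum fun i _ => hterm i)
  have hK := fun D => (walkInt_mem st hw1 D).1
  have hnn : ∀ i : Fin C.length, 0 ≤ w (disp st (e :: C.take (i + 1))) *
      (walkInt st w (e :: C.take (i + 1)) *
        |connInt st w (C.take (i + 1)) (C.drop (i + 1))|) := fun i =>
    mul_nonneg (hw _).1 (mul_nonneg (hK _) (abs_nonneg _))
  refine (ENNReal.ofReal_le_ofReal hbound).trans ?_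
  rw [ENNReal.ofReal_mul (by norm_num), ENNReal.ofReal_ofNat,
    ENNReal.ofReal_sum_of_nonneg (fun i _ => hnn i)]
  gcongr
  rw [List.length_cons, Finset.sum_range_succ', Finset.sum_range_succ', Finset.sum_range]
  refine le_add_right (le_add_right (Finset.sum_le_sum fun i _ => ?_))
  rw [ENNReal.ofReal_mul (hw _).1, ENNReal.ofReal_mul (hK _)]
  refine mul_le_mul' (hw' _) ?_
  exact connInt_le_laceMaj st hw1 hκ hw' (C.drop (i + 1)) [e] (C.take (i + 1))

lemma irrInt_singleton (e : σ) : irrInt st w [e] = 1 := connInt_nil _ _ _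

end Majorant

section Extensionality

variable {σ M : Type*} [AddCommGroup M] (st : σ → M) {w₁ w₂ : M → ℝ}

lemma pointInt_congr (A B : List σ)
    (h : ∀ v, v <:+: A ++ B → v ≠ [] → w₁ (disp st v) = w₂ (disp st v)) :
    pointInt st w₁ A (disp st B) = pointInt st w₂ A (disp st B) := by
  induction A with
  | nil => rfl
  | cons e A ih =>
    rw [pointInt, pointInt, ← disp_append, h (e :: A ++ B) List.infix_rfl (by simp), ih]
    exact fun v hv => h v (hv.trans (List.suffix_cons e (A ++ B)).isInfix)

lemma crossInt_congr (A B C : List σ)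
    (h : ∀ v, v <:+: A ++ B ++ C → v ≠ [] → w₁ (disp st v) = w₂ (disp st v)) :
    crossInt st w₁ A (disp st B) C = crossInt st w₂ A (disp st B) C := by
  induction C generalizing B with
  | nil => rfl
  | cons f C ih =>
    have e1 : disp st B + st f = disp st (B ++ [f]) := by simp
    rw [crossInt, crossInt, e1, ih (B ++ [f]) (by simpa using h), pointInt_congr]
    intro v hv
    refine h v (hv.trans ?_)
    rw [← List.append_assoc]
    exact ⟨[], C, by simp⟩

lemma crossInc_congr (A C : List σ)
    (h : ∀ v, v <:+: A ++ C → v ≠ [] → w₁ (disp st v) = w₂ (disp st v)) :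
    crossInc st w₁ A C = crossInc st w₂ A C := by
  have h1 := crossInt_congr st A [] C (by simpa using h)
  have h2 := crossInt_congr st A [] C.dropLast (w₁ := w₁) (w₂ := w₂) (by
    simp only [List.append_nil]
    refine fun v hv => h v (hv.trans ?_)
    exact ((List.prefix_append_right_inj A).2 (List.dropLast_prefix C)).isInfix)
  rw [crossInc, crossInc]
  simp only [disp_nil] at h1 h2
  rw [h1, h2]

lemma walkInt_congr (ω : List σ)
    (h : ∀ v, v <:+: ω → v ≠ [] → w₁ (disp st v) = w₂ (disp st v)) :
    walkInt st w₁ ω = walkInt st w₂ ω := by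
  induction ω with
  | nil => rfl
  | cons e ω ih =>
    have h1 := crossInt_congr st [e] [] ω (by simpa using h)
    simp only [disp_nil] at h1
    rw [walkInt, walkInt, h1, ih]
    exact fun v hv => h v (hv.trans (List.suffix_cons e ω).isInfix)

lemma connInt_congr (A C : List σ)
    (h : ∀ v, v <:+: A ++ C → v ≠ [] → w₁ (disp st v) = w₂ (disp st v)) :
    connInt st w₁ A C = connInt st w₂ A C := by
  induction hn : C.length using Nat.strong_induction_on generalizing A C with
  | _ L ih =>
  subst hn
  by_cases hC : C = []
  · subst hC; rw [connInt_nil, connInt_nil]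
  rw [connInt_of_ne_nil _ _ _ _ hC, connInt_of_ne_nil _ _ _ _ hC]
  refine Finset.sum_congr rfl fun i _ => ?_
  have hi := i.2
  have hsub : C <:+: A ++ C := (List.suffix_append A C).isInfix
  congr 1
  · congr 1
    · refine crossInc_congr st _ _ fun v hv => h v (hv.trans ?_)
      exact ((List.prefix_append_right_inj A).2 (List.take_prefix _ C)).isInfix
    · exact walkInt_congr st _ fun v hv =>
        h v ((hv.trans (List.take_prefix _ C).isInfix).trans hsub)
  · refine ih _ (by rw [List.length_drop]; omega) _ _ (fun v hv => h v ?_) rfl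
    rw [List.take_append_drop] at hv
    exact hv.trans hsub

lemma irrInt_congr (ω : List σ)
    (h : ∀ v, v <:+: ω → v ≠ [] → w₁ (disp st v) = w₂ (disp st v)) :
    irrInt st w₁ ω = irrInt st w₂ ω := by
  cases ω with
  | nil => rfl
  | cons e C => exact connInt_congr st [e] C h

end Extensionality

section ListSums

variable {α : Type*}

/-- The pairs of consecutive words concatenating to a given word. -/
noncomputable def splitEquiv (σ : Type*) :
    (Σ ω : List σ, Fin (ω.length + 1)) ≃ List σ × List σ :=
  Equiv.ofBijective (fun x => (x.1.take x.2, x.1.drop x.2)) (by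
    constructor
    · rintro ⟨ω, n, hn⟩ ⟨ω', n', hn'⟩ h
      simp only [Prod.mk.injEq] at h
      obtain rfl : ω = ω' := by
        rw [← List.take_append_drop n ω, h.1, h.2, List.take_append_drop]
      have h1 := congrArg List.length h.1
      simp only [List.length_take] at h1
      obtain rfl : n = n' := by omega
      rfl
    · rintro ⟨u, v⟩
      exact ⟨⟨u ++ v, ⟨u.length, by simp⟩⟩, by simp⟩)

lemma tsum_split {σ : Type*} (F : List σ → List σ → ℝ≥0∞) :
    ∑' ω : List σ, ∑ n ∈ Finset.range (ω.length + 1), F (ω.take n) (ω.drop n)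
      = ∑' u, ∑' v, F u v := by
  calc _ = ∑' ω : List σ, ∑' n : Fin (ω.length + 1), F (ω.take n) (ω.drop n) := by
        refine tsum_congr fun ω => ?_
        rw [Finset.sum_range, tsum_fintype]
    _ = ∑' x : (Σ ω : List σ, Fin (ω.length + 1)), F (x.1.take x.2) (x.1.drop x.2) :=
        (ENNReal.tsum_sigma' (β := fun ω : List σ => Fin (ω.length + 1))
          fun x => F (x.1.take x.2) (x.1.drop x.2)).symm
    _ = ∑' y : List σ × List σ, F y.1 y.2 :=
        (splitEquiv σ).tsum_eq (fun y : List σ × List σ => F y.1 y.2)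
    _ = _ := ENNReal.tsum_prod

/-- Iterated sum over lists with the given weights for the successive entries. -/
noncomputable def msum : List (α → ℝ≥0∞) → (List α → ℝ≥0∞) → ℝ≥0∞
  | [], Ψ => Ψ []
  | f :: fs, Ψ => ∑' a, f a * msum fs fun l => Ψ (a :: l)

lemma msum_mono (fs : List (α → ℝ≥0∞)) {Ψ Φ : List α → ℝ≥0∞}
    (h : ∀ l, l.length = fs.length → Ψ l ≤ Φ l) : msum fs Ψ ≤ msum fs Φ := by
  induction fs generalizing Ψ Φ with
  | nil => exact h [] rfl
  | cons f fs ih =>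
    refine ENNReal.tsum_le_tsum fun a => ?_
    exact mul_le_mul' le_rfl (ih fun l hl => h _ (by simp [hl]))

lemma msum_add (fs : List (α → ℝ≥0∞)) (Ψ Φ : List α → ℝ≥0∞) :
    msum fs (fun l => Ψ l + Φ l) = msum fs Ψ + msum fs Φ := by
  induction fs generalizing Ψ Φ with
  | nil => rfl
  | cons f fs ih => simp only [msum, ih, mul_add, ENNReal.tsum_add]

lemma msum_const_mul (fs : List (α → ℝ≥0∞)) (c : ℝ≥0∞) (Ψ : List α → ℝ≥0∞) :
    msum fs (fun l => c * Ψ l) = c * msum fs Ψ := by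
  induction fs generalizing Ψ with
  | nil => rfl
  | cons f fs ih =>
    simp only [msum, ih, ← ENNReal.tsum_mul_left]
    exact tsum_congr fun a => by ring

lemma msum_zero (fs : List (α → ℝ≥0∞)) : msum fs (fun _ => 0) = 0 := by
  induction fs with
  | nil => rfl
  | cons f fs ih => simp [msum, ih]

lemma msum_sum {ι : Type*} (fs : List (α → ℝ≥0∞)) (s : Finset ι) (Ψ : ι → List α → ℝ≥0∞) :
    msum fs (fun l => ∑ i ∈ s, Ψ i l) = ∑ i ∈ s, msum fs (Ψ i) := by
  classical
  induction s using Finset.induction_on with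
  | empty => simp [msum_zero]
  | insert a s ha ih => simp only [Finset.sum_insert ha, msum_add, ih]

/-- The push-forward of a weight. -/
noncomputable def pushF {ι : Type*} (π : α → ι) (f : α → ℝ≥0∞) (y : ι) : ℝ≥0∞ :=
  open Classical in ∑' a, if π a = y then f a else 0

lemma tsum_pushF {ι : Type*} (π : α → ι) (f : α → ℝ≥0∞) (g : ι → ℝ≥0∞) :
    ∑' y, pushF π f y * g y = ∑' a, f a * g (π a) := by
  classical
  simp only [pushF, ← ENNReal.tsum_mul_right]
  rw [ENNReal.tsum_comm]
  refine tsum_congr fun a => ?_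
  rw [tsum_eq_single (π a)]
  · simp
  · intro y hy; simp [hy.symm]

lemma msum_map {ι : Type*} (π : α → ι) (fs : List (α → ℝ≥0∞)) (Ψ : List ι → ℝ≥0∞) :
    msum fs (fun l => Ψ (l.map π)) = msum (fs.map (pushF π)) Ψ := by
  induction fs generalizing Ψ with
  | nil => rfl
  | cons f fs ih =>
    simp only [msum, List.map_cons, tsum_pushF, ← ih]

end ListSums

section Ladder

variable {A : Type*} [AddCommGroup A]

/-- The displacement constraints of the successive lines of a lace diagram. -/
def ladder : A → List A → Prop
  | _, [] => False
  | x, [y] => y = x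
  | x, y₁ :: y₂ :: l => y₁ + y₂ = x ∧ ladder (-y₂) l

/-- The indicator function of the displacement constraints. -/
noncomputable def ladderInd (x : A) (l : List A) : ℝ≥0∞ :=
  open Classical in if ladder x l then 1 else 0

/-- The unit mass at the origin. -/
noncomputable def zeroInd (x : A) : ℝ≥0∞ :=
  open Classical in if x = 0 then 1 else 0

lemma ladderInd_singleton (x y : A) : ladderInd x [y] = zeroInd (y - x) := by
  classical
  by_cases h : y = x <;> simp [ladderInd, zeroInd, ladder, sub_eq_zero, h]

lemma ladderInd_cons_cons (x y₁ y₂ : A) (l : List A) :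
    ladderInd x (y₁ :: y₂ :: l) = zeroInd (y₁ + y₂ - x) * ladderInd (-y₂) l := by
  classical
  by_cases h : y₁ + y₂ = x <;> by_cases h2 : ladder (-y₂) l <;>
    simp [ladderInd, zeroInd, ladder, sub_eq_zero, h, h2]

variable {σ M : Type*} [AddCommGroup M] (st : σ → M) (φ : M →+ A)

lemma laceMaj_sum (κ : List σ → ℝ≥0∞) (b q : ℝ≥0∞) (N : ℕ) (x : A) (Ψ : List σ → ℝ≥0∞) :
    ∑' u : List σ, ∑' v : List σ, zeroInd (φ (disp st u) - x) *
        laceMaj st κ (fun y => b * zeroInd (φ y)) N u v * q ^ (u.length + v.length) * Ψ (u ++ v)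
      = b ^ N * msum (List.replicate (2 * N + 1) fun γ => κ γ * q ^ γ.length)
          (fun γs => ladderInd x (γs.map fun γ => φ (disp st γ)) * Ψ γs.flatten) := by
  induction N generalizing x Ψ with
  | zero =>
    simp only [laceMaj, pow_zero, one_mul, mul_zero, zero_add, List.replicate_one, msum,
      List.map_cons, List.map_nil, ladderInd_singleton]
    refine tsum_congr fun u => ?_
    rw [tsum_eq_single []]
    · simp; ring
    · intro v hv; simp [hv]
  | succ N ih =>
    have e1 : 2 * (N + 1) + 1 = 2 * N + 1 + 1 + 1 := by ring
    simp only [laceMaj]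
    calc _ = ∑' u : List σ, ∑ n ∈ Finset.range (u.length + 1), ∑' v : List σ,
          ∑ m ∈ Finset.range (v.length + 1),
          zeroInd (φ (disp st (u.take n)) + φ (disp st (u.drop n)) - x) *
          (κ (u.take n) * q ^ (u.take n).length) * (κ (u.drop n) * q ^ (u.drop n).length) *
          (b * zeroInd (φ (disp st (v.take m)) - -φ (disp st (u.drop n))) *
            laceMaj st κ (fun y => b * zeroInd (φ y)) N (v.take m) (v.drop m) *
            q ^ ((v.take m).length + (v.drop m).length)) *
            Ψ (u.take n ++ (u.drop n ++ (v.take m ++ v.drop m))) := by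
          refine tsum_congr fun u => ?_
          rw [← Summable.tsum_finsetSum (fun _ _ => ENNReal.summable)]
          refine tsum_congr fun v => ?_
          rw [Finset.mul_sum, Finset.sum_mul, Finset.sum_mul]
          refine Finset.sum_congr rfl fun n hn => ?_
          rw [Finset.mul_sum, Finset.mul_sum, Finset.sum_mul, Finset.sum_mul]
          refine Finset.sum_congr rfl fun m hm => ?_
          have hu : u.length = (u.take n).length + (u.drop n).length := by
            rw [← List.length_append, List.take_append_drop]
          have hv : v.length = (v.take m).length + (v.drop m).length := by
            rw [← List.length_append, List.take_append_drop]
          have hd : disp st u = disp st (u.take n) + disp st (u.drop n) := by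
            rw [← disp_append, List.take_append_drop]
          have hΨ : u.take n ++ (u.drop n ++ (v.take m ++ v.drop m)) = u ++ v := by
            rw [List.take_append_drop m v, ← List.append_assoc, List.take_append_drop]
          rw [hΨ, sub_neg_eq_add, hd, map_add, map_add, hu, hv, pow_add, pow_add, pow_add,
            add_comm (φ (disp st (v.take m)))]
          ring
      _ = ∑' a₁ : List σ, ∑' a₂ : List σ, ∑' v : List σ, ∑ m ∈ Finset.range (v.length + 1),
          zeroInd (φ (disp st a₁) + φ (disp st a₂) - x) *
          (κ a₁ * q ^ a₁.length) * (κ a₂ * q ^ a₂.length) *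
          (b * zeroInd (φ (disp st (v.take m)) - -φ (disp st a₂)) *
            laceMaj st κ (fun y => b * zeroInd (φ y)) N (v.take m) (v.drop m) *
            q ^ ((v.take m).length + (v.drop m).length)) *
            Ψ (a₁ ++ (a₂ ++ (v.take m ++ v.drop m))) := by
          exact tsum_split (fun a₁ a₂ => ∑' v : List σ, ∑ m ∈ Finset.range (v.length + 1),
          zeroInd (φ (disp st a₁) + φ (disp st a₂) - x) *
          (κ a₁ * q ^ a₁.length) * (κ a₂ * q ^ a₂.length) *
          (b * zeroInd (φ (disp st (v.take m)) - -φ (disp st a₂)) *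
            laceMaj st κ (fun y => b * zeroInd (φ y)) N (v.take m) (v.drop m) *
            q ^ ((v.take m).length + (v.drop m).length)) *
            Ψ (a₁ ++ (a₂ ++ (v.take m ++ v.drop m))))
      _ = ∑' a₁ : List σ, ∑' a₂ : List σ, zeroInd (φ (disp st a₁) + φ (disp st a₂) - x) *
          (κ a₁ * q ^ a₁.length) * (κ a₂ * q ^ a₂.length) * b *
          ∑' u : List σ, ∑' v : List σ, zeroInd (φ (disp st u) - -φ (disp st a₂)) *
            laceMaj st κ (fun y => b * zeroInd (φ y)) N u v *
            q ^ (u.length + v.length) * (fun ω => Ψ (a₁ ++ (a₂ ++ ω))) (u ++ v) := by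
          refine tsum_congr fun a₁ => tsum_congr fun a₂ => ?_
          rw [tsum_split (fun u v => zeroInd (φ (disp st a₁) + φ (disp st a₂) - x) *
          (κ a₁ * q ^ a₁.length) * (κ a₂ * q ^ a₂.length) *
          (b * zeroInd (φ (disp st u) - -φ (disp st a₂)) *
            laceMaj st κ (fun y => b * zeroInd (φ y)) N u v *
            q ^ (u.length + v.length)) * Ψ (a₁ ++ (a₂ ++ (u ++ v)))), ← ENNReal.tsum_mul_left]
          refine tsum_congr fun u => ?_
          rw [← ENNReal.tsum_mul_left]
          refine tsum_congr fun v => ?_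
          ring
      _ = _ := by
          rw [e1, List.replicate_succ, List.replicate_succ, msum, ← ENNReal.tsum_mul_left]
          refine tsum_congr fun a₁ => ?_
          rw [msum, ← ENNReal.tsum_mul_left, ← ENNReal.tsum_mul_left]
          refine tsum_congr fun a₂ => ?_
          rw [ih (-φ (disp st a₂)) (fun ω => Ψ (a₁ ++ (a₂ ++ ω)))]
          simp only [List.map_cons, ladderInd_cons_cons, List.flatten_cons, mul_assoc,
            msum_const_mul]
          ring

/-- The irreducible weights are dominated by lace diagrams. -/
lemma irrInt_sum_le {w : M → ℝ} (hw : ∀ x, 0 ≤ w x ∧ w x ≤ 1 / 2) {κ : List σ → ℝ≥0∞}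
    {b : ℝ≥0∞} (q : ℝ≥0∞) (hκ : ∀ ω, ENNReal.ofReal (walkInt st w ω) ≤ κ ω)
    (hw' : ∀ x, ENNReal.ofReal (w x) ≤ b * zeroInd (φ x)) (Ψ : List σ → ℝ≥0∞) :
    ∑' ω : List σ, (if 2 ≤ ω.length then
        ENNReal.ofReal |irrInt st w ω| * q ^ ω.length * Ψ ω else 0) ≤
      2 * b * ∑' N, b ^ N * msum (List.replicate (2 * N + 1) fun γ => κ γ * q ^ γ.length)
          (fun γs => ladderInd 0 (γs.map fun γ => φ (disp st γ)) * Ψ γs.flatten) := by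
  calc _ ≤ ∑' ω : List σ, ∑ m ∈ Finset.range (ω.length + 1),
        2 * (b * zeroInd (φ (disp st (ω.take m)))) *
          (∑' N, laceMaj st κ (fun y => b * zeroInd (φ y)) N (ω.take m) (ω.drop m)) *
          q ^ ((ω.take m).length + (ω.drop m).length) * Ψ (ω.take m ++ ω.drop m) := by
        refine ENNReal.tsum_le_tsum fun ω => ?_
        split_ifs with h
        · match ω, h with
          | e :: f :: C, _ =>
          have := irrInt_le_laceMaj st hw hκ hw' e (f :: C) (by simp)
          refine (mul_le_mul' (mul_le_mul' this le_rfl) le_rfl).trans (le_of_eq ?_)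
          rw [mul_assoc, Finset.mul_sum, Finset.sum_mul]
          refine Finset.sum_congr rfl fun m _ => ?_
          rw [← List.length_append, List.take_append_drop]
          ring
        · exact zero_le
    _ = _ := by
        rw [tsum_split (fun u v => 2 * (b * zeroInd (φ (disp st u))) *
          (∑' N, laceMaj st κ (fun y => b * zeroInd (φ y)) N u v) *
          q ^ (u.length + v.length) * Ψ (u ++ v))]
        simp only [← laceMaj_sum]
        rw [ENNReal.tsum_comm (f := fun N u => ∑' v, _), ← ENNReal.tsum_mul_left]
        refine tsum_congr fun u => ?_
        rw [ENNReal.tsum_comm, ← ENNReal.tsum_mul_left]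
        refine tsum_congr fun v => ?_
        simp only [← ENNReal.tsum_mul_left, ← ENNReal.tsum_mul_right, sub_zero]
        exact tsum_congr fun N => by ring

end Ladder

section SquareSums

/-- `b` bounds the `ℓ²` norm of `f`. -/
def SqSumLE {α : Type*} (f : α → ℝ≥0∞) (b : ℝ≥0∞) : Prop := ∑' y, f y ^ 2 ≤ b ^ 2

lemma SqSumLE.mono {α : Type*} {f g : α → ℝ≥0∞} {b c : ℝ≥0∞} (h : SqSumLE g b)
    (hfg : ∀ y, f y ≤ g y) (hbc : b ≤ c) : SqSumLE f c :=
  (ENNReal.tsum_le_tsum fun y => pow_le_pow_left' (hfg y) 2).trans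
    (le_trans h (pow_le_pow_left' hbc 2))

lemma SqSumLE.comp_equiv {α : Type*} {f : α → ℝ≥0∞} {b : ℝ≥0∞} (h : SqSumLE f b) (e : α ≃ α) :
    SqSumLE (fun y => f (e y)) b := by
  rw [SqSumLE, e.tsum_eq (fun y => f y ^ 2)]; exact h

lemma tsum_mul_sq_le {α : Type*} (f g : α → ℝ≥0∞) :
    (∑' y, f y * g y) ^ 2 ≤ (∑' y, f y ^ 2) * ∑' y, g y ^ 2 := by
  let _ : MeasurableSpace α := ⊤
  have h := ENNReal.lintegral_mul_le_Lp_mul_Lq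
    (MeasureTheory.Measure.count : MeasureTheory.Measure α)
    (p := 2) (q := 2) (by constructor <;> norm_num)
    (measurable_from_top (f := f)).aemeasurable
    (measurable_from_top (f := g)).aemeasurable
  simp only [Pi.mul_apply, MeasureTheory.lintegral_count' measurable_from_top,
    ENNReal.rpow_two] at h
  refine (pow_le_pow_left' h 2).trans (le_of_eq ?_)
  rw [mul_pow, ← ENNReal.rpow_natCast, ← ENNReal.rpow_natCast, ← ENNReal.rpow_mul,
    ← ENNReal.rpow_mul]
  norm_num

lemma SqSumLE.tsum_mul_le {α : Type*} {f g : α → ℝ≥0∞} {b c : ℝ≥0∞} (hf : SqSumLE f b)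
    (hg : SqSumLE g c) : ∑' y, f y * g y ≤ b * c := by
  have h := (tsum_mul_sq_le f g).trans (mul_le_mul' hf hg)
  rw [← mul_pow] at h
  exact (ENNReal.pow_le_pow_left_iff two_ne_zero).1 h

variable {A : Type*} [AddCommGroup A]

/-- Young's inequality for `ℓ² * ℓ¹`. -/
lemma SqSumLE.conv {f u : A → ℝ≥0∞} {b c : ℝ≥0∞} (hf : SqSumLE f b) (hu : ∑' y, u y ≤ c) :
    SqSumLE (fun x => ∑' y, f (x - y) * u y) (b * c) := by
  have h1 : ∀ x, (∑' y, f (x - y) * u y) ^ 2 ≤ (∑' y, f (x - y) ^ 2 * u y) * c := by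
    intro x
    have := tsum_mul_sq_le (fun y => f (x - y) * u y ^ (1 / 2 : ℝ)) fun y => u y ^ (1 / 2 : ℝ)
    have e : ∀ y, u y ^ (1 / 2 : ℝ) * u y ^ (1 / 2 : ℝ) = u y := fun y => by
      rw [← ENNReal.rpow_add_of_nonneg _ _ (by norm_num) (by norm_num)]; norm_num
    simp only [mul_pow, mul_assoc, e, sq (u _ ^ (1 / 2 : ℝ))] at this
    exact this.trans (mul_le_mul' le_rfl hu)
  calc _ ≤ ∑' x, (∑' y, f (x - y) ^ 2 * u y) * c := ENNReal.tsum_le_tsum h1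
    _ = (∑' y, (∑' x, f (x - y) ^ 2) * u y) * c := by
      rw [ENNReal.tsum_mul_right, ENNReal.tsum_comm]
      simp only [ENNReal.tsum_mul_right]
    _ = (∑' y, (∑' x, f x ^ 2) * u y) * c := by
      congr 1
      refine tsum_congr fun y => ?_
      rw [← (Equiv.subRight y).tsum_eq (fun x => f x ^ 2)]
      rfl
    _ ≤ (b ^ 2 * c) * c := by
      rw [ENNReal.tsum_mul_left]
      exact mul_le_mul' (mul_le_mul' hf hu) le_rfl
    _ = _ := by ring

lemma SqSumLE.conv_le {f g : A → ℝ≥0∞} {b c : ℝ≥0∞} (hf : SqSumLE f b) (hg : SqSumLE g c)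
    (x : A) : ∑' y, f (x - y) * g y ≤ b * c :=
  (hf.comp_equiv (Equiv.subLeft x)).tsum_mul_le hg

end SquareSums

section LadderBounds

variable {A : Type*} [AddCommGroup A]

/-- The sum over the displacements of the lines of a lace diagram. -/
noncomputable def ladderSum (fs : List (A → ℝ≥0∞)) (x : A) : ℝ≥0∞ := msum fs (ladderInd x)

lemma tsum_mul_zeroInd (f : A → ℝ≥0∞) (x : A) : ∑' y, f y * zeroInd (y - x) = f x := by
  classical
  rw [tsum_eq_single x]
  · simp [zeroInd]
  · intro y hy; simp [zeroInd, sub_eq_zero, hy]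

lemma ladderSum_nil (x : A) : ladderSum [] x = 0 := by simp [ladderSum, msum, ladderInd, ladder]

lemma ladderSum_singleton (f : A → ℝ≥0∞) (x : A) : ladderSum [f] x = f x := by
  simp only [ladderSum, msum, ladderInd_singleton, tsum_mul_zeroInd]

lemma ladderSum_cons_cons (f g : A → ℝ≥0∞) (l : List (A → ℝ≥0∞)) (x : A) :
    ladderSum (f :: g :: l) x = ∑' y, f (x - y) * (g y * ladderSum l (-y)) := by
  simp only [ladderSum, msum, ladderInd_cons_cons, msum_const_mul]
  simp only [← ENNReal.tsum_mul_left]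
  rw [ENNReal.tsum_comm]
  refine tsum_congr fun y => ?_
  rw [← tsum_mul_zeroInd (fun y₁ => f y₁ * (g y * msum l (ladderInd (-y)))) (x - y)]
  refine tsum_congr fun y₁ => ?_
  rw [show y₁ + y - x = y₁ - (x - y) by abel]
  ring

lemma sqSumLE_ladderSum {b : ℝ≥0∞} (fs : List (A → ℝ≥0∞)) (h : ∀ f ∈ fs, SqSumLE f b) :
    SqSumLE (ladderSum fs) (b ^ fs.length) := by
  match fs, h with
  | [], _ => simp [SqSumLE, ladderSum_nil]
  | [f], h => simpa [SqSumLE, ladderSum_singleton] using h f (by simp)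
  | f :: g :: l, h =>
    have ih := sqSumLE_ladderSum l fun f hf => h f (by simp [hf])
    have hg := (h g (by simp)).tsum_mul_le (ih.comp_equiv (Equiv.neg A))
    have := (h f (by simp)).conv hg
    simp only [Equiv.neg_apply] at this
    convert this using 1
    · funext x; exact ladderSum_cons_cons f g l x
    · simp only [List.length_cons]; ring

/-- A diagram with one bounded line and square-summable other lines is bounded. -/
lemma ladderSum_le {b c : ℝ≥0∞} (pre post : List (A → ℝ≥0∞)) (f : A → ℝ≥0∞)
    (hpre : ∀ f ∈ pre, SqSumLE f b) (hpost : ∀ f ∈ post, SqSumLE f b) (hf : ∀ x, f x ≤ c) (x : A) :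
    ladderSum (pre ++ f :: post) x ≤ c * b ^ (pre.length + post.length) := by
  match pre, hpre with
  | [], _ =>
    match post, hpost with
    | [], _ => simpa [ladderSum_singleton] using hf x
    | g :: l, hpost =>
      have ih := sqSumLE_ladderSum l fun f hf => hpost f (by simp [hf])
      have hg := (hpost g (by simp)).tsum_mul_le (ih.comp_equiv (Equiv.neg A))
      rw [List.nil_append, ladderSum_cons_cons]
      calc _ ≤ ∑' y, c * (g y * ladderSum l (-y)) :=
            ENNReal.tsum_le_tsum fun y => mul_le_mul' (hf _) le_rfl
        _ ≤ c * (b * b ^ l.length) := by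
            rw [ENNReal.tsum_mul_left]; exact mul_le_mul' le_rfl hg
        _ = _ := by simp only [List.length_nil, List.length_cons]; ring
  | [g], hpre =>
    have ih := sqSumLE_ladderSum post hpost
    have hg := ((hpre g (by simp)).comp_equiv (Equiv.subLeft x)).tsum_mul_le
      (ih.comp_equiv (Equiv.neg A))
    rw [List.singleton_append, ladderSum_cons_cons]
    calc _ ≤ ∑' y, c * (g (x - y) * ladderSum post (-y)) := by
          refine ENNReal.tsum_le_tsum fun y => ?_
          calc _ ≤ g (x - y) * (c * ladderSum post (-y)) :=
                mul_le_mul' le_rfl (mul_le_mul' (hf _) le_rfl)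
            _ = _ := by ring
      _ ≤ c * (b * b ^ post.length) := by
          rw [ENNReal.tsum_mul_left]; exact mul_le_mul' le_rfl hg
      _ = _ := by simp only [List.length_nil, List.length_cons]; ring
  | g₁ :: g₂ :: l, hpre =>
    have ih := ladderSum_le l post f (fun f hf => hpre f (by simp [hf])) hpost hf
    have hg := (hpre g₁ (by simp)).conv_le (hpre g₂ (by simp)) x
    rw [List.cons_append, List.cons_append, ladderSum_cons_cons]
    calc _ ≤ ∑' y, g₁ (x - y) * (g₂ y * (c * b ^ (l.length + post.length))) :=
            ENNReal.tsum_le_tsum fun y => mul_le_mul' le_rfl (mul_le_mul' le_rfl (ih _))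
      _ ≤ b * b * (c * b ^ (l.length + post.length)) := by
          simp only [← mul_assoc, ENNReal.tsum_mul_right]
          gcongr
      _ = _ := by simp only [List.length_cons]; ring

end LadderBounds

section Wrapping

variable {σ A : Type*} [AddCommGroup A]

/-- The sum of a function of the two parts over all ways of splitting a word. -/
noncomputable def splitSum (γ : List σ) (F : List σ → List σ → ℝ≥0∞) : ℝ≥0∞ :=
  ∑ n ∈ Finset.range (γ.length + 1), F (γ.take n) (γ.drop n)

lemma le_splitSum (u v : List σ) (F : List σ → List σ → ℝ≥0∞) : F u v ≤ splitSum (u ++ v) F := by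
  have h := Finset.single_le_sum (f := fun n => F ((u ++ v).take n) ((u ++ v).drop n))
    (fun _ _ => zero_le) (Finset.mem_range.2 (by simp : u.length < (u ++ v).length + 1))
  simpa [splitSum] using h

lemma splitSum_mul_le {W : List σ → ℝ≥0∞} (hW : ∀ u v, W (u ++ v) ≤ W u * W v) (γ : List σ)
    (F : List σ → List σ → ℝ≥0∞) :
    W γ * splitSum γ F ≤ splitSum γ fun u v => W u * W v * F u v := by
  rw [splitSum, splitSum, Finset.mul_sum]
  refine Finset.sum_le_sum fun n _ => ?_
  refine mul_le_mul' ?_ le_rfl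
  have := hW (γ.take n) (γ.drop n)
  rwa [List.take_append_drop] at this

variable (π : List σ → A) (lg : List σ → ℝ≥0∞)

/-- Counts the ways of closing a loop, currently at displacement `x`, within the given lines. -/
noncomputable def closeSum : A → List (List σ) → ℝ≥0∞
  | _, [] => 0
  | x, γ :: γs => splitSum γ (fun c _ => zeroInd (x + π c)) + closeSum (x + π γ) γs

/-- As `closeSum`, with a long line or part of a line in the remainder of the loop. -/
noncomputable def longCloseSum : A → List (List σ) → ℝ≥0∞
  | _, [] => 0
  | x, γ :: γs => splitSum γ (fun c _ => zeroInd (x + π c) * lg c) +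
      lg γ * closeSum π (x + π γ) γs + longCloseSum (x + π γ) γs

/-- Counts loops with a long part within the concatenation of the given lines. -/
noncomputable def wrapSum : List (List σ) → ℝ≥0∞
  | [] => 0
  | γ :: γs => splitSum γ (fun _ e => splitSum e fun b _ => zeroInd (π b) * lg b) +
      splitSum γ (fun _ b => lg b * closeSum π (π b) γs + longCloseSum π lg (π b) γs) +
      wrapSum γs

variable {π lg} {ν : List σ → ℝ} {T : ℝ}

lemma one_le_closeSum (hπ : ∀ u v, π (u ++ v) = π u + π v) (γs : List (List σ)) (hγ : γs ≠ [])
    (x : A) (c e : List σ) (h : γs.flatten = c ++ e) (hx : x + π c = 0) :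
    1 ≤ closeSum π x γs := by
  induction γs generalizing x c with
  | nil => exact absurd rfl hγ
  | cons γ γs ih =>
    have hs : ∀ c' e', γ = c' ++ e' → x + π c' = 0 → 1 ≤ closeSum π x (γ :: γs) := by
      rintro c' e' rfl h0
      refine le_add_right (le_trans ?_ (le_splitSum c' e' _))
      simp [zeroInd, h0]
    rw [List.flatten_cons, List.append_eq_append_iff] at h
    rcases h with ⟨as, rfl, h⟩ | ⟨bs, rfl, h⟩
    · by_cases h0 : γs = []
      · subst h0
        simp only [List.flatten_nil, List.nil_eq, List.append_eq_nil_iff] at h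
        exact hs γ [] (by simp) (by simpa [h.1] using hx)
      · refine le_add_left (ih h0 _ as h ?_)
        rwa [add_assoc, ← hπ]
    · exact hs c bs rfl hx

lemma one_le_longCloseSum (hπ : ∀ u v, π (u ++ v) = π u + π v)
    (hν : ∀ u v, ν (u ++ v) ≤ ν u + ν v) (hT : 0 ≤ T) (hlg : ∀ γ, T ≤ ν γ → 1 ≤ lg γ)
    (γs : List (List σ)) (hγ : γs ≠ []) (x : A) (c e : List σ) (h : γs.flatten = c ++ e)
    (hx : x + π c = 0) (hc : γs.length * T ≤ ν c) : 1 ≤ longCloseSum π lg x γs := by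
  induction γs generalizing x c with
  | nil => exact absurd rfl hγ
  | cons γ γs ih =>
    have hs : ∀ c' e', γ = c' ++ e' → x + π c' = 0 → T ≤ ν c' →
        1 ≤ longCloseSum π lg x (γ :: γs) := by
      rintro c' e' rfl h0 h1
      refine le_add_right (le_add_right (le_trans ?_ (le_splitSum c' e' _)))
      simpa [zeroInd, h0] using hlg c' h1
    simp only [List.length_cons, Nat.cast_add, Nat.cast_one] at hc
    rw [List.flatten_cons, List.append_eq_append_iff] at h
    by_cases h0 : γs = []
    · subst h0
      simp only [List.length_nil, Nat.cast_zero, zero_add, one_mul] at hc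
      rcases h with ⟨as, rfl, h⟩ | ⟨bs, rfl, h⟩
      · simp only [List.flatten_nil, List.nil_eq, List.append_eq_nil_iff] at h
        rw [h.1, List.append_nil] at hx hc
        exact hs γ [] (by simp) hx hc
      · exact hs c bs rfl hx hc
    have hlen : (0 : ℝ) ≤ γs.length := Nat.cast_nonneg _
    have hlen1 : (1 : ℝ) ≤ γs.length := by
      exact_mod_cast List.length_pos_iff.2 h0
    rcases h with ⟨as, rfl, h⟩ | ⟨bs, rfl, h⟩
    · have hx' : x + π γ + π as = 0 := by rwa [add_assoc, ← hπ]
      by_cases hγT : T ≤ ν γ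
      · refine le_add_right (le_add_left ?_)
        exact one_le_mul (hlg γ hγT) (one_le_closeSum hπ γs h0 _ as e h hx')
      · refine le_add_left (ih h0 _ as h hx' ?_)
        have := hν γ as
        push Not at hγT
        nlinarith
    · exact hs c bs rfl hx (by nlinarith)

lemma one_le_wrapSum (hπ : ∀ u v, π (u ++ v) = π u + π v)
    (hν : ∀ u v, ν (u ++ v) ≤ ν u + ν v) (hT : 0 ≤ T) (hlg : ∀ γ, T ≤ ν γ → 1 ≤ lg γ)
    (γs : List (List σ)) (u v x : List σ) (h : γs.flatten = u ++ v ++ x) (hv : π v = 0)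
    (hr : 0 < ν v) (hn : ν [] ≤ 0) (hl : γs.length * T ≤ ν v) : 1 ≤ wrapSum π lg γs := by
  induction γs generalizing u with
  | nil =>
    simp only [List.flatten_nil, List.nil_eq, List.append_eq_nil_iff] at h
    rw [h.1.2] at hr
    linarith
  | cons γ γs ih =>
    simp only [List.length_cons, Nat.cast_add, Nat.cast_one] at hl
    have hlen : (0 : ℝ) ≤ γs.length := Nat.cast_nonneg _
    have hinner : ∀ a b c, γ = a ++ (b ++ c) → π b = 0 → T ≤ ν b →
        1 ≤ wrapSum π lg (γ :: γs) := by
      rintro a b c rfl h0 h1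
      refine le_add_right (le_add_right (le_trans ?_ (le_splitSum a (b ++ c) _)))
      refine le_trans ?_ (le_splitSum b c _)
      simpa [zeroInd, h0] using hlg b h1
    rw [List.flatten_cons, List.append_assoc, List.append_eq_append_iff] at h
    rcases h with ⟨as, rfl, h⟩ | ⟨bs, rfl, h⟩
    · refine le_add_left (ih as (by rw [h, List.append_assoc]) ?_)
      nlinarith
    · rw [eq_comm, List.append_eq_append_iff] at h
      rcases h with ⟨cs, rfl, h⟩ | ⟨cs, rfl, h⟩
      · by_cases h0 : γs = []
        · subst h0
          simp only [List.flatten_nil, List.nil_eq, List.append_eq_nil_iff] at h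
          simp only [List.length_nil, Nat.cast_zero, zero_add, one_mul, h.1,
            List.append_nil] at hl hv
          exact hinner u bs [] (by simp) hv hl
        · refine le_add_right (le_add_left (le_trans ?_ (le_splitSum u bs _)))
          rw [hπ] at hv
          by_cases hb : T ≤ ν bs
          · exact le_add_right (one_le_mul (hlg _ hb) (one_le_closeSum hπ γs h0 _ cs x h hv))
          · refine le_add_left (one_le_longCloseSum hπ hν hT hlg γs h0 _ cs x h hv ?_)
            have := hν bs cs
            push Not at hb
            nlinarith
      · exact hinner u v cs rfl hv (by nlinarith)

end Wrapping

section Families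

variable {A : Type*}

/-- Diagrams with one distinguished line. -/
def Marked (B c : ℝ≥0∞) (n : ℕ) (fs : List (A → ℝ≥0∞)) : Prop :=
  ∃ pre f post, fs = pre ++ f :: post ∧ fs.length = n ∧ (∀ f ∈ pre, SqSumLE f B) ∧
    (∀ f ∈ post, SqSumLE f B) ∧ ∀ x, f x ≤ c

/-- Diagrams all of whose lines are square summable. -/
def AllSq (B : ℝ≥0∞) (n : ℕ) (fs : List (A → ℝ≥0∞)) : Prop :=
  fs.length = n ∧ ∀ f ∈ fs, SqSumLE f B

lemma Marked.cons {B c : ℝ≥0∞} {n : ℕ} {fs : List (A → ℝ≥0∞)} (h : Marked B c n fs)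
    {g : A → ℝ≥0∞} (hg : SqSumLE g B) : Marked B c (n + 1) (g :: fs) := by
  obtain ⟨pre, f, post, rfl, hl, h1, h2, h3⟩ := h
  exact ⟨g :: pre, f, post, rfl, by simp [← hl], by simpa using ⟨hg, h1⟩, h2, h3⟩

lemma AllSq.mark {B c : ℝ≥0∞} {n : ℕ} {fs : List (A → ℝ≥0∞)} (h : AllSq B n fs)
    {g : A → ℝ≥0∞} (hg : ∀ x, g x ≤ c) : Marked B c (n + 1) (g :: fs) :=
  ⟨[], g, fs, rfl, by simp [h.1], by simp, h.2, hg⟩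

lemma AllSq.cons {B : ℝ≥0∞} {n : ℕ} {fs : List (A → ℝ≥0∞)} (h : AllSq B n fs)
    {g : A → ℝ≥0∞} (hg : SqSumLE g B) : AllSq B (n + 1) (g :: fs) :=
  ⟨by simp [h.1], by simpa using ⟨hg, h.2⟩⟩

lemma allSq_replicate {B : ℝ≥0∞} (n : ℕ) {g : A → ℝ≥0∞} (hg : SqSumLE g B) :
    AllSq B n (List.replicate n g) :=
  ⟨by simp, fun f hf => by rw [List.eq_of_mem_replicate hf]; exact hg⟩

/-- The sum of a constraint function over a family of diagrams. -/
noncomputable def famSum (S : List (List (A → ℝ≥0∞))) (L : List A → ℝ≥0∞) : ℝ≥0∞ :=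
  (S.map fun fs => msum fs L).sum

lemma famSum_append (S S' : List (List (A → ℝ≥0∞))) (L : List A → ℝ≥0∞) :
    famSum (S ++ S') L = famSum S L + famSum S' L := by simp [famSum]

lemma famSum_cons (fs : List (A → ℝ≥0∞)) (S : List (List (A → ℝ≥0∞))) (L : List A → ℝ≥0∞) :
    famSum (fs :: S) L = msum fs L + famSum S L := by simp [famSum]

lemma famSum_map_cons (g : A → ℝ≥0∞) (S : List (List (A → ℝ≥0∞))) (L : List A → ℝ≥0∞) :
    famSum (S.map fun fs => g :: fs) L = ∑' z, g z * famSum S fun l => L (z :: l) := by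
  induction S with
  | nil => simp [famSum]
  | cons fs S ih =>
    rw [List.map_cons, famSum_cons, ih]
    simp only [famSum_cons, mul_add, ENNReal.tsum_add, msum]

end Families

section WrapSums

variable {σ A : Type*} [AddCommGroup A] {W : List σ → ℝ≥0∞} {π : List σ → A}
  {lg : List σ → ℝ≥0∞}

lemma tsum_mul_splitSum_le (hW : ∀ u v, W (u ++ v) ≤ W u * W v)
    (F : List σ → List σ → ℝ≥0∞) (G : List σ → ℝ≥0∞) :
    ∑' γ, W γ * (splitSum γ F * G γ) ≤ ∑' u, ∑' v, W u * W v * F u v * G (u ++ v) := by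
  rw [← tsum_split (fun u v => W u * W v * F u v * G (u ++ v))]
  refine ENNReal.tsum_le_tsum fun γ => ?_
  simp only [List.take_append_drop]
  rw [← mul_assoc, ← Finset.sum_mul]
  exact mul_le_mul' (splitSum_mul_le hW γ F) le_rfl

/-- The `ℓ²` norm of the splittings of a line at displacement `z`. -/
noncomputable def pairNorm (f g : A → ℝ≥0∞) (z : A) : ℝ≥0∞ :=
  (∑' x, f x ^ 2 * g (z - x) ^ 2) ^ (1 / 2 : ℝ)

lemma sqSumLE_pairNorm (f g : A → ℝ≥0∞) (z : A) :
    SqSumLE (fun x => f x * g (z - x)) (pairNorm f g z) := by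
  rw [SqSumLE, pairNorm, ← ENNReal.rpow_natCast, ← ENNReal.rpow_mul]
  simp [mul_pow]

lemma SqSumLE.pairNorm {f g : A → ℝ≥0∞} {b c : ℝ≥0∞} (hf : SqSumLE f b) (hg : SqSumLE g c) :
    SqSumLE (pairNorm f g) (b * c) := by
  have e : ∀ z, WSAW.pairNorm f g z ^ 2 = ∑' x, f x ^ 2 * g (z - x) ^ 2 := by
    intro z
    rw [WSAW.pairNorm, ← ENNReal.rpow_natCast, ← ENNReal.rpow_mul]
    simp
  simp only [SqSumLE, e]
  rw [ENNReal.tsum_comm]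
  calc _ = ∑' x, f x ^ 2 * ∑' z, g z ^ 2 := by
        refine tsum_congr fun x => ?_
        rw [ENNReal.tsum_mul_left, ← (Equiv.subRight x).tsum_eq (fun z => g z ^ 2)]
        rfl
    _ ≤ b ^ 2 * c ^ 2 := by rw [ENNReal.tsum_mul_right]; exact mul_le_mul' hf hg
    _ = _ := by ring

lemma Marked.ladderSum_le {B c : ℝ≥0∞} {n : ℕ} {fs : List (A → ℝ≥0∞)} (h : Marked B c n fs)
    (x : A) : ladderSum fs x ≤ c * B ^ (n - 1) := by
  obtain ⟨pre, f, post, rfl, rfl, h1, h2, h3⟩ := h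
  refine (WSAW.ladderSum_le pre post f h1 h2 h3 x).trans (le_of_eq ?_)
  simp [← add_assoc]

lemma tsum_tsum_conv (F : A → A → ℝ≥0∞) :
    ∑' x, ∑' y, F x y = ∑' z, ∑' x, F x (z - x) := by
  rw [ENNReal.tsum_comm (f := fun z x => F x (z - x))]
  refine tsum_congr fun x => ?_
  rw [← (Equiv.subRight x).tsum_eq (fun y => F x y)]
  rfl

lemma tsum_pushF₂ (f g : List σ → ℝ≥0∞) (F : A → A → ℝ≥0∞) :
    ∑' u, ∑' v, f u * g v * F (π u) (π v)
      = ∑' z, ∑' x, pushF π f x * pushF π g (z - x) * F x (z - x) := by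
  calc _ = ∑' x, ∑' y, pushF π f x * pushF π g y * F x y := by
        simp only [mul_assoc, ENNReal.tsum_mul_left, tsum_pushF]
    _ = _ := tsum_tsum_conv _

end WrapSums

lemma msum_replicate_map {σ A : Type*} {W : List σ → ℝ≥0∞} {π : List σ → A}
    (m : ℕ) (L : List A → ℝ≥0∞) :
    msum (List.replicate m W) (fun γs => L (γs.map π))
      = msum (List.replicate m (pushF π W)) L := by
  rw [msum_map, List.map_replicate]

section Families

variable {σ A : Type*} [AddCommGroup A] {W : List σ → ℝ≥0∞} {π : List σ → A}
  {lg : List σ → ℝ≥0∞}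

lemma SqSumLE.comp_sub {f : A → ℝ≥0∞} {b : ℝ≥0∞} (h : SqSumLE f b) (z : A) :
    SqSumLE (fun x => f (z - x)) b := h.comp_equiv (Equiv.subLeft z)

lemma SqSumLE.comp_sub_right {f : A → ℝ≥0∞} {b : ℝ≥0∞} (h : SqSumLE f b) (z : A) :
    SqSumLE (fun x => f (x - z)) b := h.comp_equiv (Equiv.subRight z)

lemma SqSumLE.comp_neg {f : A → ℝ≥0∞} {b : ℝ≥0∞} (h : SqSumLE f b) :
    SqSumLE (fun x => f (-x)) b := h.comp_equiv (Equiv.neg A)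

lemma SqSumLE.const_mul {α : Type*} {f : α → ℝ≥0∞} {b : ℝ≥0∞} (h : SqSumLE f b) (c : ℝ≥0∞) :
    SqSumLE (fun x => c * f x) (c * b) := by
  simp only [SqSumLE, mul_pow, ENNReal.tsum_mul_left]
  exact mul_le_mul' le_rfl h

/-- The family `S` of diagrams dominates `m` lines subject to the counting function `Cl`, given a
square summable initial displacement. -/
def Dominates (W : List σ → ℝ≥0∞) (π : List σ → A) (m : ℕ) (Cl : A → List (List σ) → ℝ≥0∞)
    (S : List (List (A → ℝ≥0∞))) : Prop :=
  ∀ (u : A → ℝ≥0∞) (c : ℝ≥0∞) (L : List A → ℝ≥0∞), SqSumLE u c →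
    ∑' α, u α * msum (List.replicate m W) (fun γs => L (γs.map π) * Cl α γs) ≤ c * famSum S L

lemma Dominates.shift {m : ℕ} {Cl : A → List (List σ) → ℝ≥0∞} {S : List (List (A → ℝ≥0∞))}
    (h : Dominates W π m Cl S) (V : List σ → ℝ≥0∞) {u : A → ℝ≥0∞} {c : ℝ≥0∞} (hu : SqSumLE u c)
    (L : List A → ℝ≥0∞) :
    ∑' α, u α * ∑' γ, V γ * msum (List.replicate m W)
      (fun γs => L (π γ :: γs.map π) * Cl (α + π γ) γs)
      ≤ c * famSum (S.map fun fs => pushF π V :: fs) L := by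
  rw [famSum_map_cons, tsum_pushF π V (fun z => famSum S fun l => L (z :: l)),
    ← ENNReal.tsum_mul_left]
  simp only [← ENNReal.tsum_mul_left]
  rw [ENNReal.tsum_comm]
  refine ENNReal.tsum_le_tsum fun γ => ?_
  calc _ = V γ * ∑' α, u (α - π γ) * msum (List.replicate m W)
        (fun γs => L (π γ :: γs.map π) * Cl α γs) := by
        rw [← ENNReal.tsum_mul_left, ← (Equiv.subRight (π γ)).tsum_eq]
        refine tsum_congr fun α => ?_
        simp only [Equiv.subRight_apply, sub_add_cancel]
        ring
    _ ≤ V γ * (c * famSum S fun l => L (π γ :: l)) :=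
        mul_le_mul' le_rfl (h _ _ (fun l => L (π γ :: l)) (hu.comp_sub_right (π γ)))
    _ = _ := by ring

lemma tsum_close_split_le (hW : ∀ u v, W (u ++ v) ≤ W u * W v)
    (hπ : ∀ u v, π (u ++ v) = π u + π v) (l : List σ → ℝ≥0∞) (u H : A → ℝ≥0∞) :
    ∑' α, u α * ∑' γ, W γ * (splitSum γ (fun c _ => zeroInd (α + π c) * l c) * H (π γ))
      ≤ ∑' z, (∑' x, pushF π (fun c => l c * W c) x * pushF π W (z - x) * u (-x)) * H z := by
  calc _ ≤ ∑' α, u α * ∑' c, ∑' e, W c * W e * (zeroInd (α + π c) * l c) * H (π c + π e) := by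
        refine ENNReal.tsum_le_tsum fun α => mul_le_mul' le_rfl ?_
        simp only [← hπ]
        exact tsum_mul_splitSum_le hW (fun c _ => zeroInd (α + π c) * l c) (fun γ => H (π γ))
    _ = ∑' c, ∑' e, (l c * W c) * W e * (u (- π c) * H (π c + π e)) := by
        simp only [← ENNReal.tsum_mul_left]
        rw [ENNReal.tsum_comm]
        refine tsum_congr fun c => ?_
        rw [ENNReal.tsum_comm]
        refine tsum_congr fun e => ?_
        calc _ = ∑' α, (u α * ((l c * W c) * W e * H (π c + π e))) * zeroInd (α - -π c) := by
              refine tsum_congr fun α => ?_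
              rw [sub_neg_eq_add]
              ring
          _ = _ := by rw [tsum_mul_zeroInd]; ring
    _ = ∑' z, ∑' x, pushF π (fun c => l c * W c) x * pushF π W (z - x) *
          (u (-x) * H (x + (z - x))) :=
        tsum_pushF₂ (fun c => l c * W c) W (fun x y => u (-x) * H (x + y))
    _ = _ := by
        refine tsum_congr fun z => ?_
        rw [← ENNReal.tsum_mul_right]
        refine tsum_congr fun x => ?_
        rw [add_sub_cancel]
        ring

variable {b c : ℝ≥0∞}

lemma exists_dominates_closeSum (hW : ∀ u v, W (u ++ v) ≤ W u * W v)
    (hπ : ∀ u v, π (u ++ v) = π u + π v) (hb : 1 ≤ b) (hf : SqSumLE (pushF π W) b) (m : ℕ) :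
    ∃ S : List (List (A → ℝ≥0∞)), S.length ≤ 2 ^ m ∧ (∀ fs ∈ S, AllSq (b ^ 2) m fs) ∧
      Dominates W π m (closeSum π) S := by
  have hbb : b ≤ b ^ 2 := le_self_pow₀ hb two_ne_zero
  have hfB : SqSumLE (pushF π W) (b ^ 2) := hf.mono (fun _ => le_rfl) hbb
  induction m with
  | zero => exact ⟨[], by simp, by simp, fun u c L _ => by simp [msum, closeSum, famSum]⟩
  | succ m ih =>
    obtain ⟨S, hS, hS', hD⟩ := ih
    refine ⟨(pairNorm (pushF π W) (pushF π W) :: List.replicate m (pushF π W)) ::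
      S.map fun fs => pushF π W :: fs, ?_, ?_, ?_⟩
    · have := Nat.one_le_two_pow (n := m)
      simp only [List.length_cons, List.length_map, pow_succ]
      omega
    · intro fs h
      rcases List.mem_cons.1 h with rfl | h
      · exact (allSq_replicate m hfB).cons (by simpa [sq] using hf.pairNorm hf)
      · obtain ⟨gs, hgs, rfl⟩ := List.mem_map.1 h
        exact (hS' gs hgs).cons hfB
    · intro u c L hu
      rw [famSum_cons, mul_add]
      simp only [List.replicate_succ, msum, List.map_cons, closeSum, mul_add, msum_add,
        ENNReal.tsum_add]
      refine add_le_add ?_ (hD.shift W hu L)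
      have e : ∀ α γ, msum (List.replicate m W) (fun γs => L (π γ :: γs.map π) *
          splitSum γ (fun c _ => zeroInd (α + π c))) =
          splitSum γ (fun c _ => zeroInd (α + π c) * 1) *
            msum (List.replicate m (pushF π W)) (fun l => L (π γ :: l)) := by
        intro α γ
        rw [← msum_replicate_map m (fun l => L (π γ :: l)), ← msum_const_mul]
        simp only [mul_one]
        simp only [mul_comm]
      simp only [e]
      refine (tsum_close_split_le hW hπ (fun _ => 1) u
        (fun z => msum (List.replicate m (pushF π W)) fun l => L (z :: l))).trans ?_
      rw [← ENNReal.tsum_mul_left]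
      refine ENNReal.tsum_le_tsum fun z => ?_
      rw [← mul_assoc]
      refine mul_le_mul' ?_ le_rfl
      simp only [one_mul]
      rw [mul_comm]
      exact (sqSumLE_pairNorm _ _ z).tsum_mul_le hu.comp_neg

lemma exists_dominates_longCloseSum (hW : ∀ u v, W (u ++ v) ≤ W u * W v)
    (hπ : ∀ u v, π (u ++ v) = π u + π v) (hb : 1 ≤ b) (hf : SqSumLE (pushF π W) b)
    (hc : ∀ x, pushF π (fun γ => lg γ * W γ) x ≤ c) (m : ℕ) :
    ∃ S : List (List (A → ℝ≥0∞)), S.length ≤ 4 ^ m ∧ (∀ fs ∈ S, Marked (b ^ 2) (c * b ^ 2) m fs) ∧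
      Dominates W π m (longCloseSum π lg) S := by
  have hbb : b ≤ b ^ 2 := le_self_pow₀ hb two_ne_zero
  have hfB : SqSumLE (pushF π W) (b ^ 2) := hf.mono (fun _ => le_rfl) hbb
  induction m with
  | zero => exact ⟨[], by simp, by simp, fun u c L _ => by simp [msum, longCloseSum, famSum]⟩
  | succ m ih =>
    obtain ⟨S, hS, hS', hD⟩ := ih
    obtain ⟨R, hR, hR', hE⟩ := exists_dominates_closeSum hW hπ hb hf m
    refine ⟨((fun _ => c * b) :: List.replicate m (pushF π W)) ::
      ((R.map fun fs => pushF π (fun γ => lg γ * W γ) :: fs) ++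
      S.map fun fs => pushF π W :: fs), ?_, ?_, ?_⟩
    · have h1 := Nat.one_le_two_pow (n := m)
      have h2 : 2 ^ m ≤ 4 ^ m := Nat.pow_le_pow_left (by norm_num) m
      simp only [List.length_cons, List.length_append, List.length_map, pow_succ]
      omega
    · intro fs h
      rcases List.mem_cons.1 h with rfl | h
      · exact (allSq_replicate m hfB).mark fun _ => mul_le_mul' le_rfl hbb
      rcases List.mem_append.1 h with h | h
      · obtain ⟨gs, hgs, rfl⟩ := List.mem_map.1 h
        refine (hR' gs hgs).mark fun x => (hc x).trans ?_
        exact le_mul_of_one_le_right' (one_le_pow₀ hb)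
      · obtain ⟨gs, hgs, rfl⟩ := List.mem_map.1 h
        exact (hS' gs hgs).cons hfB
    · intro u c' L hu
      rw [famSum_cons, famSum_append, mul_add, mul_add, ← add_assoc]
      simp only [List.replicate_succ, msum, List.map_cons, longCloseSum, mul_add, msum_add,
        ENNReal.tsum_add]
      refine add_le_add (add_le_add ?_ ?_) (hD.shift W hu L)
      · have e : ∀ α γ, msum (List.replicate m W) (fun γs => L (π γ :: γs.map π) *
            splitSum γ (fun c _ => zeroInd (α + π c) * lg c)) =
            splitSum γ (fun c _ => zeroInd (α + π c) * lg c) *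
              msum (List.replicate m (pushF π W)) (fun l => L (π γ :: l)) := by
          intro α γ
          rw [← msum_replicate_map m (fun l => L (π γ :: l)), ← msum_const_mul]
          simp only [mul_comm]
        simp only [e]
        refine (tsum_close_split_le hW hπ lg u
          (fun z => msum (List.replicate m (pushF π W)) fun l => L (z :: l))).trans ?_
        rw [← ENNReal.tsum_mul_left]
        refine ENNReal.tsum_le_tsum fun z => ?_
        rw [← mul_assoc]
        refine mul_le_mul' ?_ le_rfl
        calc _ ≤ ∑' x, c * (pushF π W (z - x) * u (-x)) := by
              refine ENNReal.tsum_le_tsum fun x => ?_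
              rw [mul_assoc]
              exact mul_le_mul' (hc x) le_rfl
          _ ≤ c * (b * c') := by
              rw [ENNReal.tsum_mul_left]
              exact mul_le_mul' le_rfl ((hf.comp_sub z).tsum_mul_le hu.comp_neg)
          _ = _ := by ring
      · refine le_trans (le_of_eq ?_) (hE.shift (fun γ => lg γ * W γ) hu L)
        refine tsum_congr fun α => ?_
        congr 1
        refine tsum_congr fun γ => ?_
        rw [mul_comm (lg γ) (W γ), mul_assoc, ← msum_const_mul (List.replicate m W) (lg γ)]
        congr 2
        funext γs
        ring

/-- Sums over `m` lines containing a loop with a long part are dominated by diagrams with one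
distinguished line. -/
lemma exists_wrapSum_le (hW : ∀ u v, W (u ++ v) ≤ W u * W v)
    (hπ : ∀ u v, π (u ++ v) = π u + π v) (hb : 1 ≤ b) (hf : SqSumLE (pushF π W) b)
    (hc : ∀ x, pushF π (fun γ => lg γ * W γ) x ≤ c) (m : ℕ) :
    ∃ S : List (List (A → ℝ≥0∞)), S.length ≤ 8 ^ m ∧ (∀ fs ∈ S, Marked (b ^ 2) (c * b ^ 2) m fs) ∧
      ∀ L : List A → ℝ≥0∞, msum (List.replicate m W)
        (fun γs => L (γs.map π) * wrapSum π lg γs) ≤ famSum S L := by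
  have hbb : b ≤ b ^ 2 := le_self_pow₀ hb two_ne_zero
  have hfB : SqSumLE (pushF π W) (b ^ 2) := hf.mono (fun _ => le_rfl) hbb
  induction m with
  | zero => exact ⟨[], by simp, by simp, fun L => by simp [msum, wrapSum, famSum]⟩
  | succ m ih =>
    obtain ⟨S, hS, hS', hD⟩ := ih
    obtain ⟨R, hR, hR', hE⟩ := exists_dominates_closeSum hW hπ hb hf m
    obtain ⟨Q, hQ, hQ', hF⟩ := exists_dominates_longCloseSum hW hπ hb hf hc m
    refine ⟨((fun _ => c * b ^ 2) :: List.replicate m (pushF π W)) ::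
      (((R.map fun fs => (fun _ => c * b) :: fs) ++
      (Q.map fun fs => pairNorm (pushF π W) (pushF π W) :: fs)) ++
      S.map fun fs => pushF π W :: fs), ?_, ?_, ?_⟩
    · have h1 := Nat.one_le_two_pow (n := m)
      have h2 : 2 ^ m ≤ 4 ^ m := Nat.pow_le_pow_left (by norm_num) m
      have h3 : 4 ^ m ≤ 8 ^ m := Nat.pow_le_pow_left (by norm_num) m
      simp only [List.length_cons, List.length_append, List.length_map, pow_succ]
      omega
    · intro fs h
      rcases List.mem_cons.1 h with rfl | h
      · exact (allSq_replicate m hfB).mark fun _ => le_rfl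
      rcases List.mem_append.1 h with h | h
      · rcases List.mem_append.1 h with h | h
        · obtain ⟨gs, hgs, rfl⟩ := List.mem_map.1 h
          exact (hR' gs hgs).mark fun x => mul_le_mul' le_rfl hbb
        · obtain ⟨gs, hgs, rfl⟩ := List.mem_map.1 h
          exact (hQ' gs hgs).cons (by simpa [sq] using hf.pairNorm hf)
      · obtain ⟨gs, hgs, rfl⟩ := List.mem_map.1 h
        exact (hS' gs hgs).cons hfB
    · intro L
      have hsplit : ∀ Cl : A → List (List σ) → ℝ≥0∞, ∀ l : List σ → ℝ≥0∞,
          ∑' γ, W γ * msum (List.replicate m W) (fun γs => L (π γ :: γs.map π) *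
            splitSum γ (fun _ v => l v * Cl (π v) γs)) ≤
          ∑' z, ∑' y, (pushF π (fun v => l v * W v) y * pushF π W (z - y)) *
            msum (List.replicate m W) (fun γs => L (z :: γs.map π) * Cl y γs) := by
        intro Cl l
        calc _ = ∑' γ, W γ * (splitSum γ fun u v => l v *
              msum (List.replicate m W) (fun γs => L (π (u ++ v) :: γs.map π) * Cl (π v) γs)) *
              1 := by
              refine tsum_congr fun γ => ?_
              rw [mul_one]
              congr 1
              simp only [splitSum, Finset.mul_sum, msum_sum, List.take_append_drop]
              refine Finset.sum_congr rfl fun n _ => ?_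
              rw [← msum_const_mul]
              congr 1
              funext γs
              ring
          _ ≤ ∑' u, ∑' v, W u * W v * (l v * msum (List.replicate m W)
              (fun γs => L (π (u ++ v) :: γs.map π) * Cl (π v) γs)) := by
              simp only [mul_assoc _ _ (1 : ℝ≥0∞)]
              refine (tsum_mul_splitSum_le hW _ (fun _ => 1)).trans (le_of_eq ?_)
              simp only [mul_one]
          _ = ∑' v, ∑' u, (l v * W v) * W u * msum (List.replicate m W)
              (fun γs => L ((π v + π u) :: γs.map π) * Cl (π v) γs) := by
              rw [ENNReal.tsum_comm]
              refine tsum_congr fun v => tsum_congr fun u => ?_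
              rw [hπ, add_comm (π u)]
              ring
          _ = _ := by
              rw [tsum_pushF₂ (fun v => l v * W v) W (fun y x => msum (List.replicate m W)
                (fun γs => L ((y + x) :: γs.map π) * Cl y γs))]
              simp only [add_sub_cancel]
      rw [famSum_cons, famSum_append, famSum_append, ← add_assoc, ← add_assoc]
      have hadd : ∀ (γ : List σ) (F G : List σ → List σ → ℝ≥0∞),
          splitSum γ (fun u v => F u v + G u v) = splitSum γ F + splitSum γ G := by
        intro γ F G
        simp [splitSum, Finset.sum_add_distrib]
      simp only [List.replicate_succ, msum, List.map_cons, wrapSum, hadd, mul_add, msum_add,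
        ENNReal.tsum_add, ← add_assoc]
      refine add_le_add (add_le_add (add_le_add ?_ ?_) ?_) ?_
      · set H : A → ℝ≥0∞ := fun z => msum (List.replicate m (pushF π W)) fun l => L (z :: l)
          with hH
        calc _ = ∑' γ, W γ * (splitSum γ (fun _ e => splitSum e fun v _ =>
              zeroInd (π v) * lg v) * H (π γ)) := by
              refine tsum_congr fun γ => ?_
              congr 1
              have e := msum_replicate_map (W := W) (π := π) m (fun l => L (π γ :: l))
              simp only [hH, ← e, ← msum_const_mul]
              simp only [mul_comm]
          _ ≤ ∑' u, ∑' e, W u * W e * (splitSum e fun v _ => zeroInd (π v) * lg v) *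
                H (π (u ++ e)) := tsum_mul_splitSum_le hW _ _
          _ = ∑' u, W u * ∑' e, W e * ((splitSum e fun v _ => zeroInd (π v) * lg v) *
                H (π u + π e)) := by
              simp only [hπ, ← ENNReal.tsum_mul_left, mul_assoc]
          _ ≤ ∑' u, W u * ∑' v, ∑' e, W v * W e * (zeroInd (π v) * lg v) *
                H (π u + π (v ++ e)) := by
              refine ENNReal.tsum_le_tsum fun u => mul_le_mul' le_rfl ?_
              exact tsum_mul_splitSum_le hW _ (fun e => H (π u + π e))
          _ = ∑' u, W u * ∑' v, (lg v * W v) * (zeroInd (π v) * ∑' e, W e *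
                H (π u + π e)) := by
              refine tsum_congr fun u => ?_
              congr 1
              refine tsum_congr fun v => ?_
              simp only [← ENNReal.tsum_mul_left]
              refine tsum_congr fun e => ?_
              by_cases hv : π v = 0
              · rw [hπ, hv, zero_add]; ring
              · simp [zeroInd, hv]
          _ ≤ ∑' u, W u * (c * ∑' e, W e * H (π u + π e)) := by
              refine ENNReal.tsum_le_tsum fun u => mul_le_mul' le_rfl ?_
              rw [← tsum_pushF π (fun v => lg v * W v)
                (fun y => zeroInd y * ∑' e, W e * H (π u + π e))]
              simp only [← mul_assoc, ENNReal.tsum_mul_right]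
              refine mul_le_mul' ?_ le_rfl
              have := tsum_mul_zeroInd (pushF π fun v => lg v * W v) 0
              simp only [sub_zero] at this
              rw [this]
              exact hc 0
          _ = c * ∑' u, ∑' e, W u * W e * H (π u + π e) := by
              simp only [← ENNReal.tsum_mul_left]
              refine tsum_congr fun u => tsum_congr fun e => ?_
              ring
          _ = c * ∑' z, (∑' x, pushF π W x * pushF π W (z - x)) * H z := by
              rw [tsum_pushF₂ W W (fun x y => H (x + y))]
              simp only [add_sub_cancel, ENNReal.tsum_mul_right]
          _ ≤ c * ∑' z, b ^ 2 * H z := by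
              refine mul_le_mul' le_rfl (ENNReal.tsum_le_tsum fun z => mul_le_mul' ?_ le_rfl)
              rw [sq]
              exact hf.tsum_mul_le (hf.comp_sub z)
          _ = _ := by
              simp only [← ENNReal.tsum_mul_left, ← mul_assoc, hH]
      · refine (hsplit (closeSum π) lg).trans ?_
        rw [famSum_map_cons]
        refine ENNReal.tsum_le_tsum fun z => ?_
        refine hE _ _ (fun l => L (z :: l)) ?_
        exact ((hf.comp_sub z).const_mul c).mono (fun x => mul_le_mul' (hc x) le_rfl) le_rfl
      · have := hsplit (longCloseSum π lg) (fun _ => 1)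
        simp only [one_mul] at this
        refine this.trans ?_
        rw [famSum_map_cons]
        refine ENNReal.tsum_le_tsum fun z => ?_
        exact hF _ _ (fun l => L (z :: l)) (sqSumLE_pairNorm _ _ z)
      · rw [famSum_map_cons, tsum_pushF π W fun z => famSum S fun l => L (z :: l)]
        refine ENNReal.tsum_le_tsum fun γ => mul_le_mul' le_rfl ?_
        exact hD fun l => L (π γ :: l)

end Families

section IrreducibleSums

variable {σ M A : Type*} [AddCommGroup M] [AddCommGroup A]

lemma famSum_ladderInd_le {B c : ℝ≥0∞} {m s : ℕ} {S : List (List (A → ℝ≥0∞))}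
    (hS : S.length ≤ s) (h : ∀ fs ∈ S, Marked B c m fs) (x : A) :
    famSum S (ladderInd x) ≤ s * (c * B ^ (m - 1)) := by
  have h1 : famSum S (ladderInd x) ≤ S.length * (c * B ^ (m - 1)) := by
    clear hS
    induction S with
    | nil => simp [famSum]
    | cons fs S ih =>
      rw [famSum_cons, List.length_cons, Nat.cast_succ, add_mul, one_mul, add_comm]
      exact add_le_add (ih fun f hf => h f (by simp [hf])) ((h fs (by simp)).ladderSum_le x)
  exact h1.trans (mul_le_mul' (by exact_mod_cast hS) le_rfl)

lemma tsum_pow_le_two {r : ℝ≥0∞} (hr : r ≤ 1 / 2) : ∑' N : ℕ, r ^ N ≤ 2 := by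
  rw [ENNReal.tsum_geometric]
  have : (2 : ℝ≥0∞)⁻¹ ≤ 1 - r := by
    have h := tsub_le_tsub_left hr (1 : ℝ≥0∞)
    simpa using h
  simpa using ENNReal.inv_le_inv.2 this

/-- Sums of irreducible interactions against an observable which is dominated by diagrams with one
distinguished line. -/
theorem irrInt_sum_le_of_fam (st : σ → M) (φ : M →+ A) {w : M → ℝ}
    (hw : ∀ x, 0 ≤ w x ∧ w x ≤ 1 / 2) {κ : List σ → ℝ≥0∞} {b q B c D : ℝ≥0∞}
    (hκ : ∀ ω, ENNReal.ofReal (walkInt st w ω) ≤ κ ω)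
    (hw' : ∀ x, ENNReal.ofReal (w x) ≤ b * zeroInd (φ x)) {Ψ : List σ → ℝ≥0∞}
    {Φ : ℕ → List (List σ) → ℝ≥0∞}
    (hΦ : ∀ N γs, γs.length = 2 * N + 1 → ladder 0 (γs.map fun γ => φ (disp st γ)) →
      Ψ γs.flatten ≤ Φ N γs)
    (hfam : ∀ N, msum (List.replicate (2 * N + 1) fun γ => κ γ * q ^ γ.length)
      (fun γs => ladderInd 0 (γs.map fun γ => φ (disp st γ)) * Φ N γs) ≤
        c * D ^ N * B ^ (2 * N))
    (hb : b * (D * B ^ 2) ≤ 1 / 2) :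
    ∑' ω, (if 2 ≤ ω.length then
      ENNReal.ofReal |irrInt st w ω| * q ^ ω.length * Ψ ω else 0) ≤ 4 * b * c := by
  refine (irrInt_sum_le st φ hw q hκ hw' Ψ).trans ?_
  calc _ ≤ 2 * b * ∑' N : ℕ, b ^ N * (c * D ^ N * B ^ (2 * N)) := by
        gcongr with N
        refine (msum_mono _ (Φ := fun γs => ladderInd 0 (γs.map fun γ => φ (disp st γ)) *
          Φ N γs) fun γs hl => ?_).trans (hfam N)
        by_cases hlad : ladder 0 (γs.map fun γ => φ (disp st γ))
        · exact mul_le_mul' le_rfl (hΦ N γs (by simpa using hl) hlad)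
        · simp [ladderInd, hlad]
    _ = 2 * b * c * ∑' N : ℕ, (b * (D * B ^ 2)) ^ N := by
        rw [mul_assoc _ c, ← ENNReal.tsum_mul_left (a := c)]
        congr 1
        refine tsum_congr fun N => ?_
        rw [mul_pow, mul_pow, pow_mul]
        ring
    _ ≤ 2 * b * c * 2 := mul_le_mul' le_rfl (tsum_pow_le_two hb)
    _ = _ := by ring

/-- The sum over all choices of a distinguished element of a list, of the product of the weight `t`
of the distinguished element and the weights `s` of all others. -/
noncomputable def markSum {α : Type*} (t s : α → ℝ≥0∞) : List α → ℝ≥0∞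
  | [] => 0
  | y :: l => t y * (l.map s).prod + s y * markSum t s l

lemma markSum_map {α ι : Type*} (t s : ι → ℝ≥0∞) (π : α → ι) (l : List α) :
    markSum t s (l.map π) = markSum (fun y => t (π y)) (fun y => s (π y)) l := by
  induction l with
  | nil => rfl
  | cons y l ih => simp [markSum, ih, Function.comp_def]

lemma msum_replicate_prod {α : Type*} (W s : α → ℝ≥0∞) (m : ℕ) (L : List α → ℝ≥0∞) :
    msum (List.replicate m W) (fun l => L l * (l.map s).prod)
      = msum (List.replicate m fun y => W y * s y) L := by
  induction m generalizing L with
  | zero => simp [msum]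
  | succ m ih =>
    simp only [List.replicate_succ, msum, List.map_cons, List.prod_cons, ← ih]
    refine tsum_congr fun y => ?_
    rw [mul_assoc, ← msum_const_mul _ (s y)]
    congr 2
    funext l
    ring

lemma exists_markSum_le {α A : Type*} {W t s : α → ℝ≥0∞} {π : α → A} {b c : ℝ≥0∞}
    (hf : SqSumLE (pushF π fun y => W y * s y) b)
    (hc : ∀ x, pushF π (fun y => W y * t y) x ≤ c) (m : ℕ) :
    ∃ S : List (List (A → ℝ≥0∞)), S.length ≤ m ∧ (∀ fs ∈ S, Marked b c m fs) ∧
      ∀ L : List A → ℝ≥0∞, msum (List.replicate m W)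
        (fun l => L (l.map π) * markSum t s l) ≤ famSum S L := by
  induction m with
  | zero => exact ⟨[], by simp, by simp, fun L => by simp [msum, markSum, famSum]⟩
  | succ m ih =>
    obtain ⟨S, hS, hS', hD⟩ := ih
    refine ⟨(pushF π (fun y => W y * t y) :: List.replicate m (pushF π fun y => W y * s y)) ::
      S.map fun fs => pushF π (fun y => W y * s y) :: fs, by simpa, ?_, ?_⟩
    · intro fs h
      rcases List.mem_cons.1 h with rfl | h
      · exact (allSq_replicate m hf).mark hc
      · obtain ⟨gs, hgs, rfl⟩ := List.mem_map.1 h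
        exact (hS' gs hgs).cons hf
    · intro L
      rw [famSum_cons, famSum_map_cons]
      simp only [List.replicate_succ, msum, List.map_cons, markSum, mul_add, msum_add,
        ENNReal.tsum_add]
      refine add_le_add (le_of_eq ?_) ?_
      · rw [tsum_pushF π _ fun z =>
          msum (List.replicate m (pushF π fun y => W y * s y)) fun l => L (z :: l)]
        refine tsum_congr fun y => ?_
        have e := msum_map π (List.replicate m fun y => W y * s y) (fun l => L (π y :: l))
        rw [List.map_replicate] at e
        rw [← e, ← msum_replicate_prod, mul_assoc, ← msum_const_mul _ (t y)]
        congr 2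
        funext l
        ring
      · rw [tsum_pushF π _ fun z => famSum S fun l => L (z :: l)]
        refine ENNReal.tsum_le_tsum fun y => ?_
        refine le_trans (le_of_eq ?_) (mul_le_mul' le_rfl (hD fun l => L (π y :: l)))
        rw [mul_assoc, ← msum_const_mul _ (s y)]
        congr 2
        funext l
        ring

lemma length_flatten_eq_markSum (γs : List (List σ)) :
    (γs.flatten.length : ℝ≥0∞) = markSum (fun γ => (γ.length : ℝ≥0∞)) (fun _ => 1) γs := by
  induction γs with
  | nil => simp [markSum]
  | cons γ γs ih =>
    rw [List.flatten_cons, List.length_append, Nat.cast_add, ih]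
    simp [markSum]

end IrreducibleSums

section Alternating

variable {A : Type*}

/-- The sum over the even positions of a list. -/
noncomputable def altSum (t : A → ℝ≥0∞) : List A → ℝ≥0∞
  | [] => 0
  | [y] => t y
  | y₁ :: _ :: l => t y₁ + altSum t l

/-- The product over the odd positions of a list. -/
noncomputable def altProd (s : A → ℝ≥0∞) : List A → ℝ≥0∞
  | [] => 1
  | [_] => 1
  | _ :: y₂ :: l => s y₂ * altProd s l

lemma altProd_le_prod {s : A → ℝ≥0∞} (hs : ∀ y, 1 ≤ s y) :
    ∀ l : List A, altProd s l ≤ (l.map s).prod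
  | [] => le_rfl
  | [y] => by simpa [altProd] using hs y
  | y₁ :: y₂ :: l => by
    simp only [altProd, List.map_cons, List.prod_cons]
    exact le_mul_of_one_le_of_le (hs y₁) (mul_le_mul' le_rfl (altProd_le_prod hs l))

lemma altSum_mul_altProd_le {t s : A → ℝ≥0∞} (hs : ∀ y, 1 ≤ s y) :
    ∀ l : List A, altSum t l * altProd s l ≤ markSum t s l
  | [] => by simp [altSum]
  | [y] => by simp [altSum, altProd, markSum]
  | y₁ :: y₂ :: l => by
    simp only [altSum, altProd, markSum, List.map_cons, List.prod_cons]
    rw [add_mul]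
    refine add_le_add (mul_le_mul' le_rfl (mul_le_mul' le_rfl (altProd_le_prod hs l))) ?_
    refine le_mul_of_one_le_of_le (hs y₁) (le_add_left ?_)
    rw [mul_left_comm]
    exact mul_le_mul' le_rfl (altSum_mul_altProd_le hs l)

lemma ennreal_add_pow_le (x y : ℝ≥0∞) (p : ℕ) : (x + y) ^ p ≤ 2 ^ p * (x ^ p + y ^ p) := by
  rcases le_total x y with h | h
  · calc (x + y) ^ p ≤ (y + y) ^ p := by gcongr
      _ = 2 ^ p * y ^ p := by rw [← two_mul, mul_pow]
      _ ≤ _ := mul_le_mul' le_rfl le_add_self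
  · calc (x + y) ^ p ≤ (x + x) ^ p := by gcongr
      _ = 2 ^ p * x ^ p := by rw [← two_mul, mul_pow]
      _ ≤ _ := mul_le_mul' le_rfl le_self_add

lemma altSum_pow_le (p : ℕ) (hp : p ≠ 0) (t : A → ℝ≥0∞) : ∀ l : List A,
    altSum t l ^ p ≤ (2 ^ p) ^ l.length * altSum (fun y => t y ^ p) l
  | [] => by simp [altSum, hp]
  | [y] => by
    simp only [altSum]
    exact le_mul_of_one_le_left' (one_le_pow₀ (one_le_pow₀ one_le_two))
  | y₁ :: y₂ :: l => by
    simp only [altSum, List.length_cons]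
    have h1 : (1 : ℝ≥0∞) ≤ 2 ^ p := one_le_pow₀ one_le_two
    calc _ ≤ 2 ^ p * (t y₁ ^ p + altSum t l ^ p) := ennreal_add_pow_le _ _ p
      _ ≤ 2 ^ p * ((2 ^ p) ^ l.length * t y₁ ^ p +
          (2 ^ p) ^ l.length * altSum (fun y => t y ^ p) l) := by
        gcongr
        · exact le_mul_of_one_le_left' (one_le_pow₀ h1)
        · exact altSum_pow_le p hp t l
      _ = (2 ^ p) ^ (l.length + 1) * (t y₁ ^ p + altSum (fun y => t y ^ p) l) := by ring
      _ ≤ _ := mul_le_mul' (pow_le_pow_right₀ h1 (by omega)) le_rfl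

end Alternating

section Moments

variable {A : Type*} [NormedAddCommGroup A]

/-- The bracket `1 + ‖x‖`. -/
noncomputable def jb (x : A) : ℝ≥0∞ := 1 + ‖x‖ₑ

lemma one_le_jb (x : A) : 1 ≤ jb x := le_self_add

lemma jb_neg (x : A) : jb (-x) = jb x := by simp [jb]

lemma jb_ne_top (x : A) : jb x ≠ ⊤ := by simp [jb]

lemma jb_add_le_mul (x y : A) : jb (x + y) ≤ jb x * jb y := by
  unfold jb
  calc 1 + ‖x + y‖ₑ ≤ 1 + (‖x‖ₑ + ‖y‖ₑ) := by gcongr; exact enorm_add_le x y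
    _ ≤ 1 + (‖x‖ₑ + ‖y‖ₑ) + ‖x‖ₑ * ‖y‖ₑ := le_self_add
    _ = _ := by ring

lemma jb_add_le_add (x y : A) : jb (x + y) ≤ jb x + jb y := by
  unfold jb
  calc 1 + ‖x + y‖ₑ ≤ 1 + (‖x‖ₑ + ‖y‖ₑ) := by gcongr; exact enorm_add_le x y
    _ ≤ 1 + (‖x‖ₑ + ‖y‖ₑ) + 1 := le_self_add
    _ = _ := by ring

lemma jb_le_altSum : ∀ (x : A) (l : List A), ladder x l → jb (l.sum + l.sum - x) ≤ altSum jb l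
  | _, [], h => h.elim
  | x, [y], h => by
    have : y = x := h
    subst this
    simp [altSum]
  | x, y₁ :: y₂ :: l, h => by
    obtain ⟨rfl, h⟩ := h
    have e : (y₁ :: y₂ :: l).sum + (y₁ :: y₂ :: l).sum - (y₁ + y₂)
        = y₁ + (l.sum + l.sum - -y₂) := by
      simp only [List.sum_cons]
      abel
    rw [e]
    exact (jb_add_le_add _ _).trans (add_le_add le_rfl (jb_le_altSum _ l h))

lemma jb_rpow_le_altProd {q : ℝ} (hq : 0 ≤ q) : ∀ (x : A) (l : List A), ladder x l →
    jb (x - l.sum) ^ q ≤ altProd (fun y => jb y ^ q) l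
  | _, [], h => h.elim
  | x, [y], h => by
    have : y = x := h
    subst this
    simp [altProd, jb]
  | x, y₁ :: y₂ :: l, h => by
    obtain ⟨rfl, h⟩ := h
    have e : (y₁ + y₂) - (y₁ :: y₂ :: l).sum = y₂ + (-y₂ - l.sum) := by
      simp only [List.sum_cons]
      abel
    rw [e, altProd]
    refine (ENNReal.rpow_le_rpow (jb_add_le_mul _ _) hq).trans ?_
    rw [ENNReal.mul_rpow_of_nonneg _ _ hq]
    exact mul_le_mul' le_rfl (jb_rpow_le_altProd hq _ l h)

/-- Moments of the total displacement of a ladder are dominated by moments of its lines. -/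
lemma jb_pow_mul_rpow_le_markSum (h2 : ∀ y : A, ‖y‖ₑ ≤ ‖y + y‖ₑ) {p : ℕ} (hp : p ≠ 0) {q : ℝ}
    (hq : 0 ≤ q) {l : List A} (h : ladder 0 l) :
    jb l.sum ^ p * jb l.sum ^ q ≤
      (2 ^ p) ^ l.length * markSum (fun y => jb y ^ p) (fun y => jb y ^ q) l := by
  have ha : jb l.sum ≤ altSum jb l := by
    refine le_trans ?_ (jb_le_altSum 0 l h)
    rw [sub_zero]
    exact add_le_add le_rfl (h2 _)
  have hb : jb l.sum ^ q ≤ altProd (fun y => jb y ^ q) l := by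
    have := jb_rpow_le_altProd hq 0 l h
    rwa [zero_sub, jb_neg] at this
  calc _ ≤ ((2 ^ p) ^ l.length * altSum (fun y => jb y ^ p) l) *
        altProd (fun y => jb y ^ q) l :=
        mul_le_mul' ((pow_le_pow_left' ha p).trans (altSum_pow_le p hp jb l)) hb
    _ ≤ _ := by
        rw [mul_assoc]
        exact mul_le_mul' le_rfl
          (altSum_mul_altProd_le (fun y => by simpa using ENNReal.rpow_le_rpow (one_le_jb y) hq) l)

end Moments

section Monotonicity

variable {σ M : Type*} [AddCommGroup M] (st : σ → M) {w₁ w₂ : M → ℝ}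

lemma pointInt_anti (h : ∀ x, w₁ x ≤ w₂ x) (h₁ : ∀ x, 0 ≤ w₁ x ∧ w₁ x ≤ 1)
    (h₂ : ∀ x, 0 ≤ w₂ x ∧ w₂ x ≤ 1) (A : List σ) (c : M) :
    pointInt st w₂ A c ≤ pointInt st w₁ A c := by
  induction A with
  | nil => exact le_rfl
  | cons e A ih =>
    refine mul_le_mul (by linarith [h (disp st (e :: A) + c)]) ih (pointInt_mem st h₂ A c).1 ?_
    linarith [(h₁ (disp st (e :: A) + c)).2]

lemma crossInt_anti (h : ∀ x, w₁ x ≤ w₂ x) (h₁ : ∀ x, 0 ≤ w₁ x ∧ w₁ x ≤ 1)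
    (h₂ : ∀ x, 0 ≤ w₂ x ∧ w₂ x ≤ 1) (A : List σ) (c : M) (C : List σ) :
    crossInt st w₂ A c C ≤ crossInt st w₁ A c C := by
  induction C generalizing c with
  | nil => exact le_rfl
  | cons f C ih =>
    exact mul_le_mul (pointInt_anti st h h₁ h₂ A _) (ih _) (crossInt_mem st h₂ A _ C).1
      (pointInt_mem st h₁ A _).1

lemma walkInt_anti (h : ∀ x, w₁ x ≤ w₂ x) (h₁ : ∀ x, 0 ≤ w₁ x ∧ w₁ x ≤ 1)
    (h₂ : ∀ x, 0 ≤ w₂ x ∧ w₂ x ≤ 1) (ω : List σ) : walkInt st w₂ ω ≤ walkInt st w₁ ω := by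
  induction ω with
  | nil => exact le_rfl
  | cons e ω ih =>
    exact mul_le_mul (crossInt_anti st h h₁ h₂ _ _ _) ih (walkInt_mem st h₂ ω).1
      (crossInt_mem st h₁ _ _ _).1

end Monotonicity

lemma two_mul_add_one_le_three_pow (N : ℕ) : 2 * N + 1 ≤ 3 ^ N := by
  induction N with
  | zero => simp
  | succ N ih => rw [pow_succ]; omega

section Contact

variable {σ M A : Type*} [AddCommGroup M] [AddCommGroup A]

/-- The contact interaction of strength `β` between points identified by `φ`. -/
noncomputable def contactW (φ : M →+ A) (β : ℝ) (x : M) : ℝ :=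
  open Classical in if φ x = 0 then β else 0

variable {β : ℝ}

lemma contactW_mem (φ : M →+ A) {c : ℝ} (h0 : 0 ≤ β) (h1 : β ≤ c) (x : M) :
    0 ≤ contactW φ β x ∧ contactW φ β x ≤ c := by
  unfold contactW
  split_ifs
  · exact ⟨h0, h1⟩
  · exact ⟨le_rfl, h0.trans h1⟩

lemma contactW_id_le (φ : M →+ A) (h0 : 0 ≤ β) (x : M) :
    contactW (AddMonoidHom.id M) β x ≤ contactW φ β x := by
  unfold contactW
  split_ifs with h h' h'
  · exact le_rfl
  · simp_all
  · exact h0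
  · exact le_rfl

lemma ofReal_contactW_le (φ : M →+ A) (x : M) :
    ENNReal.ofReal (contactW φ β x) ≤ ENNReal.ofReal β * zeroInd (φ x) := by
  unfold contactW zeroInd
  split_ifs <;> simp

variable (st : σ → M)

/-- The weight of a walk with contact interaction and activity `q`. -/
noncomputable def wt (β : ℝ) (q : ℝ≥0∞) (ω : List σ) : ℝ≥0∞ :=
  ENNReal.ofReal (walkInt st (contactW (AddMonoidHom.id M) β) ω) * q ^ ω.length

variable {st} {q : ℝ≥0∞}

lemma wt_append_le (h0 : 0 ≤ β) (h1 : β ≤ 1) (u v : List σ) :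
    wt st β q (u ++ v) ≤ wt st β q u * wt st β q v := by
  have hw := contactW_mem (AddMonoidHom.id M) h0 h1
  calc wt st β q (u ++ v) ≤ ENNReal.ofReal (walkInt st (contactW (AddMonoidHom.id M) β) u *
        walkInt st (contactW (AddMonoidHom.id M) β) v) * q ^ (u ++ v).length :=
        mul_le_mul' (ENNReal.ofReal_le_ofReal (walkInt_append_le st hw u v)) le_rfl
    _ = _ := by
        rw [ENNReal.ofReal_mul (walkInt_mem st hw u).1, List.length_append, pow_add, wt, wt]
        ring

lemma ofReal_walkInt_le (φ : M →+ A) (h0 : 0 ≤ β) (h1 : β ≤ 1) (ω : List σ) :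
    ENNReal.ofReal (walkInt st (contactW φ β) ω) ≤
      ENNReal.ofReal (walkInt st (contactW (AddMonoidHom.id M) β) ω) :=
  ENNReal.ofReal_le_ofReal (walkInt_anti st (contactW_id_le φ h0)
    (contactW_mem _ h0 h1) (contactW_mem _ h0 h1) ω)

lemma pushF_length_mul_le {W : List σ → ℝ≥0∞} {π : List σ → A} {b : ℝ≥0∞}
    (hW : ∀ u v, W (u ++ v) ≤ W u * W v) (hπ : ∀ u v, π (u ++ v) = π u + π v)
    (hf : SqSumLE (pushF π W) b) (x : A) :
    pushF π (fun γ => W γ * γ.length) x ≤ b ^ 2 := by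
  classical
  calc pushF π (fun γ => W γ * γ.length) x
      ≤ ∑' γ, W γ * (splitSum γ (fun _ _ => 1) * zeroInd (x - π γ)) := by
        refine ENNReal.tsum_le_tsum fun γ => ?_
        have e : (γ.length : ℝ≥0∞) ≤ splitSum γ (fun _ _ => 1) := by simp [splitSum]
        by_cases h : π γ = x
        · simpa [zeroInd, h] using mul_le_mul' (le_refl (W γ)) e
        · simp [h]
    _ ≤ ∑' u, ∑' v, W u * W v * 1 * zeroInd (x - π (u ++ v)) :=
        tsum_mul_splitSum_le hW _ fun γ => zeroInd (x - π γ)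
    _ = ∑' z, ∑' y, pushF π W y * pushF π W (z - y) * zeroInd (x - z) := by
        simp only [mul_one, hπ]
        rw [tsum_pushF₂ W W fun y z => zeroInd (x - (y + z))]
        simp only [add_sub_cancel]
    _ = ∑' y, pushF π W y * pushF π W (x - y) := by
        rw [tsum_eq_single x]
        · simp [zeroInd]
        · intro z hz
          simp [zeroInd, sub_eq_zero, Ne.symm hz]
    _ ≤ b ^ 2 := by
        rw [sq]
        exact hf.tsum_mul_le (hf.comp_sub x)

lemma half_le_one_of_le {β : ℝ} (h1 : β ≤ 1 / 2) : β ≤ 1 := by linarith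

/-- First length moment of the irreducible interactions. -/
theorem irrInt_length_sum_le (φ : M →+ A) (h0 : 0 ≤ β) (h1 : β ≤ 1 / 2) {b : ℝ≥0∞}
    (hf : SqSumLE (pushF (fun γ => φ (disp st γ)) (wt st β q)) b)
    (hb : ENNReal.ofReal β * (3 * b ^ 2) ≤ 1 / 2) :
    ∑' ω, (if 2 ≤ ω.length then ENNReal.ofReal |irrInt st (contactW φ β) ω| * q ^ ω.length *
      ω.length else 0) ≤ 4 * ENNReal.ofReal β * b ^ 2 := by
  have h1' := half_le_one_of_le h1
  refine irrInt_sum_le_of_fam (st := st) (φ := φ) (contactW_mem φ h0 h1)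
    (ofReal_walkInt_le φ h0 h1') (ofReal_contactW_le φ)
    (Φ := fun _ => markSum (fun γ => (γ.length : ℝ≥0∞)) (fun _ => 1))
    (fun N γs _ _ => (length_flatten_eq_markSum γs).le) (fun N => ?_) hb
  obtain ⟨S, hS, hS', hD⟩ := exists_markSum_le (W := wt st β q)
    (t := fun γ => (γ.length : ℝ≥0∞)) (s := fun _ => 1) (π := fun γ => φ (disp st γ))
    (by simpa using hf)
    (pushF_length_mul_le (wt_append_le h0 h1') (fun u v => by simp) hf) (2 * N + 1)
  refine (hD _).trans ((famSum_ladderInd_le hS hS' 0).trans ?_)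
  rw [add_tsub_cancel_right, mul_comm (b ^ 2) (3 ^ N), ← mul_assoc]
  refine mul_le_mul' (mul_le_mul' ?_ le_rfl) le_rfl
  exact_mod_cast two_mul_add_one_le_three_pow N

end Contact

section Moment

variable {σ M A : Type*} [AddCommGroup M] [NormedAddCommGroup A] {β : ℝ} {st : σ → M}
  {q : ℝ≥0∞}

lemma sum_map_hom {φ : M →+ A} (γs : List (List σ)) :
    (γs.map fun γ => φ (disp st γ)).sum = φ (disp st γs.flatten) := by
  induction γs with
  | nil => simp
  | cons γ γs ih => simp [ih]

/-- Spatial moments of the irreducible interactions. -/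
theorem irrInt_moment_sum_le (φ : M →+ A) (h2 : ∀ y : A, ‖y‖ₑ ≤ ‖y + y‖ₑ) (h0 : 0 ≤ β)
    (h1 : β ≤ 1 / 2) {p : ℕ} (hp : p ≠ 0) {k : ℝ} (hk : 0 ≤ k) {b c : ℝ≥0∞}
    (hf : SqSumLE (pushF (fun γ => φ (disp st γ))
      fun γ => wt st β q γ * jb (φ (disp st γ)) ^ k) b)
    (hc : ∀ x, pushF (fun γ => φ (disp st γ))
      (fun γ => wt st β q γ * jb (φ (disp st γ)) ^ p) x ≤ c)
    (hb : ENNReal.ofReal β * (3 * 4 ^ p * b ^ 2) ≤ 1 / 2) :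
    ∑' ω, (if 2 ≤ ω.length then ENNReal.ofReal |irrInt st (contactW φ β) ω| * q ^ ω.length *
      (jb (φ (disp st ω)) ^ p * jb (φ (disp st ω)) ^ k) else 0) ≤
      4 * ENNReal.ofReal β * (2 ^ p * c) := by
  have h1' := half_le_one_of_le h1
  refine irrInt_sum_le_of_fam (st := st) (φ := φ) (contactW_mem φ h0 h1)
    (ofReal_walkInt_le φ h0 h1') (ofReal_contactW_le φ)
    (Ψ := fun ω => jb (φ (disp st ω)) ^ p * jb (φ (disp st ω)) ^ k)
    (Φ := fun N γs => (2 ^ p) ^ (2 * N + 1) * markSum (fun γ => jb (φ (disp st γ)) ^ p)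
      (fun γ => jb (φ (disp st γ)) ^ k) γs) (fun N γs hl hlad => ?_) (fun N => ?_) hb
  · have := jb_pow_mul_rpow_le_markSum h2 hp hk hlad
    rwa [sum_map_hom, List.length_map, hl, markSum_map] at this
  · obtain ⟨S, hS, hS', hD⟩ := exists_markSum_le (W := wt st β q)
      (t := fun γ => jb (φ (disp st γ)) ^ p) (s := fun γ => jb (φ (disp st γ)) ^ k)
      (π := fun γ => φ (disp st γ)) hf hc (2 * N + 1)
    simp only [mul_left_comm _ ((2 ^ p) ^ (2 * N + 1) : ℝ≥0∞)]
    rw [msum_const_mul]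
    refine (mul_le_mul' le_rfl ((hD _).trans (famSum_ladderInd_le hS hS' 0))).trans ?_
    calc (2 ^ p) ^ (2 * N + 1) * (((2 * N + 1 : ℕ) : ℝ≥0∞) * (c * b ^ (2 * N + 1 - 1)))
        ≤ (2 ^ p) ^ (2 * N + 1) * (3 ^ N * (c * b ^ (2 * N))) := by
          rw [add_tsub_cancel_right]
          gcongr
          exact_mod_cast two_mul_add_one_le_three_pow N
      _ = _ := by
          rw [show (4 : ℝ≥0∞) = 2 ^ 2 by norm_num, pow_succ, pow_mul, mul_pow, ← pow_mul, ← pow_mul,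
            ← pow_mul, ← pow_mul]
          ring

end Moment

section Wrap

variable {σ M A : Type*} [NormedAddCommGroup M] [AddCommGroup A] {β : ℝ} {st : σ → M}
  {q : ℝ≥0∞}

/-- The indicator function of the walks which close a loop only after identification by `φ`. -/
noncomputable def wrapInd (st : σ → M) (φ : M →+ A) (ω : List σ) : ℝ≥0∞ :=
  open Classical in if ∃ v, v <:+: ω ∧ φ (disp st v) = 0 ∧ disp st v ≠ 0 then 1 else 0

/-- The indicator function of the walks with displacement of norm at least `T`. -/
noncomputable def longInd (st : σ → M) (T : ℝ) (ω : List σ) : ℝ≥0∞ :=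
  if T ≤ ‖disp st ω‖ then 1 else 0

lemma irrInt_eq_of_wrapInd_eq_zero (φ : M →+ A) (ω : List σ) (h : wrapInd st φ ω = 0) :
    irrInt st (contactW (AddMonoidHom.id M) β) ω = irrInt st (contactW φ β) ω := by
  refine irrInt_congr st ω fun v hv _ => ?_
  have h' : ¬ ∃ v, v <:+: ω ∧ φ (disp st v) = 0 ∧ disp st v ≠ 0 := by
    intro hx
    simp [wrapInd, hx] at h
  unfold contactW
  by_cases h0 : disp st v = 0
  · simp [h0]
  · have : φ (disp st v) ≠ 0 := fun hx => h' ⟨v, hv, hx, h0⟩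
    simp [h0, this]

lemma irrInt_wrap_sum_le {B : Type*} [AddCommGroup B] (φ : M →+ A) (ψ : M →+ B)
    (hψ : ∀ x, contactW ψ β x ≤ contactW φ β x) (h0 : 0 ≤ β) (h1 : β ≤ 1 / 2)
    {R : ℝ} (hR : 0 < R) (hφ : ∀ x, φ x = 0 → x ≠ 0 → R ≤ ‖x‖) {b c E : ℝ≥0∞} (hb1 : 1 ≤ b)
    (hf : SqSumLE (pushF (fun γ => φ (disp st γ)) (wt st β q)) b)
    (hc : ∀ (N : ℕ) (x), pushF (fun γ => φ (disp st γ))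
      (fun γ => longInd st (R / (2 * N + 1)) γ * wt st β q γ) x ≤ c * E ^ N)
    (hb : ENNReal.ofReal β * (64 * E * (b ^ 2) ^ 2) ≤ 1 / 2) :
    ∑' ω, (if 2 ≤ ω.length then ENNReal.ofReal |irrInt st (contactW ψ β) ω| * q ^ ω.length *
      wrapInd st φ ω else 0) ≤ 4 * ENNReal.ofReal β * (8 * c * b ^ 2) := by
  have h1' := half_le_one_of_le h1
  refine irrInt_sum_le_of_fam (st := st) (φ := φ) (contactW_mem ψ h0 h1)
    (ofReal_walkInt_le ψ h0 h1')
    (fun x => (ENNReal.ofReal_le_ofReal (hψ x)).trans (ofReal_contactW_le φ x))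
    (Φ := fun N => wrapSum (fun γ => φ (disp st γ)) (longInd st (R / (2 * N + 1))))
    (fun N γs hl _ => ?_) (fun N => ?_) hb
  · unfold wrapInd
    split_ifs with h
    · obtain ⟨v, ⟨u, x, e⟩, hv, hv0⟩ := h
      have hRv := hφ _ hv hv0
      have hN : (0 : ℝ) < 2 * N + 1 := by positivity
      refine one_le_wrapSum (ν := fun γ => ‖disp st γ‖) (T := R / (2 * N + 1))
        (fun u v => by simp) (fun u v => ?_) (by positivity) (fun γ hγ => ?_) γs u v x e.symm hv
        (hR.trans_le hRv) (by simp) ?_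
      · rw [disp_append]
        exact norm_add_le _ _
      · simp [longInd, hγ]
      · rw [hl]
        push_cast
        rw [mul_div_cancel₀ _ hN.ne']
        exact hRv
    · exact zero_le
  · obtain ⟨S, hS, hS', hD⟩ := exists_wrapSum_le (W := wt st β q)
      (lg := longInd st (R / (2 * N + 1))) (π := fun γ => φ (disp st γ))
      (wt_append_le h0 h1') (fun u v => by simp) hb1 hf (hc N) (2 * N + 1)
    refine (hD _).trans ((famSum_ladderInd_le hS hS' 0).trans (le_of_eq ?_))
    rw [add_tsub_cancel_right]
    push_cast
    have h64 : (64 : ℝ≥0∞) ^ N = 8 ^ (2 * N) := by rw [pow_mul]; norm_num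
    rw [mul_pow, h64]
    ring

/-- The irreducible interactions with and without identification are close. -/
theorem irrInt_sub_sum_le (φ : M →+ A) (h0 : 0 ≤ β) (h1 : β ≤ 1 / 2)
    {R : ℝ} (hR : 0 < R) (hφ : ∀ x, φ x = 0 → x ≠ 0 → R ≤ ‖x‖) {b c E : ℝ≥0∞} (hb1 : 1 ≤ b)
    (hf : SqSumLE (pushF (fun γ => φ (disp st γ)) (wt st β q)) b)
    (hc : ∀ (N : ℕ) (x), pushF (fun γ => φ (disp st γ))
      (fun γ => longInd st (R / (2 * N + 1)) γ * wt st β q γ) x ≤ c * E ^ N)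
    (hb : ENNReal.ofReal β * (64 * E * (b ^ 2) ^ 2) ≤ 1 / 2) :
    ∑' ω, ENNReal.ofReal |irrInt st (contactW φ β) ω -
      irrInt st (contactW (AddMonoidHom.id M) β) ω| * q ^ ω.length ≤
      64 * ENNReal.ofReal β * (c * b ^ 2) := by
  have e1 := irrInt_wrap_sum_le (st := st) (q := q) φ φ (fun x => le_rfl) h0 h1 hR hφ hb1 hf hc hb
  have e2 := irrInt_wrap_sum_le (st := st) (q := q) φ (AddMonoidHom.id M) (contactW_id_le φ h0)
    h0 h1 hR hφ hb1 hf hc hb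
  calc _ ≤ ∑' ω, ((if 2 ≤ ω.length then ENNReal.ofReal |irrInt st (contactW φ β) ω| *
          q ^ ω.length * wrapInd st φ ω else 0) + (if 2 ≤ ω.length then
          ENNReal.ofReal |irrInt st (contactW (AddMonoidHom.id M) β) ω| * q ^ ω.length *
          wrapInd st φ ω else 0)) := by
        refine ENNReal.tsum_le_tsum fun ω => ?_
        by_cases hlen : 2 ≤ ω.length
        · simp only [if_pos hlen]
          by_cases hx : wrapInd st φ ω = 0
          · simp [irrInt_eq_of_wrapInd_eq_zero (β := β) φ ω hx]
          · have hx1 : wrapInd st φ ω = 1 := by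
              unfold wrapInd at hx ⊢
              split_ifs at hx ⊢ <;> simp_all
            rw [hx1, mul_one, mul_one, ← add_mul,
              ← ENNReal.ofReal_add (abs_nonneg _) (abs_nonneg _)]
            exact mul_le_mul' (ENNReal.ofReal_le_ofReal (abs_sub _ _)) le_rfl
        · match ω, hlen with
          | [], _ => simp [irrInt]
          | [e], _ => simp [irrInt_singleton]
          | e :: f :: C, h => simp at h
    _ ≤ 4 * ENNReal.ofReal β * (8 * c * b ^ 2) + 4 * ENNReal.ofReal β * (8 * c * b ^ 2) := by
        rw [ENNReal.tsum_add]
        exact add_le_add e1 e2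
    _ = _ := by ring

end Wrap

section GeneratingFunctions

variable {σ : Type*}

/-- Renewal sequences have reciprocal generating functions. -/
theorem tsum_mul_one_sub_tsum_eq_one {K j : List σ → ℝ}
    (hren : ∀ ω, K ω = (if ω = [] then 1 else 0) +
      ∑ n ∈ Finset.range (ω.length + 1), j (ω.take n) * K (ω.drop n))
    {X : List σ → ℂ} (hX0 : X [] = 1) (hX : ∀ u v, X (u ++ v) = X u * X v)
    (hK : Summable fun ω => ‖(K ω : ℂ) * X ω‖) (hj : Summable fun ω => ‖(j ω : ℂ) * X ω‖) :
    (∑' ω, (K ω : ℂ) * X ω) * (1 - ∑' ω, (j ω : ℂ) * X ω) = 1 := by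
  classical
  have hprod := summable_mul_of_summable_norm hj hK
  have hs : Summable fun p : Σ ω : List σ, Fin (ω.length + 1) =>
      ((j (p.1.take p.2) : ℂ) * X (p.1.take p.2)) * ((K (p.1.drop p.2) : ℂ) * X (p.1.drop p.2)) :=
    (splitEquiv σ).summable_iff.2 hprod
  have e1 : (∑' ω, (j ω : ℂ) * X ω) * (∑' ω, (K ω : ℂ) * X ω) =
      ∑' ω : List σ, ((K ω : ℂ) * X ω - if ω = [] then 1 else 0) := by
    rw [tsum_mul_tsum_of_summable_norm hj hK, ← (splitEquiv σ).tsum_eq]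
    refine (hs.tsum_sigma' fun ω => Summable.of_finite).trans (tsum_congr fun ω => ?_)
    have h1 : ∀ n : Fin (ω.length + 1), ((j (ω.take n) : ℂ) * X (ω.take n)) *
        ((K (ω.drop n) : ℂ) * X (ω.drop n)) = ((j (ω.take n) * K (ω.drop n) : ℝ) : ℂ) * X ω := by
      intro n
      have := hX (ω.take n) (ω.drop n)
      rw [List.take_append_drop] at this
      rw [this]
      push_cast
      ring
    rw [tsum_fintype]
    simp only [h1]
    rw [Fin.sum_univ_eq_sum_range
      (fun n => ((j (ω.take n) * K (ω.drop n) : ℝ) : ℂ) * X ω) (ω.length + 1), ← Finset.sum_mul,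
      ← Complex.ofReal_sum]
    have h2 := hren ω
    rw [← sub_eq_iff_eq_add'] at h2
    rw [← h2]
    split_ifs with h
    · subst h
      simp [hX0]
    · simp
  have hK' : Summable fun ω => (K ω : ℂ) * X ω := hK.of_norm
  have hite : HasSum (fun ω : List σ => if ω = [] then (1 : ℂ) else 0) 1 :=
    hasSum_ite_eq [] 1
  rw [hK'.tsum_sub hite.summable, hite.tsum_eq] at e1
  linear_combination -e1

lemma eq_of_renewal {K j K' j' : List σ → ℝ}
    (hren : ∀ ω, K ω = (if ω = [] then 1 else 0) +
      ∑ n ∈ Finset.range (ω.length + 1), j (ω.take n) * K (ω.drop n))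
    (hren' : ∀ ω, K' ω = (if ω = [] then 1 else 0) +
      ∑ n ∈ Finset.range (ω.length + 1), j' (ω.take n) * K' (ω.drop n))
    (h0 : K [] = 1) (h : ∀ ω, K ω = K' ω) (ω : List σ) : j ω = j' ω := by
  induction hn : ω.length using Nat.strong_induction_on generalizing ω with
  | _ n ih =>
    have h1 := hren ω
    have h2 := hren' ω
    rw [Finset.sum_range_succ, List.take_length, List.drop_length] at h1 h2
    have h3 : ∑ n ∈ Finset.range ω.length, j (ω.take n) * K (ω.drop n)
        = ∑ n ∈ Finset.range ω.length, j' (ω.take n) * K' (ω.drop n) := by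
      refine Finset.sum_congr rfl fun m hm => ?_
      have hm' := Finset.mem_range.1 hm
      rw [h, ih m (hn ▸ hm') _ (by simp; omega)]
    rw [h3, h0] at h1
    rw [← h, ← h, h0] at h2
    linarith

variable {M : Type*} [AddCommGroup M] {st : σ → M} {w : M → ℝ} {ν : σ → σ}

lemma disp_map (hν : ∀ e, st (ν e) = - st e) (ω : List σ) :
    disp st (ω.map ν) = - disp st ω := by
  induction ω with
  | nil => simp
  | cons e ω ih => simp [ih, hν, add_comm]

lemma pointInt_map (hν : ∀ e, st (ν e) = - st e) (hw : ∀ x, w (-x) = w x) (A : List σ) (c : M) :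
    pointInt st w (A.map ν) (-c) = pointInt st w A c := by
  induction A with
  | nil => rfl
  | cons e A ih =>
    have h1 : disp st ((e :: A).map ν) + -c = -(disp st (e :: A) + c) := by
      rw [disp_map hν, neg_add]
    rw [pointInt, ← ih, ← hw, ← h1]
    rfl

lemma crossInt_map (hν : ∀ e, st (ν e) = - st e) (hw : ∀ x, w (-x) = w x) (A : List σ) (c : M)
    (C : List σ) : crossInt st w (A.map ν) (-c) (C.map ν) = crossInt st w A c C := by
  induction C generalizing c with
  | nil => rfl
  | cons f C ih =>
    rw [List.map_cons, crossInt, crossInt, ← ih, hν, ← neg_add, pointInt_map hν hw]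

lemma walkInt_map (hν : ∀ e, st (ν e) = - st e) (hw : ∀ x, w (-x) = w x) (ω : List σ) :
    walkInt st w (ω.map ν) = walkInt st w ω := by
  induction ω with
  | nil => rfl
  | cons e ω ih =>
    have := crossInt_map hν hw [e] 0 ω
    rw [neg_zero] at this
    rw [List.map_cons, walkInt, ih, walkInt, ← this]
    rfl

lemma irrInt_map (hν : ∀ e, st (ν e) = - st e) (hw : ∀ x, w (-x) = w x) (ω : List σ) :
    irrInt st w (ω.map ν) = irrInt st w ω := by
  refine eq_of_renewal (K := fun ω => walkInt st w (ω.map ν)) (K' := walkInt st w)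
    (j := fun ω => irrInt st w (ω.map ν)) (fun ω => ?_) (walkInt_renewal st w) rfl
    (walkInt_map hν hw) ω
  have := walkInt_renewal st w (ω.map ν)
  simpa only [List.map_eq_nil_iff, List.length_map, ← List.map_take, ← List.map_drop] using this

end GeneratingFunctions

section Differences

/-- The forward difference of a sequence. -/
def dif (f : ℕ → ℂ) (m : ℕ) : ℂ := f (m + 1) - f m

lemma dif_iter_succ (j : ℕ) (f : ℕ → ℂ) : dif^[j + 1] f = dif^[j] (dif f) :=
  Function.iterate_succ_apply dif j f

lemma dif_iter_add (j : ℕ) (f g : ℕ → ℂ) (m : ℕ) :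
    dif^[j] (fun m => f m + g m) m = dif^[j] f m + dif^[j] g m := by
  induction j generalizing f g with
  | zero => rfl
  | succ j ih =>
    have e : dif (fun m => f m + g m) = fun m => dif f m + dif g m := by
      funext m
      simp only [dif]
      ring
    rw [dif_iter_succ, e, ih, dif_iter_succ, dif_iter_succ]

lemma dif_iter_neg (j : ℕ) (f : ℕ → ℂ) (m : ℕ) :
    dif^[j] (fun m => -f m) m = -dif^[j] f m := by
  induction j generalizing f with
  | zero => rfl
  | succ j ih =>
    have e : dif (fun m => -f m) = fun m => -dif f m := by
      funext m
      simp only [dif]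
      ring
    rw [dif_iter_succ, e, ih, dif_iter_succ]

lemma dif_iter_congr (j : ℕ) (f g : ℕ → ℂ) (n : ℕ) (h : ∀ m ≤ n, f m = g m) (m : ℕ)
    (hm : j + m ≤ n) : dif^[j] f m = dif^[j] g m := by
  induction j generalizing f g n with
  | zero => exact h m (by omega)
  | succ j ih =>
    rw [dif_iter_succ, dif_iter_succ]
    refine ih (dif f) (dif g) (n - 1) (fun m hm' => ?_) (by omega)
    rw [dif, dif, h m (by omega), h (m + 1) (by omega)]

lemma dif_iter_shift (j : ℕ) (f : ℕ → ℂ) (m : ℕ) :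
    dif^[j] (fun m => f (m + 1)) m = dif^[j] f (m + 1) := by
  induction j generalizing f with
  | zero => rfl
  | succ j ih =>
    rw [dif_iter_succ, dif_iter_succ, ← ih]
    rfl

/-- The Leibniz rule, in the form of a bound. -/
lemma norm_dif_iter_mul_le (j : ℕ) : ∀ (n : ℕ) (f g : ℕ → ℂ) (a b R : ℕ → ℝ),
    (∀ i m, i ≤ j → i + m ≤ n → ‖dif^[i] f m‖ ≤ a i) →
    (∀ i m, i ≤ j → i + m ≤ n → ‖dif^[i] g m‖ ≤ b i) → (∀ i, 0 ≤ a i) →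
    (∀ i l, a i * b l ≤ R (i + l)) →
    ∀ m, j + m ≤ n → ‖dif^[j] (fun m => f m * g m) m‖ ≤ 2 ^ j * R j := by
  induction j with
  | zero =>
    intro n f g a b R hf hg ha hR m hm
    simp only [Function.iterate_zero, id_eq, norm_mul, pow_zero, one_mul]
    have h1 := hf 0 m le_rfl hm
    have h2 := hg 0 m le_rfl hm
    exact (mul_le_mul h1 h2 (norm_nonneg _) (ha 0)).trans (hR 0 0)
  | succ j ih =>
    intro n f g a b R hf hg ha hR m hm
    obtain ⟨n, rfl⟩ : ∃ k, n = k + 1 := ⟨n - 1, by omega⟩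
    have e : dif (fun m => f m * g m) = fun m => dif f m * g (m + 1) + f m * dif g m := by
      funext m
      simp only [dif]
      ring
    rw [dif_iter_succ, e, dif_iter_add (f := fun m => dif f m * g (m + 1))]
    have h1 := ih n (dif f) (fun m => g (m + 1)) (fun i => a (i + 1)) b (fun i => R (i + 1))
      (fun i m hi h => by rw [← dif_iter_succ]; exact hf _ _ (by omega) (by omega))
      (fun i m hi h => by rw [dif_iter_shift]; exact hg _ _ (by omega) (by omega)) (fun i => ha _)
      (fun i l => by have := hR (i + 1) l; rwa [add_right_comm] at this) m (by omega)
    have h2 := ih n f (dif g) a (fun i => b (i + 1)) (fun i => R (i + 1))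
      (fun i m hi h => hf _ _ (by omega) (by omega))
      (fun i m hi h => by rw [← dif_iter_succ]; exact hg _ _ (by omega) (by omega)) ha
      (fun i l => hR i (l + 1)) m (by omega)
    calc _ ≤ _ := norm_add_le _ _
      _ ≤ 2 ^ j * R (j + 1) + 2 ^ j * R (j + 1) := add_le_add h1 h2
      _ = _ := by ring

/-- Bounds on the differences of a reciprocal. -/
lemma exists_norm_dif_iter_inv_le (A : ℝ) (hA : 0 ≤ A) (n : ℕ) : ∃ C : ℝ, 0 ≤ C ∧
    ∀ (ψ F : ℕ → ℂ) (s : ℝ) (r : ℕ → ℝ), 0 < s → (∀ i, 0 ≤ r i) → 1 ≤ r 0 →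
    (∀ i l, r i * r l ≤ r (i + l)) → (∀ m ≤ n, ψ m * F m = 1) → (∀ m ≤ n, s ≤ ‖ψ m‖) →
    (∀ i m, i + 1 + m ≤ n → ‖dif^[i + 1] ψ m‖ ≤ A * s * r (i + 1)) →
    ∀ i m, i + m ≤ n → ‖dif^[i] F m‖ ≤ C * s⁻¹ * r i := by
  suffices H : ∀ j ≤ n, ∃ C : ℝ, 0 ≤ C ∧
      ∀ (ψ F : ℕ → ℂ) (s : ℝ) (r : ℕ → ℝ), 0 < s → (∀ i, 0 ≤ r i) → 1 ≤ r 0 →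
      (∀ i l, r i * r l ≤ r (i + l)) → (∀ m ≤ n, ψ m * F m = 1) → (∀ m ≤ n, s ≤ ‖ψ m‖) →
      (∀ i m, i + 1 + m ≤ n → ‖dif^[i + 1] ψ m‖ ≤ A * s * r (i + 1)) →
      ∀ i m, i ≤ j → i + m ≤ n → ‖dif^[i] F m‖ ≤ C * s⁻¹ * r i by
    obtain ⟨C, hC, h⟩ := H n le_rfl
    exact ⟨C, hC, fun ψ F s r h1 h2 h3 h4 h5 h6 h7 i m him =>
      h ψ F s r h1 h2 h3 h4 h5 h6 h7 i m (by omega) him⟩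
  intro j
  induction j with
  | zero =>
    intro _
    refine ⟨1, zero_le_one, fun ψ F s r hs hr hr0 hrr hψF hψ hdψ i m hi hm => ?_⟩
    obtain rfl : i = 0 := by omega
    have h1 := hψF m (by omega)
    have h2 := hψ m (by omega)
    have h3 : ‖ψ m‖ * ‖F m‖ = 1 := by rw [← norm_mul, h1, norm_one]
    have h4 : ‖F m‖ ≤ s⁻¹ := by
      rw [← one_div, le_div_iff₀ hs, mul_comm]
      calc s * ‖F m‖ ≤ ‖ψ m‖ * ‖F m‖ := by gcongr
        _ = 1 := h3
    simp only [Function.iterate_zero, id_eq, one_mul]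
    exact h4.trans (le_mul_of_one_le_right (by positivity) hr0)
  | succ j ih =>
    intro hj
    obtain ⟨C, hC, h⟩ := ih (by omega)
    refine ⟨C + 2 ^ j * (A * (2 ^ j * C ^ 2)), by positivity,
      fun ψ F s r hs hr hr0 hrr hψF hψ hdψ i m hi hm => ?_⟩
    have hF := h ψ F s r hs hr hr0 hrr hψF hψ hdψ
    have hsi : 0 < s⁻¹ := by positivity
    rcases Nat.lt_or_ge i (j + 1) with hij | hij
    · refine (hF i m (by omega) hm).trans ?_
      have := hr i
      gcongr
      exact le_add_of_nonneg_right (by positivity)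
    · obtain rfl : i = j + 1 := by omega
      have e : ∀ m ≤ n - 1, dif F m = -dif ψ m * (F m * F (m + 1)) := by
        intro m hm
        have h1 := hψF m (by omega)
        have h2 := hψF (m + 1) (by omega)
        simp only [dif]
        linear_combination F m * h2 - F (m + 1) * h1
      have hFF : ∀ i m, i ≤ j → i + m ≤ n - 1 →
          ‖dif^[i] (fun m => F m * F (m + 1)) m‖ ≤ 2 ^ j * C ^ 2 * (s⁻¹ ^ 2 * r i) := by
        intro i m hi him
        have := norm_dif_iter_mul_le i (n - 1) F (fun m => F (m + 1)) (fun i => C * s⁻¹ * r i)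
          (fun i => C * s⁻¹ * r i) (fun i => C ^ 2 * (s⁻¹ ^ 2 * r i))
          (fun i m h1 h2 => hF i m (by omega) (by omega))
          (fun i m h1 h2 => by rw [dif_iter_shift]; exact hF i (m + 1) (by omega) (by omega))
          (fun i => by have := hr i; positivity)
          (fun i l => by
            calc C * s⁻¹ * r i * (C * s⁻¹ * r l) = C ^ 2 * (s⁻¹ ^ 2 * (r i * r l)) := by ring
              _ ≤ _ := by have := hrr i l; gcongr) m him
        refine this.trans ?_
        have := hr i
        calc 2 ^ i * (C ^ 2 * (s⁻¹ ^ 2 * r i)) ≤ 2 ^ j * (C ^ 2 * (s⁻¹ ^ 2 * r i)) := by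
              gcongr
              norm_num
          _ = _ := by ring
      rw [dif_iter_succ, dif_iter_congr j _ _ (n - 1) e m (by omega)]
      have := norm_dif_iter_mul_le j (n - 1) (fun m => -dif ψ m) (fun m => F m * F (m + 1))
        (fun i => A * s * r (i + 1)) (fun i => 2 ^ j * C ^ 2 * (s⁻¹ ^ 2 * r i))
        (fun i => A * (2 ^ j * C ^ 2) * (s⁻¹ * r (i + 1)))
        (fun i m h1 h2 => by
          rw [dif_iter_neg, norm_neg, ← dif_iter_succ]
          exact hdψ i m (by omega))
        hFF (fun i => by have := hr (i + 1); positivity)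
        (fun i l => by
          have h1 := hrr (i + 1) l
          rw [add_right_comm] at h1
          calc A * s * r (i + 1) * (2 ^ j * C ^ 2 * (s⁻¹ ^ 2 * r l))
              = A * (2 ^ j * C ^ 2) * ((s * s⁻¹) * s⁻¹ * (r (i + 1) * r l)) := by ring
            _ = A * (2 ^ j * C ^ 2) * (s⁻¹ * (r (i + 1) * r l)) := by
              rw [mul_inv_cancel₀ hs.ne', one_mul]
            _ ≤ _ := by gcongr) m (by omega)
      refine this.trans ?_
      have := hr (j + 1)
      calc 2 ^ j * (A * (2 ^ j * C ^ 2) * (s⁻¹ * r (j + 1)))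
          = (0 + 2 ^ j * (A * (2 ^ j * C ^ 2))) * s⁻¹ * r (j + 1) := by ring
        _ ≤ _ := by gcongr

/-- The differences of a sum of geometric sequences. -/
lemma dif_iter_tsum {ι : Type*} (a z : ι → ℂ) (ha : Summable fun x => ‖a x‖)
    (hz : ∀ x, ‖z x‖ = 1) (j : ℕ) (m : ℕ) :
    dif^[j] (fun m => ∑' x, a x * z x ^ m) m = ∑' x, a x * (z x - 1) ^ j * z x ^ m := by
  have hs : ∀ (a : ι → ℂ), (Summable fun x => ‖a x‖) → ∀ m, Summable fun x => a x * z x ^ m := by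
    intro a ha m
    refine Summable.of_norm ?_
    simpa [hz] using ha
  induction j generalizing a with
  | zero => simp
  | succ j ih =>
    have e : dif (fun m => ∑' x, a x * z x ^ m) = fun m => ∑' x, a x * (z x - 1) * z x ^ m := by
      funext m
      rw [dif, ← (hs a ha _).tsum_sub (hs a ha _)]
      congr 1
      funext x
      ring
    rw [dif_iter_succ, e, ih]
    · congr 1
      funext x
      ring
    · refine Summable.of_nonneg_of_le (fun x => norm_nonneg _) (fun x => ?_) (ha.mul_right 2)
      rw [norm_mul]
      have : ‖z x - 1‖ ≤ 2 := (norm_sub_le _ _).trans (by rw [hz, norm_one]; norm_num)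
      gcongr

end Differences

section LatticeSums

variable {d : ℕ}

lemma card_ball_le (ρ : ℝ) (hρ : 1 ≤ ρ) :
    ∑' m : Fin d → ℤ, (if ‖m‖ ≤ ρ then (1 : ℝ≥0∞) else 0) ≤ ENNReal.ofReal ((3 * ρ) ^ d) := by
  classical
  set N : ℕ := ⌊ρ⌋₊
  set s : Finset (Fin d → ℤ) := Fintype.piFinset fun _ => Finset.Icc (-(N : ℤ)) N
  have hs : ∀ m : Fin d → ℤ, ‖m‖ ≤ ρ → m ∈ s := by
    intro m hm
    rw [Fintype.mem_piFinset]
    intro i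
    have h1 : ‖m i‖ ≤ ρ := (norm_le_pi_norm m i).trans hm
    rw [Int.norm_eq_abs, ← Int.cast_abs] at h1
    have h2 : (m i).natAbs ≤ N := by
      apply Nat.le_floor
      rwa [Nat.cast_natAbs]
    rw [Finset.mem_Icc]
    omega
  have hN : (N : ℝ) ≤ ρ := Nat.floor_le (by linarith)
  rw [tsum_eq_sum (s := s) (fun m hm => if_neg fun h => hm (hs m h))]
  calc ∑ m ∈ s, (if ‖m‖ ≤ ρ then (1 : ℝ≥0∞) else 0) ≤ ∑ m ∈ s, 1 := by
        gcongr
        split_ifs <;> simp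
    _ = ENNReal.ofReal (s.card : ℝ) := by simp
    _ ≤ _ := by
      apply ENNReal.ofReal_le_ofReal
      have : s.card = (2 * N + 1) ^ d := by
        simp only [s, Fintype.card_piFinset, Int.card_Icc, Finset.prod_const, Finset.card_univ,
          Fintype.card_fin]
        congr 1
        omega
      rw [this]
      push_cast
      gcongr
      linarith

lemma card_punctured_ball_le (ρ : ℝ) :
    ∑' m : Fin d → ℤ, (if m ≠ 0 ∧ ‖m‖ ≤ ρ then (1 : ℝ≥0∞) else 0) ≤
      ENNReal.ofReal ((3 * ρ) ^ d) := by
  rcases lt_or_ge ρ 1 with h | h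
  · rw [ENNReal.tsum_eq_zero.2]
    · exact zero_le
    · intro m
      refine if_neg fun ⟨h0, hm⟩ => h0 ?_
      funext i
      have h1 : ‖m i‖ < 1 := ((norm_le_pi_norm m i).trans hm).trans_lt h
      rw [Int.norm_eq_abs, ← Int.cast_abs] at h1
      have h2 : |m i| < 1 := by exact_mod_cast h1
      exact Int.abs_lt_one_iff.1 h2
  · refine le_trans (ENNReal.tsum_le_tsum fun m => ?_) (card_ball_le ρ h)
    split_ifs <;> simp_all

lemma tsum_ofReal_geometric (c q : ℝ) (hc : 0 ≤ c) (h0 : 0 ≤ q) (h1 : q < 1) :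
    ∑' k : ℕ, ENNReal.ofReal (c * q ^ k) = ENNReal.ofReal (c * (1 - q)⁻¹) := by
  rw [← ENNReal.ofReal_tsum_of_nonneg (fun k => by positivity)
    ((summable_geometric_of_lt_one h0 h1).mul_left c), tsum_mul_left,
    tsum_geometric_of_lt_one h0 h1]

lemma exists_tsum_max_rpow_le (d : ℕ) : ∃ C : ℝ, 0 ≤ C ∧ ∀ X : ℝ, 1 ≤ X →
    ∑' m : Fin d → ℤ, ENNReal.ofReal (max ‖m‖ X ^ (-((d : ℝ) + 1 / 4))) ≤
      ENNReal.ofReal (C * X ^ (-(1 / 4 : ℝ))) := by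
  set b : ℝ := d + 1 / 4 with hb
  have hb0 : 0 ≤ b := by positivity
  set q : ℝ := 2 ^ (-(1 / 4 : ℝ)) with hq
  have hq0 : 0 < q := by positivity
  have hq1 : q < 1 := Real.rpow_lt_one_of_one_lt_of_neg (by norm_num) (by norm_num)
  refine ⟨2 ^ b * 3 ^ d * (1 - q)⁻¹, by
    have : 0 < 1 - q := by linarith
    positivity, fun X hX => ?_⟩
  have hX0 : 0 < X := by linarith
  have hpt : ∀ m : Fin d → ℤ, ENNReal.ofReal (max ‖m‖ X ^ (-b)) ≤
      ∑' k : ℕ, ENNReal.ofReal (2 ^ b * (2 ^ k * X) ^ (-b)) *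
        (if ‖m‖ ≤ 2 ^ k * X then 1 else 0) := by
    intro m
    have hex : ∃ k : ℕ, ‖m‖ ≤ 2 ^ k * X := by
      obtain ⟨k, hk⟩ := pow_unbounded_of_one_lt ‖m‖ (one_lt_two (α := ℝ))
      exact ⟨k, hk.le.trans (le_mul_of_one_le_right (by positivity) hX)⟩
    classical
    set k := Nat.find hex
    have hk : ‖m‖ ≤ 2 ^ k * X := Nat.find_spec hex
    refine le_trans ?_ (ENNReal.le_tsum k)
    rw [if_pos hk, mul_one]
    apply ENNReal.ofReal_le_ofReal
    have h1 : 2 ^ k * X / 2 ≤ max ‖m‖ X := by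
      rcases Nat.eq_zero_or_pos k with h | h
      · rw [h, pow_zero, one_mul]
        exact le_max_of_le_right (by linarith)
      · have h2 := Nat.find_min hex (m := k - 1) (by omega)
        push Not at h2
        apply le_max_of_le_left
        obtain ⟨l, hl⟩ : ∃ l, k = l + 1 := ⟨k - 1, by omega⟩
        rw [hl, Nat.add_sub_cancel] at h2
        rw [hl, pow_succ]
        linarith
    calc max ‖m‖ X ^ (-b) ≤ (2 ^ k * X / 2) ^ (-b) :=
          Real.rpow_le_rpow_of_nonpos (by positivity) h1 (by linarith)
      _ = 2 ^ b * (2 ^ k * X) ^ (-b) := by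
        rw [Real.div_rpow (by positivity) (by norm_num), Real.rpow_neg (x := 2) (by norm_num),
          div_inv_eq_mul, mul_comm]
  refine (ENNReal.tsum_le_tsum hpt).trans ?_
  rw [ENNReal.tsum_comm]
  calc _ ≤ ∑' k : ℕ, ENNReal.ofReal (2 ^ b * 3 ^ d * X ^ (-(1 / 4 : ℝ)) * q ^ k) := by
        refine ENNReal.tsum_le_tsum fun k => ?_
        rw [ENNReal.tsum_mul_left]
        have h2k : (1 : ℝ) ≤ 2 ^ k := one_le_pow₀ (by norm_num)
        have h1 : 1 ≤ 2 ^ k * X := by nlinarith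
        refine (mul_le_mul_right (card_ball_le _ h1) _).trans ?_
        rw [← ENNReal.ofReal_mul (by positivity)]
        apply ENNReal.ofReal_le_ofReal
        apply le_of_eq
        have h2 : (2 ^ k * X : ℝ) ^ (-b) * (2 ^ k * X) ^ d = (2 ^ k * X) ^ (-(1 / 4 : ℝ)) := by
          rw [← Real.rpow_natCast (2 ^ k * X) d, ← Real.rpow_add (by positivity)]
          congr 1
          rw [hb]
          ring
        have h3 : (2 ^ k * X : ℝ) ^ (-(1 / 4 : ℝ)) = X ^ (-(1 / 4 : ℝ)) * q ^ k := by
          rw [Real.mul_rpow (by positivity) hX0.le, mul_comm, hq, ← Real.rpow_natCast,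
            ← Real.rpow_natCast, ← Real.rpow_mul (by norm_num), ← Real.rpow_mul (by norm_num),
            mul_comm (k : ℝ)]
        rw [mul_pow, mul_assoc (2 ^ b), mul_left_comm _ (3 ^ d), h2, h3]
        ring
    _ = _ := by
      rw [tsum_ofReal_geometric _ _ (by positivity) hq0.le hq1]
      congr 1
      ring

lemma tsum_inv_sq_le (hd : 3 ≤ d) (X : ℝ) (hX : 0 < X) :
    ∑' m : Fin d → ℤ, (if m ≠ 0 ∧ ‖m‖ ≤ X then ENNReal.ofReal ((‖m‖ ^ 2)⁻¹) else 0) ≤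
      ENNReal.ofReal (8 * 3 ^ d * X ^ (d - 2)) := by
  have hpt : ∀ m : Fin d → ℤ,
      (if m ≠ 0 ∧ ‖m‖ ≤ X then ENNReal.ofReal ((‖m‖ ^ 2)⁻¹) else 0) ≤
      ∑' k : ℕ, ENNReal.ofReal (4 * ((X / 2 ^ k) ^ 2)⁻¹) *
        (if m ≠ 0 ∧ ‖m‖ ≤ X / 2 ^ k then 1 else 0) := by
    intro m
    split_ifs with hm
    · have hm0 : 0 < ‖m‖ := norm_pos_iff.2 hm.1
      have hex : ∃ k : ℕ, X / 2 ^ (k + 1) < ‖m‖ := by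
        obtain ⟨k, hk⟩ := pow_unbounded_of_one_lt (X / ‖m‖) (one_lt_two (α := ℝ))
        refine ⟨k, ?_⟩
        rw [div_lt_iff₀ hm0] at hk
        rw [div_lt_iff₀ (by positivity), pow_succ]
        nlinarith
      classical
      set k := Nat.find hex
      have hk : X / 2 ^ (k + 1) < ‖m‖ := Nat.find_spec hex
      have hk2 : ‖m‖ ≤ X / 2 ^ k := by
        rcases Nat.eq_zero_or_pos k with h | h
        · rw [h, pow_zero, div_one]
          exact hm.2
        · have h2 := Nat.find_min hex (m := k - 1) (by omega)
          push Not at h2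
          rwa [Nat.sub_add_cancel h] at h2
      refine le_trans ?_ (ENNReal.le_tsum k)
      rw [if_pos ⟨hm.1, hk2⟩, mul_one]
      apply ENNReal.ofReal_le_ofReal
      calc (‖m‖ ^ 2)⁻¹ ≤ ((X / 2 ^ (k + 1)) ^ 2)⁻¹ := by gcongr
        _ = _ := by
          field_simp
          ring
    · exact zero_le
  refine (ENNReal.tsum_le_tsum hpt).trans ?_
  rw [ENNReal.tsum_comm]
  calc _ ≤ ∑' k : ℕ, ENNReal.ofReal (4 * 3 ^ d * X ^ (d - 2) * (1 / 2) ^ k) := by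
        refine ENNReal.tsum_le_tsum fun k => ?_
        rw [ENNReal.tsum_mul_left]
        refine (mul_le_mul_right (card_punctured_ball_le _) _).trans ?_
        rw [← ENNReal.ofReal_mul (by positivity)]
        apply ENNReal.ofReal_le_ofReal
        obtain ⟨e, rfl⟩ : ∃ e, d = e + 3 := ⟨d - 3, by omega⟩
        rw [show e + 3 - 2 = e + 1 by omega]
        have h1 : ((X / 2 ^ k) ^ 2)⁻¹ * (X / 2 ^ k) ^ (e + 3) = (X / 2 ^ k) ^ (e + 1) := by
          have : X / 2 ^ k ≠ 0 := by positivity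
          rw [show e + 3 = 2 + (e + 1) by ring, pow_add _ 2, inv_mul_cancel_left₀ (by positivity)]
        have h2 : (X / 2 ^ k) ^ (e + 1) ≤ X ^ (e + 1) * (1 / 2) ^ k := by
          rw [div_eq_mul_one_div, mul_pow, ← one_div_pow, ← pow_mul]
          gcongr ?_ * ?_
          exact pow_le_pow_of_le_one (by norm_num) (by norm_num) (by nlinarith)
        calc 4 * ((X / 2 ^ k) ^ 2)⁻¹ * (3 * (X / 2 ^ k)) ^ (e + 3)
            = 4 * 3 ^ (e + 3) * (((X / 2 ^ k) ^ 2)⁻¹ * (X / 2 ^ k) ^ (e + 3)) := by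
              rw [mul_pow]
              ring
          _ ≤ 4 * 3 ^ (e + 3) * (X ^ (e + 1) * (1 / 2) ^ k) := by
              rw [h1]
              gcongr
          _ = _ := by ring
    _ = _ := by
      rw [tsum_ofReal_geometric _ _ (by positivity) (by norm_num) (by norm_num)]
      congr 1
      norm_num
      ring

end LatticeSums

section Characters

variable {d : ℕ}

/-- The character `x ↦ exp (i k·x)`. -/
noncomputable def ech (k : Fin d → ℝ) (x : Fin d → ℤ) : ℂ :=
  Complex.exp ((∑ l, k l * x l : ℝ) * Complex.I)

lemma norm_ech (k : Fin d → ℝ) (x : Fin d → ℤ) : ‖ech k x‖ = 1 :=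
  Complex.norm_exp_ofReal_mul_I _

lemma ech_add_left (k k' : Fin d → ℝ) (x : Fin d → ℤ) : ech (k + k') x = ech k x * ech k' x := by
  rw [ech, ech, ech, ← Complex.exp_add, ← add_mul, ← Complex.ofReal_add, ← Finset.sum_add_distrib]
  simp only [Pi.add_apply, add_mul]

lemma ech_add (k : Fin d → ℝ) (x y : Fin d → ℤ) : ech k (x + y) = ech k x * ech k y := by
  rw [ech, ech, ech, ← Complex.exp_add, ← add_mul, ← Complex.ofReal_add, ← Finset.sum_add_distrib]
  simp only [Pi.add_apply, Int.cast_add, mul_add]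

@[simp] lemma ech_zero (k : Fin d → ℝ) : ech k 0 = 1 := by simp [ech]

lemma ech_ne_zero (k : Fin d → ℝ) (x : Fin d → ℤ) : ech k x ≠ 0 := Complex.exp_ne_zero _

lemma ech_neg (k : Fin d → ℝ) (x : Fin d → ℤ) : ech k (-x) = (ech k x)⁻¹ := by
  apply eq_inv_of_mul_eq_one_left
  rw [← ech_add, neg_add_cancel, ech_zero]

lemma ech_eq_prod (k : Fin d → ℝ) (x : Fin d → ℤ) :
    ech k x = ∏ l, Complex.exp (k l * Complex.I) ^ x l := by
  rw [ech, Complex.ofReal_sum, Finset.sum_mul, Complex.exp_sum]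
  refine Finset.prod_congr rfl fun l _ => ?_
  rw [← Complex.exp_int_mul]
  push_cast
  ring_nf

/-- The distance of a wave vector to the origin, in the sup norm of the phases. -/
noncomputable def lam (k : Fin d → ℝ) : ℝ := ‖fun l => Complex.exp (k l * Complex.I) - 1‖

lemma lam_nonneg (k : Fin d → ℝ) : 0 ≤ lam k := norm_nonneg _

lemma lam_le_two (k : Fin d → ℝ) : lam k ≤ 2 := by
  refine (pi_norm_le_iff_of_nonneg (by norm_num)).2 fun l => ?_
  refine (norm_sub_le _ _).trans ?_
  rw [Complex.norm_exp_ofReal_mul_I, norm_one]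
  norm_num

lemma norm_exp_sub_one_le (t : ℝ) : ‖Complex.exp (t * Complex.I) - 1‖ ≤ |t| := by
  have := Real.norm_exp_I_mul_ofReal_sub_one_le (x := t)
  rwa [mul_comm, Real.norm_eq_abs] at this

lemma lam_add_le (k k' : Fin d → ℝ) : lam (k + k') ≤ lam k + ‖k'‖ := by
  refine (pi_norm_le_iff_of_nonneg (add_nonneg (lam_nonneg _) (norm_nonneg _))).2 fun l => ?_
  have e : Complex.exp ((k + k') l * Complex.I) - 1 = (Complex.exp (k l * Complex.I) - 1) +
      Complex.exp (k l * Complex.I) * (Complex.exp (k' l * Complex.I) - 1) := by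
    rw [Pi.add_apply, Complex.ofReal_add, add_mul, Complex.exp_add]
    ring
  rw [e]
  refine (norm_add_le _ _).trans ?_
  rw [norm_mul, Complex.norm_exp_ofReal_mul_I, one_mul]
  exact add_le_add (norm_le_pi_norm (fun l => Complex.exp (k l * Complex.I) - 1) l)
    ((norm_exp_sub_one_le _).trans (norm_le_pi_norm k' l))

lemma le_lam_add (k k' : Fin d → ℝ) : lam k ≤ lam (k + k') + ‖k'‖ := by
  have := lam_add_le (k + k') (-k')
  rwa [add_neg_cancel_right, norm_neg] at this

lemma norm_zpow_sub_one_le (z : ℂ) (hz : ‖z‖ = 1) (n : ℤ) : ‖z ^ n - 1‖ ≤ |(n : ℝ)| * ‖z - 1‖ := by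
  have hz0 : z ≠ 0 := by
    intro h
    simp [h] at hz
  have hnat : ∀ n : ℕ, ‖z ^ n - 1‖ ≤ n * ‖z - 1‖ := by
    intro n
    induction n with
    | zero => simp
    | succ n ih =>
      have e : z ^ (n + 1) - 1 = z ^ n * (z - 1) + (z ^ n - 1) := by ring
      rw [e]
      refine (norm_add_le _ _).trans ?_
      rw [norm_mul, norm_pow, hz, one_pow, one_mul]
      push_cast
      linarith
  obtain ⟨m, rfl | rfl⟩ := n.eq_nat_or_neg
  · simpa using hnat m
  · have e : z ^ (-(m : ℤ)) - 1 = -(z ^ m)⁻¹ * (z ^ m - 1) := by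
      rw [zpow_neg, zpow_natCast]
      have := pow_ne_zero m hz0
      field_simp
      ring
    rw [e, norm_mul, norm_neg, norm_inv, norm_pow, hz]
    simpa using hnat m

lemma norm_prod_sub_one_le {ι : Type*} (s : Finset ι) (f : ι → ℂ) (hf : ∀ i, ‖f i‖ = 1) :
    ‖∏ i ∈ s, f i - 1‖ ≤ ∑ i ∈ s, ‖f i - 1‖ := by
  classical
  induction s using Finset.induction_on with
  | empty => simp
  | insert a s ha ih =>
    rw [Finset.prod_insert ha, Finset.sum_insert ha]
    have e : f a * ∏ i ∈ s, f i - 1 = (f a - 1) + f a * (∏ i ∈ s, f i - 1) := by ring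
    rw [e]
    refine (norm_add_le _ _).trans ?_
    rw [norm_mul, hf, one_mul]
    linarith

lemma norm_ech_sub_one_le (k : Fin d → ℝ) (x : Fin d → ℤ) :
    ‖ech k x - 1‖ ≤ d * lam k * ‖x‖ := by
  rw [ech_eq_prod]
  refine (norm_prod_sub_one_le _ _ fun l => ?_).trans ?_
  · rw [norm_zpow, Complex.norm_exp_ofReal_mul_I, one_zpow]
  · calc _ ≤ ∑ _l : Fin d, lam k * ‖x‖ := by
          refine Finset.sum_le_sum fun l _ => ?_
          refine (norm_zpow_sub_one_le _ (Complex.norm_exp_ofReal_mul_I _) _).trans ?_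
          rw [mul_comm]
          have h1 : ‖x l‖ ≤ ‖x‖ := norm_le_pi_norm x l
          rw [Int.norm_eq_abs] at h1
          exact mul_le_mul (norm_le_pi_norm (fun l => Complex.exp (k l * Complex.I) - 1) l) h1
            (abs_nonneg _) (lam_nonneg _)
      _ = _ := by simp [mul_assoc]

/-- The phase `exp (i θ x_i)`. -/
noncomputable def phase (i : Fin d) (θ : ℝ) (x : Fin d → ℤ) : ℂ :=
  Complex.exp ((θ * x i : ℝ) * Complex.I)

lemma norm_phase (i : Fin d) (θ : ℝ) (x : Fin d → ℤ) : ‖phase i θ x‖ = 1 :=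
  Complex.norm_exp_ofReal_mul_I _

lemma phase_ne_zero (i : Fin d) (θ : ℝ) (x : Fin d → ℤ) : phase i θ x ≠ 0 := Complex.exp_ne_zero _

lemma phase_neg (i : Fin d) (θ : ℝ) (x : Fin d → ℤ) : phase i θ (-x) = (phase i θ x)⁻¹ := by
  rw [phase, phase, ← Complex.exp_neg]
  simp

lemma phase_pow (i : Fin d) (θ : ℝ) (x : Fin d → ℤ) (m : ℕ) :
    phase i θ x ^ m = ech (Pi.single i (m * θ)) x := by
  rw [phase, ech, ← Complex.exp_nat_mul, ← mul_assoc]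
  congr 2
  rw [Finset.sum_eq_single i]
  · simp [mul_assoc]
  · intro l _ hl
    simp [hl]
  · simp

lemma norm_phase_sub_one_le (i : Fin d) {θ : ℝ} (hθ : 0 ≤ θ) (x : Fin d → ℤ) :
    ‖phase i θ x - 1‖ ≤ θ * ‖x‖ := by
  refine (norm_exp_sub_one_le _).trans ?_
  rw [abs_mul, abs_of_nonneg hθ, ← Int.norm_eq_abs]
  gcongr
  exact norm_le_pi_norm x i

lemma norm_phase_sub_one_le_two (i : Fin d) (θ : ℝ) (x : Fin d → ℤ) :
    ‖phase i θ x - 1‖ ≤ 2 := by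
  refine (norm_sub_le _ _).trans ?_
  rw [norm_phase, norm_one]
  norm_num

lemma norm_phase_sub_one_pow_le (i : Fin d) {θ a : ℝ} (hθ : 0 < θ) (ha : 0 ≤ a) (j : ℕ)
    (x : Fin d → ℤ) :
    ‖phase i θ x - 1‖ ^ j ≤ 2 ^ j * (θ ^ min (j : ℝ) a * (1 + ‖x‖) ^ a) := by
  have hx := norm_nonneg x
  set b := min (j : ℝ) a
  have hb0 : 0 ≤ b := le_min (by positivity) ha
  have h1 : ‖phase i θ x - 1‖ ≤ 2 * min 1 (θ * ‖x‖) := by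
    rw [mul_min_of_nonneg _ _ (by norm_num)]
    refine le_min (by simpa using norm_phase_sub_one_le_two i θ x) ?_
    have := norm_phase_sub_one_le i hθ.le x
    have : 0 ≤ θ * ‖x‖ := by positivity
    linarith
  set m := min 1 (θ * ‖x‖)
  have hm0 : 0 ≤ m := le_min zero_le_one (by positivity)
  have hm1 : m ≤ 1 := min_le_left _ _
  calc ‖phase i θ x - 1‖ ^ j ≤ (2 * m) ^ j := by gcongr
    _ = 2 ^ j * m ^ j := mul_pow _ _ _
    _ ≤ 2 ^ j * m ^ b := by
      gcongr
      rw [← Real.rpow_natCast]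
      rcases hm0.eq_or_lt with h | h
      · rw [← h]
        rcases Nat.eq_zero_or_pos j with hj | hj
        · have hb : b = 0 := by
            apply le_antisymm _ hb0
            calc b ≤ j := min_le_left _ _
              _ = 0 := by simp [hj]
          rw [hb, hj]
          simp
        · rw [Real.zero_rpow (by positivity)]
          positivity
      · exact Real.rpow_le_rpow_of_exponent_ge h hm1 (min_le_left _ _)
    _ ≤ 2 ^ j * (θ * ‖x‖) ^ b := by
      gcongr
      exact min_le_right _ _
    _ ≤ _ := by
      rw [Real.mul_rpow hθ.le hx]
      gcongr
      calc ‖x‖ ^ b ≤ (1 + ‖x‖) ^ b := by gcongr; linarith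
        _ ≤ _ := Real.rpow_le_rpow_of_exponent_le (by linarith) (min_le_right _ _)

end Characters

section Fourier

variable {d : ℕ}

/-- The Fourier transform of a function on the lattice. -/
noncomputable def fhat (f : (Fin d → ℤ) → ℝ) (k : Fin d → ℝ) : ℂ := ∑' x, (f x : ℂ) * ech k x

/-- A wave vector shifted in a coordinate direction. -/
noncomputable def shift (k : Fin d → ℝ) (i : Fin d) (t : ℝ) : Fin d → ℝ := k + Pi.single i t

lemma ech_shift (k : Fin d → ℝ) (i : Fin d) (m : ℕ) (θ : ℝ) (x : Fin d → ℤ) :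
    ech (shift k i (m * θ)) x = ech k x * phase i θ x ^ m := by
  rw [shift, ech_add_left, phase_pow]

/-- A nonnegative function `G` whose Fourier transform is the reciprocal of `1 - fhat J`, with an
infrared bound and a moment bound on `J`. -/
structure GreenPair (M c : ℝ) (G J : (Fin d → ℤ) → ℝ) : Prop where
  nonneg : ∀ x, 0 ≤ G x
  summable : Summable G
  even : ∀ x, J (-x) = J x
  moment_summable : Summable fun x => |J x| * (1 + ‖x‖) ^ ((d : ℝ) - 7 / 4)
  moment_le : ∑' x, |J x| * (1 + ‖x‖) ^ ((d : ℝ) - 7 / 4) ≤ M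
  mul_eq : ∀ k, fhat G k * (1 - fhat J k) = 1
  re_ge : ∀ k, c * lam k ^ 2 ≤ (1 - fhat J k).re

namespace GreenPair

variable {M c : ℝ} {G J : (Fin d → ℤ) → ℝ}

lemma moment_nonneg (h : GreenPair M c G J) : 0 ≤ M :=
  (tsum_nonneg fun x => by positivity).trans h.moment_le

lemma abs_summable (hd : 5 ≤ d) (h : GreenPair M c G J) : Summable fun x => |J x| := by
  refine Summable.of_nonneg_of_le (fun x => abs_nonneg _) (fun x => ?_) h.moment_summable
  have hd' : (5 : ℝ) ≤ d := by exact_mod_cast hd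
  exact le_mul_of_one_le_right (abs_nonneg _)
    (Real.one_le_rpow (by linarith [norm_nonneg x]) (by linarith))

lemma norm_tsum_le (h : GreenPair M c G J) (f : (Fin d → ℤ) → ℂ) (B : ℝ)
    (hf : ∀ x, ‖f x‖ ≤ B * (1 + ‖x‖) ^ ((d : ℝ) - 7 / 4)) (hB : 0 ≤ B) :
    ‖∑' x, (J x : ℂ) * f x‖ ≤ B * M := by
  have hs : Summable fun x => B * (|J x| * (1 + ‖x‖) ^ ((d : ℝ) - 7 / 4)) :=
    h.moment_summable.mul_left B
  have hle : ∀ x, ‖(J x : ℂ) * f x‖ ≤ B * (|J x| * (1 + ‖x‖) ^ ((d : ℝ) - 7 / 4)) := by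
    intro x
    rw [norm_mul, Complex.norm_real, Real.norm_eq_abs, mul_left_comm]
    gcongr
    exact hf x
  calc _ ≤ ∑' x, B * (|J x| * (1 + ‖x‖) ^ ((d : ℝ) - 7 / 4)) :=
        tsum_of_norm_bounded hs.hasSum hle
    _ ≤ _ := by
      rw [tsum_mul_left]
      gcongr
      exact h.moment_le

lemma norm_tsum_phase_le (hd : 5 ≤ d) (h : GreenPair M c G J) (n : ℕ) (i : Fin d) (k : Fin d → ℝ)
    {θ l : ℝ} (hθ : 0 < θ) (hθl : θ ≤ l) (hl : l ≤ 2) (hk : lam k ≤ 2 * l) (j : ℕ) (hj : 1 ≤ j)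
    (hjn : j ≤ n) :
    ‖∑' x, (J x : ℂ) * (ech k x * (phase i θ x - 1) ^ j)‖ ≤
      2 ^ n * 2 ^ ((d : ℝ) - 7 / 4) * ((1 + 4 * d) * M) * l ^ 2 *
        (θ / l) ^ min (j : ℝ) ((d : ℝ) - 7 / 4) := by
  have hd' : (5 : ℝ) ≤ d := by exact_mod_cast hd
  have hM := h.moment_nonneg
  have hl0 : 0 < l := by linarith
  set a : ℝ := (d : ℝ) - 7 / 4 with ha
  have ha2 : 2 ≤ a := by linarith
  have h2a : (1 : ℝ) ≤ 2 ^ a := Real.one_le_rpow (by norm_num) (by linarith)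
  have h2n : (1 : ℝ) ≤ 2 ^ n := one_le_pow₀ (by norm_num)
  rcases Nat.lt_or_ge 1 j with hj2 | hj1
  · have hb : 2 ≤ min (j : ℝ) a := le_min (by exact_mod_cast hj2) ha2
    set b := min (j : ℝ) a
    have hba : b ≤ a := min_le_right _ _
    have h1 : θ ^ b ≤ 2 ^ a * l ^ 2 * (θ / l) ^ b := by
      have e : θ ^ b = l ^ b * (θ / l) ^ b := by
        rw [← Real.mul_rpow hl0.le (by positivity), mul_div_cancel₀ _ hl0.ne']
      rw [e]
      gcongr
      calc l ^ b = l ^ (b - 2) * l ^ 2 := by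
            rw [← Real.rpow_natCast l 2, ← Real.rpow_add hl0]
            norm_num
        _ ≤ 2 ^ (b - 2) * l ^ 2 := by
          gcongr
        _ ≤ _ := by
          have : (2 : ℝ) ^ (b - 2) ≤ 2 ^ a := Real.rpow_le_rpow_of_exponent_le (by norm_num)
            (by linarith)
          gcongr
    refine (h.norm_tsum_le _ (2 ^ j * θ ^ b) (fun x => ?_) (by positivity)).trans ?_
    · rw [norm_mul, norm_ech, one_mul, norm_pow, mul_assoc]
      exact norm_phase_sub_one_pow_le i hθ (by linarith) j x
    · calc 2 ^ j * θ ^ b * M ≤ 2 ^ n * (2 ^ a * l ^ 2 * (θ / l) ^ b) * ((1 + 4 * d) * M) := by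
            gcongr
            · norm_num
            · exact le_mul_of_one_le_left hM (by linarith)
        _ = _ := by ring
  · obtain rfl : j = 1 := by omega
    have e : min ((1 : ℕ) : ℝ) a = 1 := by rw [Nat.cast_one, min_eq_left (by linarith)]
    rw [e, Real.rpow_one]
    simp only [pow_one]
    set F : (Fin d → ℤ) → ℂ := fun x => (J x : ℂ) * (ech k x * (phase i θ x - 1)) with hF
    have hFs : Summable F := by
      refine Summable.of_norm_bounded ((h.abs_summable hd).mul_right 2) fun x => ?_
      rw [hF]
      simp only
      rw [norm_mul, norm_mul, norm_ech, one_mul, Complex.norm_real, Real.norm_eq_abs]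
      gcongr
      exact norm_phase_sub_one_le_two i θ x
    have hFn : ∑' x, F (-x) = ∑' x, F x :=
      (Equiv.neg (Fin d → ℤ)).tsum_eq F
    have hFns : Summable fun x => F (-x) := hFs.comp_injective neg_injective
    have hsum : 2 * ∑' x, F x = ∑' x, (J x : ℂ) * ((phase i θ x - 1) *
        ((ech k x)⁻¹ * (phase i θ x)⁻¹ * (ech k x * ech k x * phase i θ x - 1))) := by
      rw [two_mul]
      nth_rewrite 2 [← hFn]
      rw [← hFs.tsum_add hFns]
      congr 1
      funext x
      have h1 := ech_ne_zero k x
      have h2 := phase_ne_zero i θ x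
      simp only [hF, h.even, ech_neg, phase_neg]
      field_simp
      ring
    have hbd : ‖2 * ∑' x, F x‖ ≤ θ * (θ + 4 * d * l) * M := by
      rw [hsum]
      refine h.norm_tsum_le _ _ (fun x => ?_) (by positivity)
      rw [norm_mul, norm_mul, norm_mul, norm_inv, norm_inv, norm_ech, norm_phase, inv_one,
        one_mul, one_mul]
      have h1 := norm_phase_sub_one_le i hθ.le x
      have h2 : ‖ech k x * ech k x * phase i θ x - 1‖ ≤ (θ + 4 * d * l) * ‖x‖ := by
        have e : ech k x * ech k x * phase i θ x - 1 =
            ech k x * ech k x * (phase i θ x - 1) + (ech k x * (ech k x - 1) + (ech k x - 1)) := by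
          ring
        rw [e]
        refine (norm_add_le _ _).trans ((add_le_add_right (norm_add_le _ _) _).trans ?_)
        rw [norm_mul, norm_mul, norm_mul, norm_ech, one_mul, one_mul, one_mul]
        have h3 := norm_ech_sub_one_le k x
        have h4 : d * lam k * ‖x‖ ≤ d * (2 * l) * ‖x‖ := by gcongr
        linarith
      calc _ ≤ θ * ‖x‖ * ((θ + 4 * d * l) * ‖x‖) := by gcongr
        _ = θ * (θ + 4 * d * l) * ‖x‖ ^ 2 := by ring
        _ ≤ _ := by
          gcongr
          calc ‖x‖ ^ 2 ≤ (1 + ‖x‖) ^ 2 := by gcongr; linarith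
            _ = (1 + ‖x‖) ^ (2 : ℝ) := by norm_cast
            _ ≤ _ := Real.rpow_le_rpow_of_exponent_le (by linarith [norm_nonneg x]) ha2
    rw [norm_mul, Complex.norm_ofNat] at hbd
    calc ‖∑' x, F x‖ ≤ θ * (θ + 4 * d * l) * M := by linarith [norm_nonneg (∑' x, F x)]
      _ ≤ θ * (l + 4 * d * l) * M := by gcongr
      _ = 1 * 1 * ((1 + 4 * d) * M) * l ^ 2 * (θ / l) := by field_simp
      _ ≤ _ := by gcongr

lemma norm_dif_one_sub_fhat_le (hd : 5 ≤ d) (h : GreenPair M c G J) (n : ℕ) (i : Fin d)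
    (k : Fin d → ℝ) {θ l : ℝ} (hθ : 0 < θ) (hθl : θ ≤ l) (hl : l ≤ 2) (m : ℕ)
    (hk : lam (shift k i (m * θ)) ≤ 2 * l) (j : ℕ) (hj : 1 ≤ j) (hjn : j ≤ n) :
    ‖dif^[j] (fun m : ℕ => 1 - fhat J (shift k i (m * θ))) m‖ ≤
      2 ^ n * 2 ^ ((d : ℝ) - 7 / 4) * ((1 + 4 * d) * M) * l ^ 2 *
        (θ / l) ^ min (j : ℝ) ((d : ℝ) - 7 / 4) := by
  have hech : ∀ (m : ℕ) x, ech (shift k i (m * θ)) x = ech k x * phase i θ x ^ m := by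
    intro m x
    exact ech_shift k i m θ x
  obtain ⟨j, rfl⟩ : ∃ l, j = l + 1 := ⟨j - 1, by omega⟩
  have e : dif (fun m : ℕ => 1 - fhat J (shift k i (m * θ))) = fun m =>
      -dif (fun m => ∑' x, ((J x : ℂ) * ech k x) * phase i θ x ^ m) m := by
    funext m
    simp only [dif, fhat, hech, mul_assoc]
    ring
  have h1 := h.norm_tsum_phase_le hd n i (shift k i (m * θ)) hθ hθl hl hk (j + 1) hj hjn
  have h2 : dif^[j + 1] (fun m : ℕ => 1 - fhat J (shift k i (m * θ))) m =
      -∑' x, ((J x : ℂ) * ech k x) * (phase i θ x - 1) ^ (j + 1) * phase i θ x ^ m := by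
    rw [dif_iter_succ, e, dif_iter_neg, ← dif_iter_succ,
      dif_iter_tsum _ _ (by simpa [norm_ech] using h.abs_summable hd) (norm_phase i θ)]
  rw [h2, norm_neg]
  have h3 : ∀ x, (J x : ℂ) * ech k x * (phase i θ x - 1) ^ (j + 1) * phase i θ x ^ m =
      (J x : ℂ) * (ech (shift k i (m * θ)) x * (phase i θ x - 1) ^ (j + 1)) := by
    intro x
    rw [hech]
    ring
  simp only [h3]
  exact h1

lemma min_exponent (hd : 5 ≤ d) {t : ℝ} (ht : 0 < t) (ht1 : t ≤ 1) (i l : ℕ) :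
    t ^ min (i : ℝ) ((d : ℝ) - 7 / 4) * t ^ min (l : ℝ) ((d : ℝ) - 7 / 4) ≤
      t ^ min ((i + l : ℕ) : ℝ) ((d : ℝ) - 7 / 4) := by
  have hd' : (5 : ℝ) ≤ d := by exact_mod_cast hd
  rw [← Real.rpow_add ht]
  apply Real.rpow_le_rpow_of_exponent_ge ht ht1
  have hi : (0 : ℝ) ≤ i := by positivity
  have hl : (0 : ℝ) ≤ l := by positivity
  push_cast
  rcases le_total (i : ℝ) ((d : ℝ) - 7 / 4) with h1 | h1 <;>
  rcases le_total (l : ℝ) ((d : ℝ) - 7 / 4) with h2 | h2 <;>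
  simp only [min_eq_left, min_eq_right, h1, h2]
  · exact min_le_left _ _
  all_goals
    refine (min_le_right _ _).trans ?_
    linarith

lemma exists_norm_dif_fhat_le (hd : 5 ≤ d) {c : ℝ} (hc : 0 < c) (hM : 0 ≤ M) (n : ℕ)
    (hn : (d : ℝ) - 7 / 4 ≤ n) :
    ∃ C : ℝ, 0 ≤ C ∧ ∀ G J : (Fin d → ℤ) → ℝ, GreenPair M c G J → ∀ (i : Fin d) (k : Fin d → ℝ)
      (θ l : ℝ), 0 < θ → θ ≤ l → l ≤ 2 →
      (∀ m ≤ n, l / 2 ≤ lam (shift k i (m * θ)) ∧ lam (shift k i (m * θ)) ≤ 2 * l) →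
      ‖∑' x, (G x : ℂ) * (ech k x * (phase i θ x - 1) ^ n)‖ ≤
        C * (l ^ 2)⁻¹ * (θ / l) ^ ((d : ℝ) - 7 / 4) := by
  set a : ℝ := (d : ℝ) - 7 / 4 with ha
  obtain ⟨A₀, hA₀⟩ : ∃ A : ℝ, A = 2 ^ n * 2 ^ a * ((1 + 4 * d) * M) := ⟨_, rfl⟩
  have hA₀' : 0 ≤ A₀ := by rw [hA₀]; positivity
  obtain ⟨C, hC, H⟩ := exists_norm_dif_iter_inv_le (A₀ * (4 / c)) (by positivity) n
  refine ⟨C * (4 / c), by positivity, fun G J h i k θ l hθ hθl hl hw => ?_⟩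
  have hl0 : 0 < l := by linarith
  have ht : 0 < θ / l := by positivity
  have ht1 : θ / l ≤ 1 := by rw [div_le_one hl0]; exact hθl
  have hd' : (5 : ℝ) ≤ d := by exact_mod_cast hd
  have hech : ∀ (m : ℕ) x, ech (shift k i (m * θ)) x = ech k x * phase i θ x ^ m := by
    intro m x
    exact ech_shift k i m θ x
  have key := H (fun m => 1 - fhat J (shift k i (m * θ)))
    (fun m => fhat G (shift k i (m * θ))) (c * l ^ 2 / 4)
    (fun j => (θ / l) ^ min (j : ℝ) a) (by positivity) (fun j => by positivity)
    (by
      rw [Nat.cast_zero, min_eq_left (by linarith), Real.rpow_zero])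
    (min_exponent hd ht ht1) (fun m _ => by rw [mul_comm]; exact h.mul_eq _)
    (fun m hm => by
      have h1 := h.re_ge (shift k i (m * θ))
      have h2 := (hw m hm).1
      have h3 : c * (l / 2) ^ 2 ≤ c * lam (shift k i (m * θ)) ^ 2 := by gcongr
      calc c * l ^ 2 / 4 = c * (l / 2) ^ 2 := by ring
        _ ≤ _ := h3.trans (h1.trans (Complex.re_le_norm _)))
    (fun j m hjm => by
      have h1 := h.norm_dif_one_sub_fhat_le hd n i k hθ hθl hl m (hw m (by omega)).2 (j + 1)
        (by omega) (by omega)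
      rw [← ha, ← hA₀] at h1
      refine h1.trans (le_of_eq ?_)
      field_simp) n 0 le_rfl
  have e : (fun m : ℕ => fhat G (shift k i (m * θ))) = fun m =>
      ∑' x, ((G x : ℂ) * ech k x) * phase i θ x ^ m := by
    funext m
    simp only [fhat, hech, mul_assoc]
  rw [e, dif_iter_tsum _ _ _ (norm_phase i θ), min_eq_right hn] at key
  · calc _ = ‖∑' x, (G x : ℂ) * ech k x * (phase i θ x - 1) ^ n * phase i θ x ^ 0‖ := by
          simp only [pow_zero, mul_one, mul_assoc]
      _ ≤ _ := key
      _ = _ := by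
        field_simp
  · have := h.summable.abs
    simpa [norm_ech] using this

end GreenPair

end Fourier

section Orthogonality

variable {d L : ℕ}

/-- The representative of smallest absolute value of a point of the torus. -/
def vma (l : Fin d → ZMod L) : Fin d → ℤ := fun i => (l i).valMinAbs

lemma vma_injective : Function.Injective (vma : (Fin d → ZMod L) → Fin d → ℤ) := by
  intro l l' h
  funext i
  exact ZMod.injective_valMinAbs (congrFun h i)

lemma sum_vma_le [NeZero L] (f : (Fin d → ℤ) → ℝ≥0∞) :
    ∑ l : Fin d → ZMod L, f (vma l) ≤ ∑' m, f m := by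
  rw [← tsum_fintype (L := .unconditional _)]
  exact ENNReal.tsum_comp_le_tsum_of_injective vma_injective f

/-- The dual wave vector of a point of the torus. -/
noncomputable def kvec (l : Fin d → ZMod L) : Fin d → ℝ := fun i => 2 * Real.pi * vma l i / L

lemma sum_ech_kvec [NeZero L] (x : Fin d → ℤ) :
    ∑ l : Fin d → ZMod L, ech (kvec l) x =
      if (∀ i, ((x i : ℤ) : ZMod L) = 0) then (L : ℂ) ^ d else 0 := by
  have e : ∀ l : Fin d → ZMod L, ech (kvec l) x =
      ∏ i, ZMod.stdAddChar (l i * ((x i : ℤ) : ZMod L)) := by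
    intro l
    rw [ech_eq_prod]
    refine Finset.prod_congr rfl fun i _ => ?_
    have h1 : l i * ((x i : ℤ) : ZMod L) = ((vma l i * x i : ℤ) : ZMod L) := by
      rw [Int.cast_mul, vma, ZMod.coe_valMinAbs]
    rw [h1, ZMod.stdAddChar_coe, ← Complex.exp_int_mul, kvec]
    congr 1
    push_cast
    ring
  simp only [e]
  rw [← Fintype.prod_sum fun i (a : ZMod L) => ZMod.stdAddChar (a * ((x i : ℤ) : ZMod L))]
  have h2 : ∀ i, ∑ a : ZMod L, ZMod.stdAddChar (a * ((x i : ℤ) : ZMod L)) =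
      if ((x i : ℤ) : ZMod L) = 0 then (L : ℂ) else 0 := by
    intro i
    rw [AddChar.sum_mulShift _ (ZMod.isPrimitive_stdAddChar L), ZMod.card]
    split_ifs <;> simp
  simp only [h2]
  split_ifs with h
  · simp [h]
  · push Not at h
    obtain ⟨i, hi⟩ := h
    exact Finset.prod_eq_zero (Finset.mem_univ i) (if_neg hi)

/-- Poisson summation on the torus, as a bound. -/
lemma tsum_congr_le_sum_fhat [NeZero L] (h : (Fin d → ℤ) → ℝ) (h0 : ∀ y, 0 ≤ h y)
    (hs : Summable h) (x : Fin d → ℤ) :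
    ENNReal.ofReal ((L : ℝ) ^ d) *
        ∑' y : Fin d → ℤ, (if ∀ i, ((y i - x i : ℤ) : ZMod L) = 0 then ENNReal.ofReal (h y) else 0)
      ≤ ∑ l : Fin d → ZMod L, ENNReal.ofReal ‖fhat h (kvec l)‖ := by
  classical
  have hL : (0 : ℝ) < (L : ℝ) ^ d := by
    have : 0 < L := NeZero.pos L
    positivity
  set w : (Fin d → ℤ) → ℝ := fun y => if ∀ i, ((y i - x i : ℤ) : ZMod L) = 0 then h y else 0
  have hw0 : ∀ y, 0 ≤ w y := by
    intro y
    simp only [w]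
    split_ifs
    exacts [h0 y, le_rfl]
  have hws : Summable w := by
    refine Summable.of_nonneg_of_le hw0 (fun y => ?_) hs
    simp only [w]
    split_ifs
    exacts [le_rfl, h0 y]
  have hw : ∑' y : Fin d → ℤ, (if ∀ i, ((y i - x i : ℤ) : ZMod L) = 0 then ENNReal.ofReal (h y)
      else 0) = ENNReal.ofReal (∑' y, w y) := by
    rw [ENNReal.ofReal_tsum_of_nonneg hw0 hws]
    congr 1
    funext y
    simp only [w]
    split_ifs <;> simp
  have hsum : ∀ k : Fin d → ℝ, Summable fun y => (h y : ℂ) * ech k y := by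
    intro k
    refine Summable.of_norm ?_
    simpa [norm_ech] using hs.abs
  have key : ((L : ℂ) ^ d) * ((∑' y, w y : ℝ) : ℂ) =
      ∑ l : Fin d → ZMod L, fhat h (kvec l) * ech (kvec l) (-x) := by
    simp only [fhat, ← tsum_mul_right]
    rw [← Summable.tsum_finsetSum fun l _ => (hsum (kvec l)).mul_right _, Complex.ofReal_tsum,
      ← tsum_mul_left]
    congr 1
    funext y
    simp only [mul_assoc, ← ech_add]
    rw [← Finset.mul_sum, sum_ech_kvec]
    simp only [Pi.add_apply, Pi.neg_apply, ← sub_eq_add_neg, w]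
    split_ifs <;> simp [mul_comm]
  rw [hw, ← ENNReal.ofReal_mul hL.le, ← ENNReal.ofReal_sum_of_nonneg fun l _ => norm_nonneg _]
  apply ENNReal.ofReal_le_ofReal
  have h1 : (L : ℝ) ^ d * ∑' y, w y = ‖((L : ℂ) ^ d) * ((∑' y, w y : ℝ) : ℂ)‖ := by
    rw [norm_mul, norm_pow, Complex.norm_natCast, Complex.norm_real,
      Real.norm_of_nonneg (tsum_nonneg hw0)]
  rw [h1, key]
  refine (norm_sum_le _ _).trans (le_of_eq ?_)
  simp [norm_ech]

lemma le_norm_exp_sub_one (t : ℝ) (ht : |t| ≤ Real.pi) :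
    2 / Real.pi * |t| ≤ ‖Complex.exp (t * Complex.I) - 1‖ := by
  rw [mul_comm (t : ℂ), Complex.norm_exp_I_mul_ofReal_sub_one, norm_mul, Real.norm_ofNat,
    Real.norm_eq_abs, Real.abs_sin_eq_sin_abs_of_abs_le_pi, abs_div, abs_two]
  · have := Real.mul_le_sin (x := |t| / 2) (by positivity) (by linarith)
    calc _ = 2 * (2 / Real.pi * (|t| / 2)) := by ring
      _ ≤ _ := by gcongr
  · rw [abs_div, abs_two]
    linarith [abs_nonneg t]

lemma le_lam_kvec [NeZero L] (l : Fin d → ZMod L) : 4 / L * ‖vma l‖ ≤ lam (kvec l) := by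
  have hL : (0 : ℝ) < L := by exact_mod_cast NeZero.pos L
  rw [mul_comm, ← le_div_iff₀ (by positivity)]
  refine (pi_norm_le_iff_of_nonneg (div_nonneg (lam_nonneg _) (by positivity))).2 fun i => ?_
  rw [le_div_iff₀ (by positivity)]
  refine le_trans ?_ (norm_le_pi_norm (fun i => Complex.exp (kvec l i * Complex.I) - 1) i)
  have hb : |(vma l i : ℝ)| * 2 ≤ L := by
    have h1 := ZMod.valMinAbs_mem_Ioc (l i)
    have h2 : |(l i).valMinAbs| * 2 ≤ L := by
      have := h1.1
      have := h1.2
      rw [← abs_two, ← abs_mul, abs_le]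
      constructor <;> linarith
    rw [← Int.cast_abs]
    exact_mod_cast h2
  have e : |kvec l i| = Real.pi * (|(vma l i : ℝ)| * 2) / L := by
    rw [kvec, abs_div, abs_mul, abs_mul, abs_two, abs_of_pos Real.pi_pos, abs_of_pos hL]
    ring
  refine le_trans (le_of_eq ?_) (le_norm_exp_sub_one _ ?_)
  · have := Real.pi_pos
    rw [e, Int.norm_eq_abs]
    field_simp
    ring
  · rw [e, div_le_iff₀ hL]
    exact mul_le_mul_of_nonneg_left hb Real.pi_pos.le

lemma lam_congr (k k' : Fin d → ℝ) (h : ∀ i, ∃ n : ℤ, k i = k' i + n * (2 * Real.pi)) :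
    lam k = lam k' := by
  rw [lam, lam]
  congr 1
  funext i
  obtain ⟨n, hn⟩ := h i
  rw [hn]
  congr 1
  rw [Complex.exp_eq_exp_iff_exists_int]
  exact ⟨n, by push_cast; ring⟩

lemma exists_le_lam_shift_kvec [NeZero L] (i : Fin d) (t : ℝ) :
    ∃ l₀ : Fin d → ZMod L, ∀ l : Fin d → ZMod L,
      (4 * ‖vma (l + l₀)‖ - Real.pi) / L ≤ lam (shift (kvec l) i t) := by
  have hL : (0 : ℝ) < L := by exact_mod_cast NeZero.pos L
  have hπ := Real.pi_pos
  set n : ℤ := round (t * L / (2 * Real.pi))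
  refine ⟨Pi.single i (n : ZMod L), fun l => ?_⟩
  set s : ℝ := t - 2 * Real.pi * n / L
  have hs : |s| ≤ Real.pi / L := by
    have h1 := abs_sub_round (t * L / (2 * Real.pi))
    have e : s = (2 * Real.pi / L) * (t * L / (2 * Real.pi) - n) := by
      simp only [s]
      field_simp
    rw [e, abs_mul, abs_of_pos (by positivity)]
    calc _ ≤ 2 * Real.pi / L * (1 / 2) := by gcongr
      _ = _ := by ring
  have h2 : lam (shift (kvec l) i t) =
      lam (kvec (l + Pi.single i (n : ZMod L)) + Pi.single i s) := by
    apply lam_congr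
    intro i'
    have h3 : ∃ m : ℤ, vma l i' + (Pi.single i n : Fin d → ℤ) i' =
        vma (l + Pi.single i (n : ZMod L)) i' + L * m := by
      have h4 : ((vma l i' + (Pi.single i n : Fin d → ℤ) i' : ℤ) : ZMod L) =
          ((vma (l + Pi.single i (n : ZMod L)) i' : ℤ) : ZMod L) := by
        rw [Int.cast_add, vma, vma, ZMod.coe_valMinAbs, ZMod.coe_valMinAbs, Pi.add_apply]
        congr 1
        by_cases h : i' = i
        · subst h
          simp
        · simp [h]
      rw [ZMod.intCast_eq_intCast_iff_dvd_sub] at h4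
      obtain ⟨m, hm⟩ := h4
      exact ⟨-m, by linarith⟩
    obtain ⟨m, hm⟩ := h3
    refine ⟨m, ?_⟩
    have hm' : (vma l i' : ℝ) + ((Pi.single i n : Fin d → ℤ) i' : ℤ) =
        vma (l + Pi.single i (n : ZMod L)) i' + L * m := by exact_mod_cast hm
    have e1 : (vma l i' : ℝ) = vma (l + Pi.single i (n : ZMod L)) i' + L * m -
        ((Pi.single i n : Fin d → ℤ) i' : ℤ) := by linarith
    simp only [shift, Pi.add_apply, kvec]
    rw [e1]
    by_cases h : i' = i
    · subst h
      simp only [Pi.single_eq_same, s]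
      field_simp
      ring
    · simp only [Pi.single_eq_of_ne h, Int.cast_zero]
      field_simp
      ring
  rw [h2]
  have h5 := le_lam_add (kvec (l + Pi.single i (n : ZMod L))) (Pi.single i s)
  have h6 := le_lam_kvec (l + Pi.single i (n : ZMod L))
  have h7 : ‖(Pi.single i s : Fin d → ℝ)‖ ≤ Real.pi / L := by
    rw [Pi.norm_single]
    exact hs
  calc _ = 4 / L * ‖vma (l + Pi.single i (n : ZMod L))‖ - Real.pi / L := by ring
    _ ≤ _ := by linarith

end Orthogonality

lemma norm_dif_iter_le_sum (n : ℕ) (f : ℕ → ℂ) (m : ℕ) :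
    ‖dif^[n] f m‖ ≤ 2 ^ n * ∑ s ∈ Finset.range (n + 1), ‖f (m + s)‖ := by
  induction n generalizing f with
  | zero => simp
  | succ n ih =>
    rw [dif_iter_succ]
    refine (ih _).trans ?_
    have h1 : ∑ s ∈ Finset.range (n + 1), ‖dif f (m + s)‖ ≤
        2 * ∑ s ∈ Finset.range (n + 2), ‖f (m + s)‖ := by
      calc _ ≤ ∑ s ∈ Finset.range (n + 1), (‖f (m + (s + 1))‖ + ‖f (m + s)‖) :=
            Finset.sum_le_sum fun s _ => norm_sub_le _ _
        _ = ∑ s ∈ Finset.range (n + 1), ‖f (m + (s + 1))‖ +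
            ∑ s ∈ Finset.range (n + 1), ‖f (m + s)‖ := Finset.sum_add_distrib
        _ ≤ _ := by
          have e1 := Finset.sum_range_succ' (fun s => ‖f (m + s)‖) (n + 1)
          have e2 := Finset.sum_range_succ (fun s => ‖f (m + s)‖) (n + 1)
          have := norm_nonneg (f (m + 0))
          have := norm_nonneg (f (m + (n + 1)))
          rw [show n + 2 = n + 1 + 1 from rfl]
          linarith
    calc _ ≤ 2 ^ n * (2 * ∑ s ∈ Finset.range (n + 2), ‖f (m + s)‖) := by gcongr
      _ = _ := by ring

section Weighted

variable {d : ℕ}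

/-- The weight `(2 - 2 cos (θ x_i))^d`. -/
noncomputable def cosW (i : Fin d) (θ : ℝ) (x : Fin d → ℤ) : ℝ := (2 - 2 * Real.cos (θ * x i)) ^ d

lemma cosW_nonneg (i : Fin d) (θ : ℝ) (x : Fin d → ℤ) : 0 ≤ cosW i θ x := by
  have := Real.cos_le_one (θ * x i)
  exact pow_nonneg (by linarith) _

lemma cosW_le (i : Fin d) (θ : ℝ) (x : Fin d → ℤ) : cosW i θ x ≤ 4 ^ d := by
  have h1 := Real.cos_le_one (θ * x i)
  have h2 := Real.neg_one_le_cos (θ * x i)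
  exact pow_le_pow_left₀ (by linarith) (by linarith) _

lemma phase_sub_one_sq (i : Fin d) (θ : ℝ) (x : Fin d → ℤ) :
    (phase i θ x - 1) ^ 2 = -(2 - 2 * Real.cos (θ * x i) : ℝ) * phase i θ x := by
  have h1 : phase i θ x + (phase i θ x)⁻¹ = 2 * Real.cos (θ * x i) := by
    rw [phase, ← Complex.exp_neg, ← neg_mul, Complex.ofReal_cos, Complex.two_cos]
  have h2 := mul_inv_cancel₀ (phase_ne_zero i θ x)
  push_cast at h1 ⊢
  linear_combination phase i θ x * h1 - h2

lemma shift_shift (k : Fin d → ℝ) (i : Fin d) (s t : ℝ) :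
    shift (shift k i s) i t = shift k i (s + t) := by
  rw [shift, shift, shift, add_assoc, Pi.single_add]

lemma norm_fhat_cosW (G : (Fin d → ℤ) → ℝ) (i : Fin d) (k : Fin d → ℝ) (θ : ℝ) :
    ‖fhat (fun x => G x * cosW i θ x) k‖ = ‖∑' x, (G x : ℂ) *
      (ech (shift k i (-(d * θ))) x * (phase i θ x - 1) ^ (2 * d))‖ := by
  have e : ∀ x, (G x : ℂ) * (ech (shift k i (-(d * θ))) x * (phase i θ x - 1) ^ (2 * d)) =
      (-1) ^ d * (((G x * cosW i θ x : ℝ) : ℂ) * ech k x) := by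
    intro x
    have h1 : ech k x = ech (shift k i (-(d * θ))) x * phase i θ x ^ d := by
      rw [← ech_shift, shift_shift, neg_add_cancel, shift, Pi.single_zero, add_zero]
    rw [h1, pow_mul, phase_sub_one_sq, mul_pow, neg_pow, cosW]
    push_cast
    ring
  simp only [e]
  rw [tsum_mul_left, norm_mul, norm_pow, norm_neg, norm_one, one_pow, one_mul, fhat]

lemma lam_shift_le (k : Fin d → ℝ) (i : Fin d) (t : ℝ) : lam (shift k i t) ≤ lam k + |t| := by
  have := lam_add_le k (Pi.single i t)
  rwa [Pi.norm_single] at this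

lemma le_lam_shift (k : Fin d → ℝ) (i : Fin d) (t : ℝ) : lam k ≤ lam (shift k i t) + |t| := by
  have := le_lam_add k (Pi.single i t)
  rwa [Pi.norm_single] at this

lemma norm_fhat_le {G : (Fin d → ℤ) → ℝ} (h0 : ∀ x, 0 ≤ G x) (hs : Summable G) (k : Fin d → ℝ) :
    ‖fhat G k‖ ≤ ∑' x, G x := by
  refine tsum_of_norm_bounded hs.hasSum fun x => ?_
  rw [norm_mul, norm_ech, mul_one, Complex.norm_real, Real.norm_of_nonneg (h0 x)]

lemma GreenPair.norm_fhat_le_inv {M c : ℝ} {G J : (Fin d → ℤ) → ℝ} (h : GreenPair M c G J)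
    (hc : 0 < c) (k : Fin d → ℝ) {l : ℝ} (hl : 0 < l) (hlk : l ≤ lam k) :
    ‖fhat G k‖ ≤ (c * l ^ 2)⁻¹ := by
  have h1 : ‖fhat G k‖ * ‖1 - fhat J k‖ = 1 := by rw [← norm_mul, h.mul_eq, norm_one]
  have h2 : c * l ^ 2 ≤ ‖1 - fhat J k‖ := by
    refine le_trans ?_ ((h.re_ge k).trans (Complex.re_le_norm _))
    gcongr
  rw [← one_div, le_div_iff₀ (by positivity), ← h1]
  gcongr

lemma norm_fhat_cosW_le_sum (G : (Fin d → ℤ) → ℝ) (hs : Summable fun x => ‖(G x : ℂ)‖) (i : Fin d)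
    (k : Fin d → ℝ) (θ : ℝ) :
    ‖fhat (fun x => G x * cosW i θ x) k‖ ≤
      2 ^ (2 * d) * ∑ s ∈ Finset.range (2 * d + 1), ‖fhat G (shift k i ((s - d) * θ))‖ := by
  have h1 := norm_dif_iter_le_sum (2 * d)
    (fun m => ∑' x, (G x * ech (shift k i (-(d * θ))) x) * phase i θ x ^ m) 0
  rw [dif_iter_tsum _ _ (by simpa [norm_ech] using hs) (norm_phase i θ)] at h1
  rw [norm_fhat_cosW]
  refine le_trans (le_of_eq ?_) (h1.trans (le_of_eq ?_))
  · simp only [pow_zero, mul_one, mul_assoc]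
  · congr 1
    refine Finset.sum_congr rfl fun s _ => ?_
    rw [zero_add, fhat]
    congr 2
    funext x
    rw [mul_assoc, ← ech_shift, shift_shift]
    congr 3
    ring

lemma GreenPair.exists_norm_fhat_cosW_le (hd : 5 ≤ d) {M c : ℝ} (hc : 0 < c) (hM : 0 ≤ M) :
    ∃ C : ℝ, 0 ≤ C ∧ ∀ G J : (Fin d → ℤ) → ℝ, GreenPair M c G J → ∀ (i : Fin d) (k : Fin d → ℝ)
      (θ l : ℝ), 0 < θ → l = lam k → 8 * d * θ ≤ l →
      ‖fhat (fun x => G x * cosW i θ x) k‖ ≤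
        C * θ ^ ((d : ℝ) - 7 / 4) * l ^ (-((d : ℝ) + 1 / 4)) := by
  have hd' : (5 : ℝ) ≤ d := by exact_mod_cast hd
  obtain ⟨C, hC, H⟩ := GreenPair.exists_norm_dif_fhat_le (M := M) hd hc hM (2 * d) (by
    push_cast
    linarith)
  refine ⟨C, hC, fun G J h i k θ l hθ hl hθl => ?_⟩
  have hl0 : 0 < l := lt_of_lt_of_le (by positivity) hθl
  have h1 := H G J h i (shift k i (-(d * θ))) θ l hθ
    (le_trans (le_mul_of_one_le_left hθ.le (by linarith)) hθl) (hl ▸ lam_le_two k) (fun m hm => by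
      have hm' : (m : ℝ) ≤ 2 * d := by exact_mod_cast hm
      have hm0 : (0 : ℝ) ≤ m := by positivity
      rw [shift_shift]
      have hs : |-(d * θ) + m * θ| ≤ d * θ := by
        rw [abs_le]
        constructor
        · nlinarith
        · nlinarith
      have h2 := lam_shift_le k i (-(d * θ) + m * θ)
      have h3 := le_lam_shift k i (-(d * θ) + m * θ)
      rw [← hl] at h2 h3
      constructor <;> linarith)
  rw [norm_fhat_cosW]
  refine h1.trans (le_of_eq ?_)
  have e : l ^ (-((d : ℝ) + 1 / 4)) = (l ^ 2)⁻¹ * (l ^ ((d : ℝ) - 7 / 4))⁻¹ := by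
    rw [← Real.rpow_natCast l 2, ← Real.rpow_neg hl0.le, ← Real.rpow_neg hl0.le,
      ← Real.rpow_add hl0]
    congr 1
    push_cast
    ring
  rw [e, Real.div_rpow hθ.le hl0.le]
  ring

end Weighted

section Weighted

variable {d : ℕ}

/-- The bound on low frequencies: the total mass at the origin and the infrared bound elsewhere. -/
noncomputable def lowBound (S B X : ℝ) (m : Fin d → ℤ) : ℝ≥0∞ :=
  (if m = 0 then ENNReal.ofReal S else 0) +
    ENNReal.ofReal B * (if m ≠ 0 ∧ ‖m‖ ≤ X then ENNReal.ofReal ((‖m‖ ^ 2)⁻¹) else 0)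

lemma one_le_norm_of_ne_zero {m : Fin d → ℤ} (h : m ≠ 0) : 1 ≤ ‖m‖ := by
  by_contra! hm
  refine h (funext fun i => ?_)
  have h1 : ‖m i‖ < 1 := (norm_le_pi_norm m i).trans_lt hm
  rw [Int.norm_eq_abs, ← Int.cast_abs] at h1
  exact Int.abs_lt_one_iff.1 (by exact_mod_cast h1)

lemma tsum_lowBound_le (hd : 3 ≤ d) (S B X : ℝ) (hB : 0 ≤ B) (hX : 0 < X) :
    ∑' m : Fin d → ℤ, lowBound S B X m ≤
      ENNReal.ofReal S + ENNReal.ofReal (B * (8 * 3 ^ d * X ^ (d - 2))) := by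
  simp only [lowBound]
  rw [ENNReal.tsum_add, ENNReal.tsum_mul_left, tsum_ite_eq, ENNReal.ofReal_mul hB]
  gcongr
  exact tsum_inv_sq_le hd X hX

lemma GreenPair.norm_fhat_le_lowBound {M c : ℝ} {G J : (Fin d → ℤ) → ℝ} (h : GreenPair M c G J)
    (hc : 0 < c) {L R : ℝ} (hL : 0 < L) (hR : 2 ≤ R * L) (q : Fin d → ℝ) (m : Fin d → ℤ)
    (hq : (4 * ‖m‖ - Real.pi) / L ≤ lam q) (hqR : lam q ≤ 2 * R) :
    ENNReal.ofReal ‖fhat G q‖ ≤ lowBound (∑' x, G x) (4 * L ^ 2 / c) (R * L) m := by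
  have hπ4 := Real.pi_le_four
  have hπ : Real.pi ≤ 3.5 := by linarith [Real.pi_lt_d2]
  by_cases hm : m = 0
  · rw [lowBound, if_pos hm, if_neg (by simp [hm]), mul_zero, add_zero]
    exact ENNReal.ofReal_le_ofReal (norm_fhat_le h.nonneg h.summable q)
  · have h1 := one_le_norm_of_ne_zero hm
    have h2 : ‖m‖ ≤ R * L := by
      have := hq.trans hqR
      rw [div_le_iff₀ hL] at this
      linarith
    rw [lowBound, if_neg hm, if_pos ⟨hm, h2⟩, zero_add, ← ENNReal.ofReal_mul (by positivity)]
    apply ENNReal.ofReal_le_ofReal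
    have h3 : ‖m‖ / (2 * L) ≤ lam q := by
      refine le_trans ?_ hq
      rw [div_le_div_iff₀ (by positivity) hL]
      nlinarith
    refine (h.norm_fhat_le_inv hc q (by positivity) h3).trans (le_of_eq ?_)
    field_simp
    norm_num

lemma GreenPair.exists_tsum_cosW_le (hd : 5 ≤ d) {M c : ℝ} (hc : 0 < c) (hM : 0 ≤ M) :
    ∃ C : ℝ, 0 ≤ C ∧ ∀ G J : (Fin d → ℤ) → ℝ, GreenPair M c G J → ∀ (i : Fin d) (L : ℕ) (θ : ℝ)
      (x : Fin d → ℤ), 0 < θ → 1 ≤ L → 1 ≤ θ * L →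
      ∑' y : Fin d → ℤ, (if ∀ i, ((y i - x i : ℤ) : ZMod L) = 0 then
        ENNReal.ofReal (G y * cosW i θ y) else 0) ≤
      ENNReal.ofReal (C * (θ ^ (d - 2) + (∑' x, G x) / L ^ d)) := by
  have hd' : (5 : ℝ) ≤ d := by exact_mod_cast hd
  obtain ⟨C, hC, H⟩ := GreenPair.exists_norm_fhat_cosW_le (M := M) hd hc hM
  obtain ⟨C₁, hC₁, H₁⟩ := exists_tsum_max_rpow_le d
  set K : ℝ := 2 ^ (2 * d) * (2 * d + 1)
  set C₂ : ℝ := 4 / c * (8 * 3 ^ d * (8 * d) ^ (d - 2))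
  have hK : 0 ≤ K := by positivity
  have hC₂ : 0 ≤ C₂ := by positivity
  refine ⟨C * C₁ + K * C₂ + K, by positivity, fun G J h i L θ x hθ hL1 hθL => ?_⟩
  have : NeZero L := ⟨by omega⟩
  have hL : (0 : ℝ) < L := by exact_mod_cast hL1
  have hG0 : 0 ≤ ∑' x, G x := tsum_nonneg h.nonneg
  set R : ℝ := 8 * d * θ with hR
  have hR0 : 0 < R := by positivity
  have hRL : 2 ≤ R * L := by
    rw [hR, mul_assoc]
    nlinarith
  set hi : (Fin d → ℤ) → ℝ≥0∞ := fun m => ENNReal.ofReal (C * θ ^ ((d : ℝ) - 7 / 4) *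
    (4 / L) ^ (-((d : ℝ) + 1 / 4))) *
    ENNReal.ofReal (max ‖m‖ (R * L / 4) ^ (-((d : ℝ) + 1 / 4))) with hhi
  set low : (Fin d → ℤ) → ℝ≥0∞ := lowBound (∑' x, G x) (4 * (L : ℝ) ^ 2 / c) (R * L)
  choose l₀ hl₀ using fun s : ℕ => exists_le_lam_shift_kvec (L := L) i ((s - d) * θ)
  have hpt : ∀ l : Fin d → ZMod L, ENNReal.ofReal ‖fhat (fun x => G x * cosW i θ x) (kvec l)‖ ≤
      hi (vma l) + ENNReal.ofReal (2 ^ (2 * d)) *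
        ∑ s ∈ Finset.range (2 * d + 1), low (vma (l + l₀ s)) := by
    intro l
    rcases le_or_gt R (lam (kvec l)) with hlR | hlR
    · refine le_add_right ?_
      rw [hhi]
      simp only
      rw [← ENNReal.ofReal_mul (by positivity)]
      apply ENNReal.ofReal_le_ofReal
      refine (H G J h i (kvec l) θ _ hθ rfl hlR).trans ?_
      rw [mul_assoc _ ((4 / (L : ℝ)) ^ _), ← Real.mul_rpow (by positivity) (by positivity)]
      gcongr ?_ * ?_
      refine Real.rpow_le_rpow_of_nonpos (by positivity) ?_ (by linarith)
      rw [mul_max_of_nonneg _ _ (by positivity)]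
      refine max_le (le_lam_kvec l) (le_trans (le_of_eq ?_) hlR)
      field_simp
    · refine le_add_left ?_
      have h1 := norm_fhat_cosW_le_sum G (by simpa using h.summable.abs) i (kvec l) θ
      refine (ENNReal.ofReal_le_ofReal h1).trans ?_
      rw [ENNReal.ofReal_mul (by positivity),
        ENNReal.ofReal_sum_of_nonneg fun s _ => norm_nonneg _]
      gcongr with s hs
      refine h.norm_fhat_le_lowBound hc hL hRL _ _ (hl₀ s l) ?_
      refine (lam_shift_le _ _ _).trans ?_
      have h2 : |((s : ℝ) - d) * θ| ≤ R := by
        have hs' : (s : ℝ) ≤ 2 * d := by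
          rw [Finset.mem_range] at hs
          exact_mod_cast (by omega : s ≤ 2 * d)
        have hs0 : (0 : ℝ) ≤ s := by positivity
        rw [abs_le, hR]
        constructor <;> nlinarith
      linarith
  have hhisum : ∑' m, hi m ≤ ENNReal.ofReal (C * C₁ * (θ ^ (d - 2) * L ^ d)) := by
    rw [hhi, ENNReal.tsum_mul_left]
    have hX : 1 ≤ R * L / 4 := by
      rw [hR]
      nlinarith
    refine (mul_le_mul_right (H₁ _ hX) _).trans ?_
    rw [← ENNReal.ofReal_mul (by positivity)]
    apply ENNReal.ofReal_le_ofReal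
    have h1 : (R * L / 4) ^ (-(1 / 4 : ℝ)) ≤ (θ * L) ^ (-(1 / 4 : ℝ)) := by
      refine Real.rpow_le_rpow_of_nonpos (by positivity) ?_ (by norm_num)
      rw [hR]
      nlinarith
    have h2 : (4 / (L : ℝ)) ^ (-((d : ℝ) + 1 / 4)) ≤ L ^ ((d : ℝ) + 1 / 4) := by
      rw [Real.rpow_neg (by positivity), ← Real.inv_rpow (by positivity), inv_div]
      gcongr
      linarith
    have h3 : θ ^ ((d : ℝ) - 7 / 4) * (θ ^ (-(1 / 4 : ℝ))) = θ ^ (d - 2) := by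
      rw [← Real.rpow_add hθ, ← Real.rpow_natCast θ (d - 2), Nat.cast_sub (by omega)]
      congr 1
      push_cast
      ring
    have h4 : (L : ℝ) ^ ((d : ℝ) + 1 / 4) * (L ^ (-(1 / 4 : ℝ))) = L ^ d := by
      rw [← Real.rpow_add hL, ← Real.rpow_natCast]
      congr 1
      ring
    calc C * θ ^ ((d : ℝ) - 7 / 4) * (4 / L) ^ (-((d : ℝ) + 1 / 4)) *
          (C₁ * (R * L / 4) ^ (-(1 / 4 : ℝ)))
        ≤ C * θ ^ ((d : ℝ) - 7 / 4) * L ^ ((d : ℝ) + 1 / 4) *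
          (C₁ * (θ * L) ^ (-(1 / 4 : ℝ))) := by gcongr
      _ = C * C₁ * ((θ ^ ((d : ℝ) - 7 / 4) * (θ ^ (-(1 / 4 : ℝ)))) *
          ((L : ℝ) ^ ((d : ℝ) + 1 / 4) * (L ^ (-(1 / 4 : ℝ))))) := by
        rw [Real.mul_rpow hθ.le hL.le]
        ring
      _ = _ := by rw [h3, h4]
  have hlowsum : ∑' m, low m ≤ ENNReal.ofReal (∑' x, G x + C₂ * (θ ^ (d - 2) * L ^ d)) := by
    refine (tsum_lowBound_le (by omega) _ _ _ (by positivity) (by positivity)).trans ?_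
    rw [← ENNReal.ofReal_add hG0 (by positivity)]
    apply ENNReal.ofReal_le_ofReal
    apply le_of_eq
    congr 1
    obtain ⟨e, rfl⟩ : ∃ e, d = e + 2 := ⟨d - 2, by omega⟩
    simp only [C₂, hR, Nat.add_sub_cancel]
    ring
  have hlows : ∀ s, ∑ l : Fin d → ZMod L, low (vma (l + l₀ s)) ≤ ∑' m, low m := by
    intro s
    rw [Fintype.sum_equiv (Equiv.addRight (l₀ s)) (fun l => low (vma (l + l₀ s)))
      (fun l => low (vma l)) fun l => rfl]
    exact sum_vma_le low
  have hsum : ∑ l : Fin d → ZMod L, ENNReal.ofReal ‖fhat (fun x => G x * cosW i θ x) (kvec l)‖ ≤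
      ENNReal.ofReal ((C * C₁ + K * C₂ + K) * (θ ^ (d - 2) * L ^ d + ∑' x, G x)) := by
    refine (Finset.sum_le_sum fun l _ => hpt l).trans ?_
    have e1 : ∑ l : Fin d → ZMod L, ENNReal.ofReal (2 ^ (2 * d)) *
        ∑ s ∈ Finset.range (2 * d + 1), low (vma (l + l₀ s)) = ENNReal.ofReal (2 ^ (2 * d)) *
        ∑ s ∈ Finset.range (2 * d + 1), ∑ l : Fin d → ZMod L, low (vma (l + l₀ s)) := by
      rw [← Finset.mul_sum, Finset.sum_comm]
    rw [Finset.sum_add_distrib, e1]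
    refine (add_le_add ((sum_vma_le hi).trans hhisum) (mul_le_mul_right
      (Finset.sum_le_sum fun s _ => (hlows s).trans hlowsum) _)).trans ?_
    rw [Finset.sum_const, Finset.card_range, nsmul_eq_mul, ← mul_assoc,
      ← ENNReal.ofReal_natCast, ← ENNReal.ofReal_mul (by positivity),
      ← ENNReal.ofReal_mul (by positivity), ← ENNReal.ofReal_add (by positivity) (by positivity)]
    apply ENNReal.ofReal_le_ofReal
    have h1 : 0 ≤ θ ^ (d - 2) * (L : ℝ) ^ d := by positivity
    have e : (2 : ℝ) ^ (2 * d) * ((2 * d + 1 : ℕ) : ℝ) = K := by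
      simp only [K]
      push_cast
      ring
    rw [← mul_assoc ((2 : ℝ) ^ (2 * d)), e, mul_assoc (C * C₁)]
    have h2 : 0 ≤ C * C₁ * ∑' x, G x := by positivity
    have h3 : 0 ≤ K * C₂ * ∑' x, G x := by positivity
    have h4 : 0 ≤ K * (θ ^ (d - 2) * (L : ℝ) ^ d) := by positivity
    nlinarith
  have hs : Summable fun x => G x * cosW i θ x := by
    refine Summable.of_nonneg_of_le (fun x => mul_nonneg (h.nonneg x) (cosW_nonneg i θ x))
      (fun x => ?_) (h.summable.mul_right (4 ^ d))
    exact mul_le_mul_of_nonneg_left (cosW_le i θ x) (h.nonneg x)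
  have hfin := (tsum_congr_le_sum_fhat (L := L) _
    (fun y => mul_nonneg (h.nonneg y) (cosW_nonneg i θ y)) hs x).trans hsum
  have hLd : (0 : ℝ) < (L : ℝ) ^ d := by positivity
  have h5 : ENNReal.ofReal ((C * C₁ + K * C₂ + K) * (θ ^ (d - 2) * L ^ d + ∑' x, G x)) =
      ENNReal.ofReal ((L : ℝ) ^ d) *
        ENNReal.ofReal ((C * C₁ + K * C₂ + K) * (θ ^ (d - 2) + (∑' x, G x) / L ^ d)) := by
    rw [← ENNReal.ofReal_mul hLd.le]
    congr 1
    field_simp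
  rw [h5] at hfin
  rwa [ENNReal.mul_le_mul_iff_right (ENNReal.ofReal_pos.2 hLd).ne' ENNReal.ofReal_ne_top] at hfin

end Weighted

section Far

variable {d : ℕ}

lemma le_integral_cosW (i : Fin d) {T : ℝ} (hT : 0 < T) {x : Fin d → ℤ} (hx : T ≤ |(x i : ℝ)|) :
    4 / T ≤ ∫ θ in (4 / T)..(8 / T), cosW i θ x := by
  have hab : 4 / T ≤ 8 / T := by gcongr; norm_num
  have hx0 : (x i : ℝ) ≠ 0 := abs_pos.1 (hT.trans_le hx)
  have hcont : Continuous fun θ : ℝ => cosW i θ x := by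
    unfold cosW
    fun_prop
  have h1 : ∫ θ in (4 / T)..(8 / T), (1 + d * (1 - 2 * Real.cos (θ * x i))) ≤
      ∫ θ in (4 / T)..(8 / T), cosW i θ x := by
    refine intervalIntegral.integral_mono_on hab ?_ (hcont.intervalIntegrable _ _)
      fun θ _ => ?_
    · exact Continuous.intervalIntegrable (by fun_prop) _ _
    · have := one_add_mul_le_pow (a := 1 - 2 * Real.cos (θ * x i))
        (by linarith [Real.cos_le_one (θ * x i)]) d
      refine this.trans (le_of_eq ?_)
      unfold cosW
      congr 1
      ring
  refine le_trans ?_ h1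
  have h2 : ∫ θ in (4 / T)..(8 / T), (1 + (d : ℝ) * (1 - 2 * Real.cos (θ * x i))) =
      4 / T + d * (4 / T - 2 * ((x i : ℝ)⁻¹ *
        (Real.sin (8 / T * x i) - Real.sin (4 / T * x i)))) := by
    rw [intervalIntegral.integral_add (by simp) (Continuous.intervalIntegrable (by fun_prop) _ _),
      intervalIntegral.integral_const_mul, intervalIntegral.integral_sub (by simp)
      (Continuous.intervalIntegrable (by fun_prop) _ _), intervalIntegral.integral_const_mul,
      intervalIntegral.integral_comp_mul_right (fun t => Real.cos t) hx0, integral_cos]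
    simp only [intervalIntegral.integral_const, smul_eq_mul, mul_one]
    ring
  rw [h2]
  have h3 : |(x i : ℝ)⁻¹ * (Real.sin (8 / T * x i) - Real.sin (4 / T * x i))| ≤ T⁻¹ * 2 := by
    rw [abs_mul, abs_inv]
    gcongr
    have := abs_le.1 (Real.abs_sin_le_one (8 / T * x i))
    have := abs_le.1 (Real.abs_sin_le_one (4 / T * x i))
    rw [abs_le]
    constructor <;> linarith
  have h4 := (abs_le.1 h3).2
  have h5 : 0 ≤ 4 / T - 2 * ((x i : ℝ)⁻¹ * (Real.sin (8 / T * x i) - Real.sin (4 / T * x i))) := by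
    have h6 : 4 / T = T⁻¹ * 4 := by rw [div_eq_mul_inv, mul_comm]
    linarith
  have := mul_nonneg (Nat.cast_nonneg (α := ℝ) d) h5
  linarith

lemma ofReal_le_lintegral_cosW (i : Fin d) {T : ℝ} (hT : 0 < T) {x : Fin d → ℤ}
    (hx : T ≤ |(x i : ℝ)|) :
    ENNReal.ofReal (4 / T) ≤ ∫⁻ θ in Set.Ioc (4 / T) (8 / T), ENNReal.ofReal (cosW i θ x) := by
  have hab : 4 / T ≤ 8 / T := by gcongr; norm_num
  have hcont : Continuous fun θ : ℝ => cosW i θ x := by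
    unfold cosW
    fun_prop
  rw [← MeasureTheory.ofReal_integral_eq_lintegral_ofReal
    ((hcont.intervalIntegrable (4 / T) (8 / T)).1) (Filter.Eventually.of_forall fun θ =>
      cosW_nonneg i θ x), ← intervalIntegral.integral_of_le hab]
  exact ENNReal.ofReal_le_ofReal (le_integral_cosW i hT hx)

/-- The far part of a Green function summed over a residue class. -/
lemma GreenPair.exists_tsum_far_le (hd : 5 ≤ d) {M c : ℝ} (hc : 0 < c) (hM : 0 ≤ M) :
    ∃ C : ℝ, 0 ≤ C ∧ ∀ G J : (Fin d → ℤ) → ℝ, GreenPair M c G J → ∀ (L : ℕ) (T : ℝ)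
      (x : Fin d → ℤ), 0 < T → 1 ≤ L → T ≤ 4 * L →
      ∑' y : Fin d → ℤ, (if (∀ i, ((y i - x i : ℤ) : ZMod L) = 0) ∧ T ≤ ‖y‖ then
        ENNReal.ofReal (G y) else 0) ≤
      ENNReal.ofReal (C * ((T ^ (d - 2))⁻¹ + (∑' x, G x) / L ^ d)) := by
  obtain ⟨C, hC, H⟩ := GreenPair.exists_tsum_cosW_le (M := M) hd hc hM
  refine ⟨d * (C * 8 ^ (d - 2)), by positivity, fun G J h L T x hT hL hTL => ?_⟩
  have hLr : (1 : ℝ) ≤ L := by exact_mod_cast hL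
  have hG0 : 0 ≤ ∑' x, G x := tsum_nonneg h.nonneg
  set B : ℝ := C * 8 ^ (d - 2) * ((T ^ (d - 2))⁻¹ + (∑' x, G x) / L ^ d)
  have hB : 0 ≤ B := by positivity
  have hcoord : ∀ i : Fin d, ∑' y : Fin d → ℤ,
      (if (∀ i, ((y i - x i : ℤ) : ZMod L) = 0) ∧ T ≤ |(y i : ℝ)| then
        ENNReal.ofReal (G y) else 0) ≤ ENNReal.ofReal B := by
    intro i
    have hpos : ENNReal.ofReal (4 / T) ≠ 0 := (ENNReal.ofReal_pos.2 (by positivity)).ne'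
    rw [← ENNReal.mul_le_mul_iff_right hpos ENNReal.ofReal_ne_top, ← ENNReal.tsum_mul_left]
    calc ∑' y : Fin d → ℤ, ENNReal.ofReal (4 / T) *
          (if (∀ i, ((y i - x i : ℤ) : ZMod L) = 0) ∧ T ≤ |(y i : ℝ)| then
            ENNReal.ofReal (G y) else 0)
        ≤ ∑' y : Fin d → ℤ, ∫⁻ θ in Set.Ioc (4 / T) (8 / T),
          (if ∀ i, ((y i - x i : ℤ) : ZMod L) = 0 then
            ENNReal.ofReal (G y * cosW i θ y) else 0) := by
          refine ENNReal.tsum_le_tsum fun y => ?_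
          by_cases h1 : ∀ i, ((y i - x i : ℤ) : ZMod L) = 0
          · by_cases h2 : T ≤ |(y i : ℝ)|
            · simp only [if_pos h1, if_pos (And.intro h1 h2)]
              simp_rw [ENNReal.ofReal_mul (h.nonneg y)]
              rw [MeasureTheory.lintegral_const_mul' _ _ ENNReal.ofReal_ne_top, mul_comm]
              gcongr
              exact ofReal_le_lintegral_cosW i hT h2
            · rw [if_neg (by tauto), mul_zero]
              exact zero_le
          · rw [if_neg (by tauto), mul_zero]
            exact zero_le
      _ = ∫⁻ θ in Set.Ioc (4 / T) (8 / T), ∑' y : Fin d → ℤ,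
          (if ∀ i, ((y i - x i : ℤ) : ZMod L) = 0 then
            ENNReal.ofReal (G y * cosW i θ y) else 0) := by
          rw [MeasureTheory.lintegral_tsum fun y => ?_]
          refine Measurable.aemeasurable ?_
          split_ifs
          · refine (Continuous.measurable ?_).ennreal_ofReal
            unfold cosW
            fun_prop
          · exact measurable_const
      _ ≤ ∫⁻ _ in Set.Ioc (4 / T) (8 / T), ENNReal.ofReal B := by
          refine MeasureTheory.setLIntegral_mono measurable_const fun θ hθ => ?_
          have hθ0 : 0 < θ := lt_trans (by positivity) hθ.1
          have hθL : 1 ≤ θ * L := by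
            have h1 : 4 / T * L ≤ θ * L := by gcongr; exact hθ.1.le
            refine le_trans ?_ h1
            rw [div_mul_eq_mul_div, le_div_iff₀ hT]
            linarith
          refine (H G J h i L θ x hθ0 hL hθL).trans (ENNReal.ofReal_le_ofReal ?_)
          have h2 : θ ^ (d - 2) ≤ 8 ^ (d - 2) * (T ^ (d - 2))⁻¹ := by
            rw [← div_eq_mul_inv, ← div_pow]
            gcongr
            exact hθ.2
          have h3 : (∑' x, G x) / L ^ d ≤ 8 ^ (d - 2) * ((∑' x, G x) / L ^ d) :=
            le_mul_of_one_le_left (by positivity) (one_le_pow₀ (by norm_num))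
          calc C * (θ ^ (d - 2) + (∑' x, G x) / L ^ d)
              ≤ C * (8 ^ (d - 2) * (T ^ (d - 2))⁻¹ + 8 ^ (d - 2) * ((∑' x, G x) / L ^ d)) := by
                gcongr
            _ = B := by
                simp only [B]
                ring
      _ = ENNReal.ofReal (4 / T) * ENNReal.ofReal B := by
          rw [MeasureTheory.setLIntegral_const, Real.volume_Ioc, mul_comm]
          congr 2
          ring
  calc _ ≤ ∑' y : Fin d → ℤ, ∑ i : Fin d,
          (if (∀ i, ((y i - x i : ℤ) : ZMod L) = 0) ∧ T ≤ |(y i : ℝ)| then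
            ENNReal.ofReal (G y) else 0) := by
        refine ENNReal.tsum_le_tsum fun y => ?_
        split_ifs with hy
        · obtain ⟨i, hi⟩ : ∃ i, T ≤ |(y i : ℝ)| := by
            by_contra! hne
            refine absurd hy.2 (not_le.2 ((pi_norm_lt_iff hT).2 fun i => ?_))
            rw [Int.norm_eq_abs]
            exact hne i
          refine le_trans ?_ (Finset.single_le_sum (f := fun i : Fin d =>
            if (∀ i, ((y i - x i : ℤ) : ZMod L) = 0) ∧ T ≤ |(y i : ℝ)| then
            ENNReal.ofReal (G y) else 0) (fun _ _ => zero_le) (Finset.mem_univ i))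
          rw [if_pos ⟨hy.1, hi⟩]
        · exact zero_le
    _ = ∑ i : Fin d, ∑' y : Fin d → ℤ,
          (if (∀ i, ((y i - x i : ℤ) : ZMod L) = 0) ∧ T ≤ |(y i : ℝ)| then
            ENNReal.ofReal (G y) else 0) := Summable.tsum_finsetSum fun _ _ => ENNReal.summable
    _ ≤ ∑ _i : Fin d, ENNReal.ofReal B := Finset.sum_le_sum fun i _ => hcoord i
    _ = _ := by
        rw [Finset.sum_const, Finset.card_univ, Fintype.card_fin, nsmul_eq_mul,
          ← ENNReal.ofReal_natCast, ← ENNReal.ofReal_mul (by positivity)]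
        simp only [B]
        congr 1
        ring

end Far

section Lists

lemma tsum_list {σ : Type*} [Fintype σ] (F : List σ → ℝ≥0∞) :
    ∑' ω, F ω = ∑' n : ℕ, ∑ s : Fin n → σ, F (List.ofFn s) := by
  rw [← (List.equivSigmaTuple (α := σ)).symm.tsum_eq F, ENNReal.tsum_sigma']
  refine tsum_congr fun n => ?_
  rw [tsum_fintype]
  rfl

lemma tsum_list_length {σ : Type*} [Fintype σ] (g : ℕ → ℝ≥0∞) :
    ∑' ω : List σ, g ω.length = ∑' n : ℕ, (Fintype.card σ : ℝ≥0∞) ^ n * g n := by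
  rw [tsum_list]
  refine tsum_congr fun n => ?_
  simp

lemma tsum_list_cons {σ : Type*} [Fintype σ] (F : List σ → ℝ≥0∞) :
    ∑' ω, F ω = F [] + ∑ e : σ, ∑' ω, F (e :: ω) := by
  let E : Unit ⊕ (σ × List σ) ≃ List σ :=
    { toFun := Sum.elim (fun _ => []) fun p => p.1 :: p.2
      invFun := fun l => match l with
        | [] => Sum.inl ()
        | e :: ω => Sum.inr (e, ω)
      left_inv := fun o => by cases o <;> rfl
      right_inv := fun l => by cases l <;> rfl }
  rw [← E.tsum_eq F, ENNReal.summable.tsum_sum ENNReal.summable, tsum_fintype,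
    ENNReal.tsum_prod', tsum_fintype]
  simp [E]

lemma pushF_mul {α ι : Type*} (π : α → ι) (f : α → ℝ≥0∞) (g : ι → ℝ≥0∞) (x : ι) :
    pushF π (fun a => f a * g (π a)) x = pushF π f x * g x := by
  classical
  simp only [pushF, ← ENNReal.tsum_mul_right]
  refine tsum_congr fun a => ?_
  split_ifs with h <;> simp [h]

lemma pushF_le_tsum {α ι : Type*} (π : α → ι) (f : α → ℝ≥0∞) (x : ι) :
    pushF π f x ≤ ∑' a, f a := by
  classical
  unfold pushF
  gcongr with a
  split_ifs
  exacts [le_rfl, zero_le]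

lemma exists_ofReal_mul_le {X ε : ℝ≥0∞} (hX : X ≠ ⊤) (hε : ε ≠ 0) :
    ∃ β₀ : ℝ, 0 < β₀ ∧ ∀ β ≤ β₀, ENNReal.ofReal β * X ≤ ε := by
  have h1 : Filter.Tendsto (fun β : ℝ => ENNReal.ofReal β * X) (nhds 0) (nhds 0) := by
    have := ENNReal.Tendsto.mul_const (b := X) (ENNReal.continuous_ofReal.tendsto 0) (Or.inr hX)
    simpa using this
  have h2 := h1.eventually (Iio_mem_nhds (pos_iff_ne_zero.2 hε))
  obtain ⟨δ, hδ, H⟩ := Metric.eventually_nhds_iff.1 h2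
  refine ⟨δ / 2, by positivity, fun β hβ => ?_⟩
  have h3 : ENNReal.ofReal (δ / 2) * X < ε :=
    H (by rw [Real.dist_eq, sub_zero, abs_of_pos (by positivity)]; linarith)
  refine le_trans ?_ h3.le
  gcongr

end Lists

section Walks

variable {d : ℕ}

lemma norm_wsawStep_le (e : Fin d × Bool) : ‖wsawStep d e‖ ≤ 1 := by
  refine (pi_norm_le_iff_of_nonneg zero_le_one).2 fun i => ?_
  unfold wsawStep
  split_ifs <;> simp

lemma wsawStep_ne_zero (e : Fin d × Bool) : wsawStep d e ≠ 0 := by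
  intro h
  have := congrFun h e.1
  unfold wsawStep at this
  split_ifs at this <;> simp_all

lemma norm_wsawStep (e : Fin d × Bool) : ‖wsawStep d e‖ = 1 :=
  le_antisymm (norm_wsawStep_le e) (one_le_norm_of_ne_zero (wsawStep_ne_zero e))

lemma norm_disp_le (ω : List (Fin d × Bool)) : ‖disp (wsawStep d) ω‖ ≤ ω.length := by
  induction ω with
  | nil => simp
  | cons e ω ih =>
    rw [disp_cons, List.length_cons, Nat.cast_succ, add_comm]
    exact (norm_add_le _ _).trans (add_le_add ih (norm_wsawStep_le e))

lemma jb_eq_ofReal {A : Type*} [NormedAddCommGroup A] (x : A) :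
    jb x = ENNReal.ofReal (1 + ‖x‖) := by
  rw [ENNReal.ofReal_add zero_le_one (norm_nonneg x), ENNReal.ofReal_one, jb,
    ofReal_norm]

lemma jb_disp_le (ω : List (Fin d × Bool)) :
    jb (disp (wsawStep d) ω) ≤ (ω.length + 1 : ℕ) := by
  rw [jb_eq_ofReal, ← ENNReal.ofReal_natCast]
  apply ENNReal.ofReal_le_ofReal
  push_cast
  linarith [norm_disp_le ω]

lemma enorm_le_enorm_add_self (y : Fin d → ℤ) : ‖y‖ₑ ≤ ‖y + y‖ₑ := by
  rw [← ofReal_norm, ← ofReal_norm]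
  apply ENNReal.ofReal_le_ofReal
  refine (pi_norm_le_iff_of_nonneg (norm_nonneg _)).2 fun i => ?_
  refine le_trans ?_ (norm_le_pi_norm (y + y) i)
  rw [Pi.add_apply, Int.norm_eq_abs, Int.norm_eq_abs, ← Int.cast_abs, ← Int.cast_abs]
  exact_mod_cast (by rw [← two_mul, abs_mul]; norm_num; linarith [abs_nonneg (y i)])

/-- The opposite step. -/
def flipStep (e : Fin d × Bool) : Fin d × Bool := (e.1, !e.2)

lemma flipStep_flipStep (e : Fin d × Bool) : flipStep (flipStep e) = e := by
  simp [flipStep]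

lemma wsawStep_flipStep (e : Fin d × Bool) : wsawStep d (flipStep e) = - wsawStep d e := by
  funext i
  obtain ⟨j, b⟩ := e
  by_cases h : i = j <;> cases b <;> simp [wsawStep, flipStep, h]

/-- Reversal of all steps of a walk. -/
def flipEquiv (d : ℕ) : List (Fin d × Bool) ≃ List (Fin d × Bool) where
  toFun := List.map flipStep
  invFun := List.map flipStep
  left_inv ω := by
    rw [List.map_map, show flipStep ∘ flipStep = id from funext flipStep_flipStep, List.map_id]
  right_inv ω := by
    rw [List.map_map, show flipStep ∘ flipStep = id from funext flipStep_flipStep, List.map_id]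

lemma contactW_id_neg {M : Type*} [AddCommGroup M] (β : ℝ) (x : M) :
    contactW (AddMonoidHom.id M) β (-x) = contactW (AddMonoidHom.id M) β x := by
  unfold contactW
  congr 1
  simp

/-- The weight of a walk on the lattice. -/
noncomputable def latW (d : ℕ) (β : ℝ) (ω : List (Fin d × Bool)) : ℝ :=
  walkInt (wsawStep d) (contactW (AddMonoidHom.id (Fin d → ℤ)) β) ω

/-- The irreducible weight of a walk on the lattice. -/
noncomputable def latJ (d : ℕ) (β : ℝ) (ω : List (Fin d × Bool)) : ℝ :=
  irrInt (wsawStep d) (contactW (AddMonoidHom.id (Fin d → ℤ)) β) ω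

/-- The two-point function. -/
noncomputable def green (d : ℕ) (β p : ℝ) : (Fin d → ℤ) → ℝ≥0∞ :=
  pushF (disp (wsawStep d)) (wt (wsawStep d) β (ENNReal.ofReal p))

/-- The susceptibility. -/
noncomputable def suscept (d : ℕ) (β p : ℝ) : ℝ≥0∞ :=
  ∑' ω, wt (wsawStep d) β (ENNReal.ofReal p) ω

variable {β : ℝ}

lemma latW_mem (h0 : 0 ≤ β) (h1 : β ≤ 1) (ω : List (Fin d × Bool)) :
    0 ≤ latW d β ω ∧ latW d β ω ≤ 1 :=
  walkInt_mem _ (contactW_mem _ h0 h1) ω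

lemma wt_le_pow (h0 : 0 ≤ β) (h1 : β ≤ 1) (q : ℝ≥0∞) (ω : List (Fin d × Bool)) :
    wt (wsawStep d) β q ω ≤ q ^ ω.length := by
  unfold wt
  refine mul_le_of_le_one_left zero_le ?_
  exact ENNReal.ofReal_le_one.2 (latW_mem h0 h1 ω).2

lemma green_zero_le (h0 : 0 ≤ β) (h1 : β ≤ 1) (p : ℝ) :
    green d β p 0 ≤ 1 + ∑ e : Fin d × Bool, ENNReal.ofReal p * green d β p (- wsawStep d e) := by
  classical
  unfold green pushF
  rw [tsum_list_cons]
  gcongr with e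
  · rw [disp_nil, if_pos rfl]
    simp [wt, walkInt]
  · rw [← ENNReal.tsum_mul_left]
    gcongr with ω
    rw [disp_cons, add_comm, add_eq_zero_iff_eq_neg]
    split_ifs with h
    · refine (wt_append_le (st := wsawStep d) h0 h1 [e] ω).trans ?_
      gcongr
      simpa using wt_le_pow h0 h1 (ENNReal.ofReal p) [e]
    · simp

end Walks

section Fibres

variable {α ι : Type*} (π : α → ι)

/-- Sum of a real function over the fibres of a map. -/
noncomputable def fib (u : α → ℝ) (x : ι) : ℝ := ∑' a : π ⁻¹' {x}, u a

lemma pushF_eq_tsum_fiber (f : α → ℝ≥0∞) (x : ι) : pushF π f x = ∑' a : π ⁻¹' {x}, f a := by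
  classical
  rw [tsum_subtype]
  refine tsum_congr fun a => ?_
  by_cases h : π a = x <;> simp [h]

lemma ofReal_fib {u : α → ℝ} (h0 : ∀ a, 0 ≤ u a) (hs : Summable u) (x : ι) :
    ENNReal.ofReal (fib π u x) = pushF π (fun a => ENNReal.ofReal (u a)) x := by
  rw [pushF_eq_tsum_fiber, fib,
    ENNReal.ofReal_tsum_of_nonneg (fun a : π ⁻¹' {x} => h0 a) (hs.subtype _)]

lemma fib_nonneg {u : α → ℝ} (h0 : ∀ a, 0 ≤ u a) (x : ι) : 0 ≤ fib π u x :=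
  tsum_nonneg fun a => h0 a

lemma hasSum_fib {u : α → ℝ} (hs : Summable u) : HasSum (fib π u) (∑' a, u a) :=
  hs.hasSum.tsum_fiberwise π

lemma tsum_fib_mul {u : α → ℝ} (hs : Summable u) (h : ι → ℂ) (hh : ∀ x, ‖h x‖ ≤ 1) :
    ∑' x, (fib π u x : ℂ) * h x = ∑' a, (u a : ℂ) * h (π a) := by
  have hs' : Summable fun a => (u a : ℂ) * h (π a) := by
    refine Summable.of_norm_bounded hs.abs fun a => ?_
    rw [norm_mul, Complex.norm_real, Real.norm_eq_abs]
    exact mul_le_of_le_one_right (abs_nonneg _) (hh _)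
  rw [← (hs'.hasSum.tsum_fiberwise π).tsum_eq]
  refine tsum_congr fun x => ?_
  rw [fib, Complex.ofReal_tsum, ← tsum_mul_right]
  refine tsum_congr fun a => ?_
  have ha : π a = x := a.2
  rw [ha]

lemma tsum_ofReal_abs_fib_mul_le {u : α → ℝ} (hs : Summable u) (h : ι → ℝ≥0∞) :
    ∑' x, ENNReal.ofReal |fib π u x| * h x ≤ ∑' a, ENNReal.ofReal |u a| * h (π a) := by
  rw [← tsum_pushF π]
  refine ENNReal.tsum_le_tsum fun x => mul_le_mul' ?_ le_rfl
  rw [pushF_eq_tsum_fiber, ← ENNReal.ofReal_tsum_of_nonneg (fun _ => abs_nonneg _)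
    (hs.abs.subtype _)]
  refine ENNReal.ofReal_le_ofReal ?_
  have : Summable fun a : π ⁻¹' {x} => ‖u a‖ := hs.abs.subtype _
  exact norm_tsum_le_tsum_norm this

lemma fib_comp {u : α → ℝ} (e : α ≃ α) (ν : ι → ι) (hν : ∀ x, ν (ν x) = x)
    (he : ∀ a, π (e a) = ν (π a)) (hu : ∀ a, u (e a) = u a) (x : ι) :
    fib π u (ν x) = fib π u x := by
  classical
  have h1 : ∀ y, fib π u y = ∑' a, if π a = y then u a else 0 := fun y => by
    rw [fib, tsum_subtype (π ⁻¹' {y}) u]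
    refine tsum_congr fun a => ?_
    by_cases h : π a = y <;> simp [h]
  rw [h1, h1, ← e.tsum_eq]
  refine tsum_congr fun a => ?_
  rw [he, hu]
  have : ν (π a) = ν x ↔ π a = x := ⟨fun h => by rw [← hν (π a), h, hν], fun h => by rw [h]⟩
  simp only [this]

lemma summable_of_tsum_ofReal_ne_top {u : α → ℝ} (h : ∑' a, ENNReal.ofReal |u a| ≠ ⊤) :
    Summable u := by
  rw [← summable_norm_iff]
  have := ENNReal.summable_toReal h
  refine this.congr fun a => ?_
  rw [ENNReal.toReal_ofReal (abs_nonneg _), Real.norm_eq_abs]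

end Fibres

section Irreducible

variable {d : ℕ} {β p : ℝ}

lemma latJ_nil : latJ d β [] = 0 := rfl

lemma latJ_singleton (e : Fin d × Bool) : latJ d β [e] = 1 := irrInt_singleton _ e

/-- The moments of the irreducible weights of walks with at least two steps. -/
noncomputable def momSum (d : ℕ) (β p : ℝ) : ℝ≥0∞ :=
  ∑' ω : List (Fin d × Bool), if 2 ≤ ω.length then ENNReal.ofReal |latJ d β ω| *
    ENNReal.ofReal p ^ ω.length * jb (disp (wsawStep d) ω) ^ ((d : ℝ) - 7 / 4) else 0

lemma tsum_singleton_lists {σ : Type*} [Fintype σ] (F : List σ → ℝ≥0∞) :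
    ∑' ω : List σ, (if ω.length = 1 then F ω else 0) = ∑ e, F [e] := by
  rw [tsum_list_cons]
  simp only [List.length_nil, zero_ne_one, if_false, zero_add]
  refine Finset.sum_congr rfl fun e _ => ?_
  rw [tsum_eq_single []]
  · simp
  · intro ω hω
    rw [if_neg]
    simpa using hω

lemma tsum_latJ_split (g : List (Fin d × Bool) → ℝ≥0∞) :
    ∑' ω, ENNReal.ofReal |latJ d β ω| * g ω = ∑ e, g [e] +
      ∑' ω : List (Fin d × Bool),
        if 2 ≤ ω.length then ENNReal.ofReal |latJ d β ω| * g ω else 0 := by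
  rw [← tsum_singleton_lists, ← ENNReal.tsum_add]
  refine tsum_congr fun ω => ?_
  match ω with
  | [] => simp [latJ_nil]
  | [e] => simp [latJ_singleton]
  | e :: f :: ω => simp

lemma latW_mul_pow_nonneg (h0 : 0 ≤ β) (h1 : β ≤ 1) (hp : 0 ≤ p) (ω : List (Fin d × Bool)) :
    0 ≤ latW d β ω * p ^ ω.length := mul_nonneg (latW_mem h0 h1 ω).1 (pow_nonneg hp _)

lemma ofReal_latW_mul_pow (h0 : 0 ≤ β) (h1 : β ≤ 1) (hp : 0 ≤ p) (ω : List (Fin d × Bool)) :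
    ENNReal.ofReal (latW d β ω * p ^ ω.length) = wt (wsawStep d) β (ENNReal.ofReal p) ω := by
  rw [ENNReal.ofReal_mul (latW_mem h0 h1 ω).1, ENNReal.ofReal_pow hp]
  rfl

lemma summable_latW (h0 : 0 ≤ β) (h1 : β ≤ 1) (hp : 0 ≤ p) (hχ : suscept d β p ≠ ⊤) :
    Summable fun ω : List (Fin d × Bool) => latW d β ω * p ^ ω.length := by
  apply summable_of_tsum_ofReal_ne_top
  simp_rw [abs_of_nonneg (latW_mul_pow_nonneg h0 h1 hp _), ofReal_latW_mul_pow h0 h1 hp]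
  exact hχ

lemma ofReal_tsum_latW (h0 : 0 ≤ β) (h1 : β ≤ 1) (hp : 0 ≤ p) (hχ : suscept d β p ≠ ⊤) :
    ENNReal.ofReal (∑' ω : List (Fin d × Bool), latW d β ω * p ^ ω.length) = suscept d β p := by
  rw [ENNReal.ofReal_tsum_of_nonneg (latW_mul_pow_nonneg h0 h1 hp) (summable_latW h0 h1 hp hχ)]
  simp_rw [ofReal_latW_mul_pow h0 h1 hp]
  rfl

lemma tsum_latJ_mul_le (hp : 0 ≤ p) :
    ∑' ω, ENNReal.ofReal |latJ d β ω * p ^ ω.length| *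
      jb (disp (wsawStep d) ω) ^ ((d : ℝ) - 7 / 4) =
      ENNReal.ofReal (2 * d * p * 2 ^ ((d : ℝ) - 7 / 4)) + momSum d β p := by
  have e : ∀ ω : List (Fin d × Bool), ENNReal.ofReal |latJ d β ω * p ^ ω.length| =
      ENNReal.ofReal |latJ d β ω| * ENNReal.ofReal p ^ ω.length := fun ω => by
    rw [abs_mul, abs_of_nonneg (pow_nonneg hp _), ENNReal.ofReal_mul (abs_nonneg _),
      ENNReal.ofReal_pow hp]
  simp_rw [e, mul_assoc]
  rw [tsum_latJ_split, momSum]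
  congr 1
  · have e2 : ∀ e : Fin d × Bool, ENNReal.ofReal p ^ [e].length *
        jb (disp (wsawStep d) [e]) ^ ((d : ℝ) - 7 / 4) =
        ENNReal.ofReal (p * 2 ^ ((d : ℝ) - 7 / 4)) := fun e => by
      rw [jb_eq_ofReal, disp_cons, disp_nil, add_zero, norm_wsawStep, List.length_singleton,
        pow_one, ENNReal.ofReal_mul hp, ENNReal.ofReal_rpow_of_pos (by norm_num)]
      norm_num
    rw [Finset.sum_congr rfl fun e _ => e2 e, Finset.sum_const, Finset.card_univ,
      Fintype.card_prod, Fintype.card_fin, Fintype.card_bool, nsmul_eq_mul,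
      ← ENNReal.ofReal_natCast, ← ENNReal.ofReal_mul (by positivity)]
    congr 1
    push_cast
    ring
  · simp_rw [← mul_assoc]

lemma summable_latJ_of_momSum (hd : 5 ≤ d) (hp : 0 ≤ p) (hm : momSum d β p ≠ ⊤) :
    Summable fun ω : List (Fin d × Bool) => latJ d β ω * p ^ ω.length := by
  have hd' : (5 : ℝ) ≤ d := by exact_mod_cast hd
  apply summable_of_tsum_ofReal_ne_top
  refine ne_top_of_le_ne_top ?_ (ENNReal.tsum_le_tsum fun ω => le_mul_of_one_le_right zero_le
    (ENNReal.one_le_rpow (one_le_jb (disp (wsawStep d) ω)) (z := (d : ℝ) - 7 / 4) (by linarith)))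
  rw [tsum_latJ_mul_le hp]
  exact ENNReal.add_ne_top.2 ⟨ENNReal.ofReal_ne_top, hm⟩

lemma latJ_renewal (ω : List (Fin d × Bool)) : latW d β ω = (if ω = [] then 1 else 0) +
    ∑ n ∈ Finset.range (ω.length + 1), latJ d β (ω.take n) * latW d β (ω.drop n) :=
  walkInt_renewal _ _ ω

lemma latW_mul_one_sub_latJ (h0 : 0 ≤ β) (h1 : β ≤ 1) (hp : 0 ≤ p) (hχ : suscept d β p ≠ ⊤)
    (hj : Summable fun ω : List (Fin d × Bool) => latJ d β ω * p ^ ω.length)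
    (X : List (Fin d × Bool) → ℂ) (hX0 : X [] = 1) (hX : ∀ u v, X (u ++ v) = X u * X v)
    (hXp : ∀ ω, ‖X ω‖ ≤ p ^ ω.length) :
    (∑' ω, (latW d β ω : ℂ) * X ω) * (1 - ∑' ω, (latJ d β ω : ℂ) * X ω) = 1 := by
  refine tsum_mul_one_sub_tsum_eq_one latJ_renewal hX0 hX ?_ ?_
  · refine Summable.of_nonneg_of_le (fun _ => norm_nonneg _) (fun ω => ?_)
      (summable_latW h0 h1 hp hχ).abs
    rw [norm_mul, Complex.norm_real, Real.norm_eq_abs, abs_mul, abs_of_nonneg (pow_nonneg hp _)]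
    gcongr
    exact hXp ω
  · refine Summable.of_nonneg_of_le (fun _ => norm_nonneg _) (fun ω => ?_) hj.abs
    rw [norm_mul, Complex.norm_real, Real.norm_eq_abs, abs_mul, abs_of_nonneg (pow_nonneg hp _)]
    gcongr
    exact hXp ω

end Irreducible

section Pair

variable {d : ℕ} {β p : ℝ}

/-- The two-point function as a real function. -/
noncomputable def greenR (d : ℕ) (β p : ℝ) : (Fin d → ℤ) → ℝ :=
  fib (disp (wsawStep d)) fun ω => latW d β ω * p ^ ω.length

/-- The irreducible two-point function as a real function. -/
noncomputable def irrR (d : ℕ) (β p : ℝ) : (Fin d → ℤ) → ℝ :=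
  fib (disp (wsawStep d)) fun ω => latJ d β ω * p ^ ω.length

lemma ofReal_greenR (h0 : 0 ≤ β) (h1 : β ≤ 1) (hp : 0 ≤ p) (hχ : suscept d β p ≠ ⊤)
    (x : Fin d → ℤ) : ENNReal.ofReal (greenR d β p x) = green d β p x := by
  rw [greenR, ofReal_fib _ (latW_mul_pow_nonneg h0 h1 hp) (summable_latW h0 h1 hp hχ)]
  simp_rw [ofReal_latW_mul_pow h0 h1 hp]
  rfl

lemma tsum_greenR (h0 : 0 ≤ β) (h1 : β ≤ 1) (hp : 0 ≤ p) (hχ : suscept d β p ≠ ⊤) :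
    ∑' x, greenR d β p x = (suscept d β p).toReal := by
  rw [greenR, (hasSum_fib _ (summable_latW h0 h1 hp hχ)).tsum_eq,
    ← ofReal_tsum_latW h0 h1 hp hχ,
    ENNReal.toReal_ofReal (tsum_nonneg (latW_mul_pow_nonneg h0 h1 hp))]

lemma tsum_latW_mul_eq_one (h0 : 0 ≤ β) (h1 : β ≤ 1) (hp : 0 ≤ p) (hχ : suscept d β p ≠ ⊤)
    (hj : Summable fun ω : List (Fin d × Bool) => latJ d β ω * p ^ ω.length) :
    (∑' ω : List (Fin d × Bool), latW d β ω * p ^ ω.length) *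
      (1 - ∑' ω : List (Fin d × Bool), latJ d β ω * p ^ ω.length) = 1 := by
  have := latW_mul_one_sub_latJ h0 h1 hp hχ hj (fun ω => ((p ^ ω.length : ℝ) : ℂ)) (by simp)
    (by intro u v; simp [pow_add]) fun ω => by
      rw [Complex.norm_real, Real.norm_eq_abs, abs_of_nonneg (pow_nonneg hp _)]
  exact_mod_cast this

lemma one_sub_tsum_latJ_pos (h0 : 0 ≤ β) (h1 : β ≤ 1) (hp : 0 ≤ p) (hχ : suscept d β p ≠ ⊤)
    (hj : Summable fun ω : List (Fin d × Bool) => latJ d β ω * p ^ ω.length) :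
    0 < 1 - ∑' ω : List (Fin d × Bool), latJ d β ω * p ^ ω.length := by
  have h := tsum_latW_mul_eq_one h0 h1 hp hχ hj
  have hnn : 0 ≤ ∑' ω : List (Fin d × Bool), latW d β ω * p ^ ω.length :=
    tsum_nonneg (latW_mul_pow_nonneg h0 h1 hp)
  by_contra! hc
  nlinarith [mul_nonpos_of_nonneg_of_nonpos hnn hc]

lemma hasSum_singleton_lists {σ : Type*} [Fintype σ] (F : List σ → ℝ) :
    HasSum (fun ω : List σ => if ω.length = 1 then F ω else 0) (∑ e, F [e]) := by
  classical
  have hinj : Function.Injective fun e : σ => [e] := fun a b h => by simpa using h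
  have h1 : HasSum ((fun ω : List σ => if ω.length = 1 then F ω else 0) ∘ fun e : σ => [e])
      (∑ e, F [e]) := by
    convert hasSum_fintype (fun e : σ => F [e]) using 2
    simp
  refine (hinj.hasSum_iff ?_).1 h1
  intro ω hω
  refine if_neg fun hl => hω ?_
  obtain ⟨e, rfl⟩ := List.length_eq_one_iff.1 hl
  exact ⟨e, rfl⟩

/-- A weighted sum of the irreducible weights is controlled by the one-step walks. -/
lemma le_tsum_latJ_mul (hp : 0 ≤ p)
    (v : List (Fin d × Bool) → ℝ) {ε : ℝ} (hε : 0 ≤ ε)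
    (hv : ∑' ω : List (Fin d × Bool), (if 2 ≤ ω.length then ENNReal.ofReal |latJ d β ω| *
      ENNReal.ofReal p ^ ω.length * ENNReal.ofReal |v ω| else 0) ≤ ENNReal.ofReal ε) :
    p * ∑ e, v [e] - ε ≤ ∑' ω : List (Fin d × Bool), latJ d β ω * p ^ ω.length * v ω := by
  set w : List (Fin d × Bool) → ℝ := fun ω =>
    if 2 ≤ ω.length then latJ d β ω * p ^ ω.length * v ω else 0 with hw
  have hsplit : ∀ ω, latJ d β ω * p ^ ω.length * v ω =
      (if ω.length = 1 then latJ d β ω * p ^ ω.length * v ω else 0) + w ω := by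
    intro ω
    match ω with
    | [] => simp [latJ_nil, hw]
    | [e] => simp [hw]
    | e :: f :: ω => simp [hw]
  have hwE : ∑' ω, ENNReal.ofReal |w ω| ≤ ENNReal.ofReal ε := by
    refine le_trans (le_of_eq (tsum_congr fun ω => ?_)) hv
    rw [hw]
    simp only
    split_ifs
    · rw [abs_mul, abs_mul, abs_of_nonneg (pow_nonneg hp _),
        ENNReal.ofReal_mul (by positivity), ENNReal.ofReal_mul (abs_nonneg _),
        ENNReal.ofReal_pow hp]
    · simp
  have hws : Summable w :=
    summable_of_tsum_ofReal_ne_top (ne_top_of_le_ne_top ENNReal.ofReal_ne_top hwE)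
  have hwle : |∑' ω, w ω| ≤ ε := by
    have h1 : Summable fun ω => ‖w ω‖ := hws.abs
    refine (norm_tsum_le_tsum_norm h1).trans ?_
    rw [← ENNReal.ofReal_le_ofReal_iff hε, ENNReal.ofReal_tsum_of_nonneg
      (fun _ => norm_nonneg _) h1]
    exact hwE
  have h1 := hasSum_singleton_lists fun ω : List (Fin d × Bool) => latJ d β ω * p ^ ω.length * v ω
  have h2 := h1.add hws.hasSum
  simp_rw [← hsplit] at h2
  rw [h2.tsum_eq]
  simp only [latJ_singleton, List.length_singleton, pow_one, one_mul, ← Finset.mul_sum]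
  linarith [(abs_le.1 hwle).1]

lemma norm_sub_one_sq {z : ℂ} (hz : ‖z‖ = 1) : ‖z - 1‖ ^ 2 = 2 * (1 - z.re) := by
  rw [← Complex.normSq_eq_norm_sq] at *
  have h : z.re * z.re + z.im * z.im = 1 := by
    rw [← Complex.normSq_apply, Complex.normSq_eq_norm_sq, hz, one_pow]
  rw [Complex.normSq_apply]
  simp only [Complex.sub_re, Complex.one_re, Complex.sub_im, Complex.one_im]
  linarith

lemma ech_wsawStep (k : Fin d → ℝ) (l : Fin d) :
    ech k (wsawStep d (l, true)) = Complex.exp (k l * Complex.I) := by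
  rw [ech]
  congr 2
  rw [Finset.sum_eq_single l]
  · simp [wsawStep]
  · intro i _ hi
    simp [wsawStep, hi]
  · simp

lemma lam_sq_le_sum (k : Fin d → ℝ) :
    lam k ^ 2 ≤ ∑ e : Fin d × Bool, ‖ech k (wsawStep d e) - 1‖ ^ 2 := by
  have h0 : 0 ≤ ∑ e : Fin d × Bool, ‖ech k (wsawStep d e) - 1‖ ^ 2 := by positivity
  rw [← Real.le_sqrt (lam_nonneg k) h0]
  refine (pi_norm_le_iff_of_nonneg (Real.sqrt_nonneg _)).2 fun l => ?_
  rw [Real.le_sqrt (norm_nonneg _) h0, ← ech_wsawStep]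
  exact Finset.single_le_sum (f := fun e : Fin d × Bool => ‖ech k (wsawStep d e) - 1‖ ^ 2)
    (fun e _ => by positivity) (Finset.mem_univ (l, true))

lemma fhat_irrR (hj : Summable fun ω : List (Fin d × Bool) => latJ d β ω * p ^ ω.length)
    (k : Fin d → ℝ) : fhat (irrR d β p) k = ∑' ω : List (Fin d × Bool),
      ((latJ d β ω * p ^ ω.length : ℝ) : ℂ) * ech k (disp (wsawStep d) ω) :=
  tsum_fib_mul _ hj _ fun x => (norm_ech k x).le

lemma one_le_jb_rpow (hd : 5 ≤ d) (x : Fin d → ℤ) : 1 ≤ jb x ^ ((d : ℝ) - 7 / 4) := by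
  have hd' : (5 : ℝ) ≤ d := by exact_mod_cast hd
  exact ENNReal.one_le_rpow (one_le_jb x) (by linarith)

lemma two_mul_mul_le (hd : 5 ≤ d) (h0 : 0 ≤ β) (h1 : β ≤ 1) (hp : 0 ≤ p)
    (hχ : suscept d β p ≠ ⊤) {ε : ℝ} (hε : 0 ≤ ε) (hm : momSum d β p ≤ ENNReal.ofReal ε) :
    2 * d * p ≤ 1 + ε := by
  have hj := summable_latJ_of_momSum hd hp (ne_top_of_le_ne_top ENNReal.ofReal_ne_top hm)
  have h := le_tsum_latJ_mul (β := β) hp (fun _ => 1) hε (le_trans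
    (ENNReal.tsum_le_tsum fun ω => ?_) hm)
  · have h2 := one_sub_tsum_latJ_pos h0 h1 hp hχ hj
    simp only [mul_one, Finset.sum_const, Finset.card_univ, Fintype.card_prod, Fintype.card_fin,
      Fintype.card_bool, nsmul_eq_mul, Nat.cast_mul, Nat.cast_ofNat] at h
    linarith
  · split_ifs
    · gcongr
      simpa using one_le_jb_rpow hd _
    · rfl

lemma le_one_sub_fhat_irrR (hd : 5 ≤ d) (h0 : 0 ≤ β) (h1 : β ≤ 1) (hp : 1 / (4 * d) ≤ p)
    (hχ : suscept d β p ≠ ⊤) (hm : momSum d β p ≤ ENNReal.ofReal (1 / (8 * d ^ 3)))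
    (k : Fin d → ℝ) : 1 / (16 * d) * lam k ^ 2 ≤ (1 - fhat (irrR d β p) k).re := by
  have hd' : (5 : ℝ) ≤ d := by exact_mod_cast hd
  have hp0 : 0 ≤ p := le_trans (by positivity) hp
  have hj := summable_latJ_of_momSum hd hp0 (ne_top_of_le_ne_top ENNReal.ofReal_ne_top hm)
  set ε : ℝ := 1 / (8 * d ^ 3) with hε
  set v : List (Fin d × Bool) → ℝ := fun ω => 1 - (ech k (disp (wsawStep d) ω)).re with hv
  have hv2 : ∀ ω, v ω = ‖ech k (disp (wsawStep d) ω) - 1‖ ^ 2 / 2 := fun ω => by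
    rw [norm_sub_one_sq (norm_ech k _)]
    simp only [hv]
    ring
  have hv0 : ∀ ω, 0 ≤ v ω := fun ω => by
    rw [hv2]
    positivity
  have hvB : ∀ ω, |v ω| ≤ 2 := fun ω => by
    rw [abs_of_nonneg (hv0 ω)]
    have := Complex.abs_re_le_norm (ech k (disp (wsawStep d) ω))
    rw [norm_ech] at this
    simp only [hv]
    linarith [(abs_le.1 this).1]
  have hre : (1 - fhat (irrR d β p) k).re =
      (1 - ∑' ω : List (Fin d × Bool), latJ d β ω * p ^ ω.length) +
      ∑' ω : List (Fin d × Bool), latJ d β ω * p ^ ω.length * v ω := by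
    have hs2 : Summable fun ω : List (Fin d × Bool) =>
        ((latJ d β ω * p ^ ω.length : ℝ) : ℂ) * ech k (disp (wsawStep d) ω) := by
      refine Summable.of_norm_bounded hj.abs fun ω => ?_
      rw [norm_mul, norm_ech, mul_one, Complex.norm_real, Real.norm_eq_abs]
    have hs3 : Summable fun ω : List (Fin d × Bool) => latJ d β ω * p ^ ω.length * v ω := by
      refine Summable.of_norm_bounded (hj.abs.mul_right 2) fun ω => ?_
      rw [norm_mul, Real.norm_eq_abs, Real.norm_eq_abs]
      gcongr
      exact hvB ω
    rw [fhat_irrR hj, Complex.sub_re, Complex.one_re, Complex.re_tsum hs2, sub_add,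
      ← hj.tsum_sub hs3]
    congr 1
    refine tsum_congr fun ω => ?_
    rw [Complex.re_ofReal_mul]
    simp only [hv]
    ring
  have hle := le_tsum_latJ_mul hp0 v (ε := d ^ 2 * lam k ^ 2 / 2 * ε) (by positivity) (by
    rw [ENNReal.ofReal_mul (by positivity)]
    refine le_trans ?_ (mul_le_mul' le_rfl hm)
    rw [momSum, ← ENNReal.tsum_mul_left]
    refine ENNReal.tsum_le_tsum fun ω => ?_
    split_ifs
    · rw [mul_left_comm]
      gcongr
      rw [abs_of_nonneg (hv0 ω), hv2, jb_eq_ofReal,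
        ENNReal.ofReal_rpow_of_pos (by positivity), ← ENNReal.ofReal_mul (by positivity)]
      apply ENNReal.ofReal_le_ofReal
      have h3 := norm_ech_sub_one_le k (disp (wsawStep d) ω)
      set y := ‖disp (wsawStep d) ω‖
      have hy : 0 ≤ y := norm_nonneg _
      have h4 : y ^ 2 ≤ (1 + y) ^ ((d : ℝ) - 7 / 4) := by
        calc y ^ 2 ≤ (1 + y) ^ 2 := by gcongr; linarith
          _ = (1 + y) ^ (2 : ℝ) := by norm_cast
          _ ≤ _ := Real.rpow_le_rpow_of_exponent_le (by linarith) (by linarith)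
      calc _ ≤ (d * lam k * y) ^ 2 / 2 := by gcongr
        _ = d ^ 2 * lam k ^ 2 / 2 * y ^ 2 := by ring
        _ ≤ _ := by gcongr
    · simp)
  have hsum : lam k ^ 2 / 2 ≤ ∑ e, v [e] := by
    simp_rw [hv2, disp_cons, disp_nil, add_zero]
    rw [← Finset.sum_div]
    gcongr
    exact lam_sq_le_sum k
  have h5 := one_sub_tsum_latJ_pos h0 h1 hp0 hχ hj
  have h6 : 1 / (4 * d) * (lam k ^ 2 / 2) ≤ p * ∑ e, v [e] := by gcongr
  have h7 : (d : ℝ) ^ 2 * lam k ^ 2 / 2 * ε = 1 / (16 * d) * lam k ^ 2 := by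
    rw [hε]
    field_simp
    ring
  have h8 : 1 / (4 * d) * (lam k ^ 2 / 2) = 2 * (1 / (16 * d) * lam k ^ 2) := by
    field_simp
    ring
  rw [hre]
  linarith

/-- The two-point function and its irreducible part satisfy the infrared hypotheses. -/
theorem greenPair (hd : 5 ≤ d) (h0 : 0 ≤ β) (h1 : β ≤ 1) (hp : 1 / (4 * d) ≤ p)
    (hχ : suscept d β p ≠ ⊤) (hm : momSum d β p ≤ ENNReal.ofReal (1 / (8 * d ^ 3))) :
    GreenPair (2 * 2 ^ d + 1) (1 / (16 * d)) (greenR d β p) (irrR d β p) := by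
  have hd' : (5 : ℝ) ≤ d := by exact_mod_cast hd
  have hp0 : 0 ≤ p := le_trans (by positivity) hp
  have hj := summable_latJ_of_momSum hd hp0 (ne_top_of_le_ne_top ENNReal.ofReal_ne_top hm)
  have hε : 1 / (8 * (d : ℝ) ^ 3) ≤ 1 := by
    rw [div_le_one (by positivity)]
    nlinarith [one_le_pow₀ (n := 3) (show (1 : ℝ) ≤ d by linarith)]
  have hmom : ∑' x, ENNReal.ofReal |irrR d β p x| * jb x ^ ((d : ℝ) - 7 / 4) ≤
      ENNReal.ofReal (2 * 2 ^ d + 1) := by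
    refine (tsum_ofReal_abs_fib_mul_le _ hj _).trans ?_
    rw [tsum_latJ_mul_le hp0, ENNReal.ofReal_add (by positivity) zero_le_one]
    refine add_le_add (ENNReal.ofReal_le_ofReal ?_) (hm.trans (ENNReal.ofReal_le_ofReal hε))
    have h2 := two_mul_mul_le hd h0 h1 hp0 hχ (by positivity) hm
    have h3 : (2 : ℝ) ^ ((d : ℝ) - 7 / 4) ≤ 2 ^ d := by
      rw [← Real.rpow_natCast]
      exact Real.rpow_le_rpow_of_exponent_le (by norm_num) (by linarith)
    gcongr
    linarith
  have e : ∀ x, ENNReal.ofReal |irrR d β p x| * jb x ^ ((d : ℝ) - 7 / 4) =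
      ENNReal.ofReal |(|irrR d β p x| * (1 + ‖x‖) ^ ((d : ℝ) - 7 / 4))| := fun x => by
    rw [jb_eq_ofReal, ENNReal.ofReal_rpow_of_pos (by positivity),
      ← ENNReal.ofReal_mul (by positivity), abs_of_nonneg (a := _ * _) (by positivity)]
  simp_rw [e] at hmom
  have hms := summable_of_tsum_ofReal_ne_top (ne_top_of_le_ne_top ENNReal.ofReal_ne_top hmom)
  refine ⟨fib_nonneg _ (latW_mul_pow_nonneg h0 h1 hp0),
    (hasSum_fib _ (summable_latW h0 h1 hp0 hχ)).summable, ?_, hms, ?_, fun k => ?_,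
    le_one_sub_fhat_irrR hd h0 h1 hp hχ hm⟩
  · refine fib_comp _ (flipEquiv d) Neg.neg neg_neg (fun ω => disp_map wsawStep_flipStep ω)
      fun ω => ?_
    have h3 : latJ d β (ω.map flipStep) = latJ d β ω :=
      irrInt_map wsawStep_flipStep (contactW_id_neg β) ω
    simp only [flipEquiv, Equiv.coe_fn_mk, h3, List.length_map]
  · rw [← ENNReal.ofReal_le_ofReal_iff (by positivity),
      ENNReal.ofReal_tsum_of_nonneg (fun x => by positivity) hms]
    refine le_trans (le_of_eq (tsum_congr fun x => ?_)) hmom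
    rw [abs_of_nonneg (a := _ * _) (by positivity)]
  · have h := latW_mul_one_sub_latJ h0 h1 hp0 hχ hj
      (fun ω => (p : ℂ) ^ ω.length * ech k (disp (wsawStep d) ω)) (by simp)
      (by
        intro u v
        rw [List.length_append, disp_append, ech_add, pow_add]
        ring)
      fun ω => by
        rw [norm_mul, norm_ech, mul_one, norm_pow, Complex.norm_real, Real.norm_eq_abs,
          abs_of_nonneg hp0]
    rw [fhat_irrR hj, show fhat (greenR d β p) k = ∑' ω : List (Fin d × Bool),
      ((latW d β ω * p ^ ω.length : ℝ) : ℂ) * ech k (disp (wsawStep d) ω) from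
      tsum_fib_mul _ (summable_latW h0 h1 hp0 hχ) _ fun x => (norm_ech k x).le]
    push_cast
    simpa only [mul_assoc] using h

end Pair

section Decay

variable {d : ℕ}

lemma one_le_jb_rpow_of_nonneg {A : Type*} [NormedAddCommGroup A] (x : A) {k : ℝ} (hk : 0 ≤ k) :
    1 ≤ jb x ^ k := by
  simpa using ENNReal.rpow_le_rpow (one_le_jb x) hk

/-- Decay of order `d - 2` implies square summability, with some room, for `d ≥ 5`. -/
lemma exists_sqSumLE_of_decay (hd : 5 ≤ d) : ∃ S : ℝ≥0∞, S ≠ ⊤ ∧ 1 ≤ S ∧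
    ∀ (f : (Fin d → ℤ) → ℝ≥0∞) (A : ℝ≥0∞), (∀ x, f x * jb x ^ (d - 2) ≤ A) →
      SqSumLE (fun x => f x * jb x ^ (1 / 4 : ℝ)) (A * S) := by
  have hd' : (5 : ℝ) ≤ d := by exact_mod_cast hd
  obtain ⟨C, -, hC⟩ := exists_tsum_max_rpow_le d
  have h1 := hC 1 le_rfl
  set s := ∑' m : Fin d → ℤ, ENNReal.ofReal (max ‖m‖ 1 ^ (-((d : ℝ) + 1 / 4))) with hs
  refine ⟨1 + s, ?_, le_self_add, fun f A hf => ?_⟩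
  · exact ENNReal.add_ne_top.2 ⟨ENNReal.one_ne_top, ne_top_of_le_ne_top ENNReal.ofReal_ne_top h1⟩
  have hs2 : s ≤ (1 + s) ^ 2 := by
    calc s ≤ 1 + s := le_add_self
      _ ≤ (1 + s) ^ 2 := le_self_pow le_self_add (by norm_num)
  unfold SqSumLE
  rw [mul_pow]
  refine le_trans ?_ (mul_le_mul' le_rfl hs2)
  rw [hs, ← ENNReal.tsum_mul_left]
  refine ENNReal.tsum_le_tsum fun x => ?_
  have hj0 : jb x ≠ 0 := (zero_lt_one.trans_le (one_le_jb x)).ne'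
  have hjt := jb_ne_top x
  have h2 : f x * jb x ^ (1 / 4 : ℝ) = f x * jb x ^ (d - 2) * jb x ^ (1 / 4 - ((d : ℝ) - 2)) := by
    rw [mul_assoc, ← ENNReal.rpow_natCast, ← ENNReal.rpow_add _ _ hj0 hjt,
      Nat.cast_sub (by omega)]
    congr 2
    push_cast
    ring
  beta_reduce
  rw [h2, mul_pow]
  refine mul_le_mul' (pow_le_pow_left' (hf x) 2) ?_
  rw [← ENNReal.rpow_natCast, ← ENNReal.rpow_mul, jb_eq_ofReal,
    ENNReal.ofReal_rpow_of_pos (by positivity)]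
  apply ENNReal.ofReal_le_ofReal
  have h3 : (0 : ℝ) < max ‖x‖ 1 := lt_max_of_lt_right one_pos
  calc (1 + ‖x‖) ^ ((1 / 4 - ((d : ℝ) - 2)) * (2 : ℕ))
      ≤ (1 + ‖x‖) ^ (-((d : ℝ) + 1 / 4)) := by
        apply Real.rpow_le_rpow_of_exponent_le (by linarith [norm_nonneg x])
        push_cast
        linarith
    _ ≤ _ := by
        apply Real.rpow_le_rpow_of_nonpos h3 _ (by linarith)
        exact max_le (by linarith) (by linarith [norm_nonneg x])

lemma sqSumLE_green_of_decay {β p : ℝ} {A S : ℝ≥0∞}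
    (hS : SqSumLE (fun x => green d β p x * jb x ^ (1 / 4 : ℝ)) (A * S)) :
    SqSumLE (green d β p) (A * S) :=
  hS.mono (fun x => le_mul_of_one_le_right' (one_le_jb_rpow_of_nonneg x (by norm_num))) le_rfl

/-- Decay of the two-point function makes the irreducible sums small at weak coupling. -/
theorem exists_small_of_decay (hd : 5 ≤ d) {A ε : ℝ≥0∞} (hA : A ≠ ⊤) (hε : ε ≠ 0) :
    ∃ β₁ : ℝ, 0 < β₁ ∧ ∀ β, 0 ≤ β → β ≤ β₁ → ∀ p : ℝ,
      (∀ x, green d β p x * jb x ^ (d - 2) ≤ A) → momSum d β p ≤ ε ∧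
      ∑' ω : List (Fin d × Bool), (if 2 ≤ ω.length then ENNReal.ofReal |latJ d β ω| *
        ENNReal.ofReal p ^ ω.length * ω.length else 0) ≤ ε := by
  obtain ⟨S, hS, -, H⟩ := exists_sqSumLE_of_decay hd
  have hAS : A * S ≠ ⊤ := ENNReal.mul_ne_top hA hS
  have hAS2 : (A * S) ^ 2 ≠ ⊤ := ENNReal.pow_ne_top hAS
  obtain ⟨b1, hb1, H1⟩ := exists_ofReal_mul_le (X := 3 * 4 ^ (d - 2) * (A * S) ^ 2)
    (ε := 1 / 2) (by finiteness) (by simp)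
  obtain ⟨b2, hb2, H2⟩ := exists_ofReal_mul_le (X := 4 * (2 ^ (d - 2) * A)) (by finiteness) hε
  obtain ⟨b3, hb3, H3⟩ := exists_ofReal_mul_le (X := 4 * (A * S) ^ 2) (by finiteness) hε
  refine ⟨min (min b1 b2) (min b3 (1 / 2)), by positivity, fun β h0 hβ p hp => ?_⟩
  simp only [le_min_iff] at hβ
  obtain ⟨⟨hβ1, hβ2⟩, hβ3, hβ4⟩ := hβ
  have hsq := H _ _ hp
  constructor
  · have hm := irrInt_moment_sum_le (st := wsawStep d) (q := ENNReal.ofReal p)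
      (AddMonoidHom.id (Fin d → ℤ)) enorm_le_enorm_add_self h0 hβ4 (p := d - 2)
      (by omega) (k := 1 / 4) (by norm_num) (b := A * S) (c := A)
      (hsq.mono (fun x => ?_) le_rfl) (fun x => ?_) (H1 β hβ1)
    · refine le_trans (le_of_eq ?_) (hm.trans (le_trans (le_of_eq ?_) (H2 β hβ2)))
      · unfold momSum latJ
        refine tsum_congr fun ω => ?_
        split_ifs
        · congr 1
          simp only [AddMonoidHom.id_apply]
          have hj0 : jb (disp (wsawStep d) ω) ≠ 0 := (zero_lt_one.trans_le (one_le_jb _)).ne'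
          rw [← ENNReal.rpow_natCast, ← ENNReal.rpow_add _ _ hj0 (jb_ne_top _),
            Nat.cast_sub (by omega)]
          congr 1
          push_cast
          ring
        · rfl
      · ring
    · exact (pushF_mul (disp (wsawStep d)) _ (fun x => jb x ^ (1 / 4 : ℝ)) x).le
    · exact (pushF_mul (disp (wsawStep d)) _ (fun x => jb x ^ (d - 2)) x).le.trans (hp x)
  · have hm := irrInt_length_sum_le (st := wsawStep d) (q := ENNReal.ofReal p)
      (AddMonoidHom.id (Fin d → ℤ)) h0 hβ4 (sqSumLE_green_of_decay hsq) (by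
        refine le_trans ?_ (H1 β hβ1)
        gcongr
        exact le_mul_of_one_le_right' (one_le_pow₀ (by norm_num)))
    refine hm.trans (le_trans (le_of_eq ?_) (H3 β hβ3))
    ring

end Decay

section Bootstrap

variable {d : ℕ}

lemma GreenPair.exists_le_rpow (hd : 5 ≤ d) {M c : ℝ} (hc : 0 < c) (hM : 0 ≤ M) :
    ∃ C : ℝ, 0 ≤ C ∧ ∀ G J : (Fin d → ℤ) → ℝ, GreenPair M c G J → ∀ x, x ≠ 0 →
      ENNReal.ofReal (G x) ≤ ENNReal.ofReal (C * (‖x‖ ^ (d - 2))⁻¹) := by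
  obtain ⟨C, hC, H⟩ := GreenPair.exists_tsum_far_le hd hc hM
  refine ⟨C, hC, fun G J h x hx => ?_⟩
  have hx0 : 0 < ‖x‖ := norm_pos_iff.2 hx
  have hlim : Filter.Tendsto (fun L : ℕ => ENNReal.ofReal
      (C * ((‖x‖ ^ (d - 2))⁻¹ + (∑' x, G x) / (L : ℝ) ^ d))) Filter.atTop
      (nhds (ENNReal.ofReal (C * ((‖x‖ ^ (d - 2))⁻¹ + 0)))) := by
    refine (ENNReal.continuous_ofReal.tendsto _).comp (Filter.Tendsto.const_mul _
      (Filter.Tendsto.const_add _ (Filter.Tendsto.const_div_atTop ?_ _)))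
    exact (Filter.tendsto_pow_atTop (by omega)).comp tendsto_natCast_atTop_atTop
  rw [add_zero] at hlim
  refine ge_of_tendsto hlim ?_
  filter_upwards [Filter.eventually_ge_atTop (⌈‖x‖⌉₊ + 1)] with L hL
  have h1 : ‖x‖ ≤ L := (Nat.le_ceil _).trans (by exact_mod_cast (by omega : ⌈‖x‖⌉₊ ≤ L))
  refine le_trans ?_ (H G J h L ‖x‖ x hx0 (by omega) (by linarith))
  refine le_trans (le_of_eq ?_) (ENNReal.le_tsum x)
  simp

/-- Small irreducible moments imply a uniform decay of the two-point function. -/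
lemma exists_decay_of_small (hd : 5 ≤ d) : ∃ K : ℝ, 0 ≤ K ∧ ∀ β p : ℝ, 0 ≤ β → β ≤ 1 →
    1 / (4 * d) ≤ p → suscept d β p ≠ ⊤ → momSum d β p ≤ ENNReal.ofReal (1 / (8 * d ^ 3)) →
    ∀ x, green d β p x * jb x ^ (d - 2) ≤ ENNReal.ofReal K := by
  have hd' : (5 : ℝ) ≤ d := by exact_mod_cast hd
  obtain ⟨C, hC, H⟩ := GreenPair.exists_le_rpow hd (M := 2 * 2 ^ d + 1) (c := 1 / (16 * d))
    (by positivity) (by positivity)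
  refine ⟨max (1 + 2 * C) (C * 2 ^ (d - 2)), by positivity,
    fun β p h0 h1 hp hχ hm x => ?_⟩
  have hp0 : 0 ≤ p := le_trans (by positivity) hp
  have hG : ∀ y, y ≠ 0 → green d β p y ≤ ENNReal.ofReal (C * (‖y‖ ^ (d - 2))⁻¹) := fun y hy => by
    rw [← ofReal_greenR h0 h1 hp0 hχ]
    exact H _ _ (greenPair hd h0 h1 hp hχ hm) y hy
  rcases eq_or_ne x 0 with rfl | hx
  · have hj : jb (0 : Fin d → ℤ) = 1 := by simp [jb]
    rw [hj, one_pow, mul_one]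
    refine (green_zero_le h0 h1 p).trans (le_trans ?_ (ENNReal.ofReal_le_ofReal (le_max_left _ _)))
    rw [ENNReal.ofReal_add zero_le_one (by positivity), ENNReal.ofReal_one]
    gcongr
    have h2 : ∀ e : Fin d × Bool, ENNReal.ofReal p * green d β p (-wsawStep d e) ≤
        ENNReal.ofReal (p * C) := fun e => by
      rw [ENNReal.ofReal_mul hp0]
      gcongr
      simpa [norm_wsawStep] using hG (-wsawStep d e) (neg_ne_zero.2 (wsawStep_ne_zero e))
    refine (Finset.sum_le_sum fun e _ => h2 e).trans ?_
    rw [Finset.sum_const, nsmul_eq_mul, ← ENNReal.ofReal_natCast,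
      ← ENNReal.ofReal_mul (by positivity)]
    apply ENNReal.ofReal_le_ofReal
    have h3 := two_mul_mul_le hd h0 h1 hp0 hχ (by positivity) hm
    have h4 : 1 / (8 * (d : ℝ) ^ 3) ≤ 1 := by
      rw [div_le_one (by positivity)]
      nlinarith [one_le_pow₀ (n := 3) (show (1 : ℝ) ≤ d by linarith)]
    simp only [Finset.card_univ, Fintype.card_prod, Fintype.card_fin, Fintype.card_bool,
      Nat.cast_mul, Nat.cast_ofNat]
    calc (d : ℝ) * 2 * (p * C) = 2 * d * p * C := by ring
      _ ≤ 2 * C := by gcongr; linarith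
  · have hx1 := one_le_norm_of_ne_zero hx
    refine le_trans (mul_le_mul' (hG x hx) le_rfl) ?_
    rw [jb_eq_ofReal, ← ENNReal.ofReal_pow (by positivity), ← ENNReal.ofReal_mul (by positivity)]
    refine ENNReal.ofReal_le_ofReal (le_trans ?_ (le_max_right _ _))
    calc C * (‖x‖ ^ (d - 2))⁻¹ * (1 + ‖x‖) ^ (d - 2)
        ≤ C * (‖x‖ ^ (d - 2))⁻¹ * (2 * ‖x‖) ^ (d - 2) := by gcongr; linarith
      _ = _ := by
        rw [mul_pow]
        have : ‖x‖ ^ (d - 2) ≠ 0 := by positivity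
        field_simp

/-- An absolute bound on the weighted two-point function at the starting point. -/
lemma exists_decay_start (hd : 5 ≤ d) : ∃ K : ℝ, 0 ≤ K ∧ ∀ β : ℝ, 0 ≤ β → β ≤ 1 →
    ∀ x, green d β (1 / (4 * d)) x * jb x ^ (d - 2) ≤ ENNReal.ofReal K := by
  have hd' : (5 : ℝ) ≤ d := by exact_mod_cast hd
  have hs : Summable fun n : ℕ => ((n + 1 : ℕ) : ℝ) ^ (d - 2) * (1 / 2) ^ (n + 1) :=
    (summable_nat_add_iff 1).2 (summable_pow_mul_geometric_of_norm_lt_one (R := ℝ) (d - 2)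
      (r := 1 / 2) (by norm_num))
  have h0 : ∀ n : ℕ, 0 ≤ ((n + 1 : ℕ) : ℝ) ^ (d - 2) * (1 / 2) ^ (n + 1) := fun n => by positivity
  refine ⟨∑' n : ℕ, 2 * (((n + 1 : ℕ) : ℝ) ^ (d - 2) * (1 / 2) ^ (n + 1)),
    tsum_nonneg fun n => by positivity, fun β hβ0 hβ1 x => ?_⟩
  rw [green, ← pushF_mul (disp (wsawStep d)) _ (fun x => jb x ^ (d - 2)) x]
  refine (pushF_le_tsum _ _ _).trans ?_
  rw [ENNReal.ofReal_tsum_of_nonneg (fun n => by positivity) (hs.mul_left 2)]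
  have h2 : ∀ ω : List (Fin d × Bool), wt (wsawStep d) β (ENNReal.ofReal (1 / (4 * d))) ω *
      jb (disp (wsawStep d) ω) ^ (d - 2) ≤
      ENNReal.ofReal (1 / (4 * d)) ^ ω.length * ((ω.length + 1 : ℕ) : ℝ≥0∞) ^ (d - 2) := fun ω => by
    gcongr
    · exact wt_le_pow hβ0 hβ1 _ ω
    · exact jb_disp_le ω
  refine (ENNReal.tsum_le_tsum h2).trans ?_
  rw [tsum_list_length fun n => ENNReal.ofReal (1 / (4 * d)) ^ n *
    ((n + 1 : ℕ) : ℝ≥0∞) ^ (d - 2)]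
  refine ENNReal.tsum_le_tsum fun n => ?_
  rw [← ENNReal.ofReal_pow (by positivity), ← ENNReal.ofReal_natCast (n + 1),
    ← ENNReal.ofReal_natCast (Fintype.card _), ← ENNReal.ofReal_pow (by positivity),
    ← ENNReal.ofReal_pow (by positivity), ← ENNReal.ofReal_mul (by positivity),
    ← ENNReal.ofReal_mul (by positivity)]
  apply ENNReal.ofReal_le_ofReal
  simp only [Fintype.card_prod, Fintype.card_fin, Fintype.card_bool, Nat.cast_mul,
      Nat.cast_ofNat]
  rw [← mul_assoc, ← mul_pow, show (d : ℝ) * 2 * (1 / (4 * d)) = 1 / 2 by field_simp; norm_num,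
    pow_succ (1 / 2 : ℝ) n]
  apply le_of_eq
  ring

/-- A modulus of continuity for the weighted two-point function. -/
lemma exists_green_lipschitz {β p₁ q : ℝ} (hp₁ : 0 < p₁) (hq : p₁ < q)
    (hχ : suscept d β q ≠ ⊤) : ∃ D : ℝ≥0∞, D ≠ ⊤ ∧ ∀ p p' : ℝ, 0 ≤ p → p ≤ p' → p' ≤ p₁ →
      ∀ x, green d β p' x * jb x ^ (d - 2) ≤
        green d β p x * jb x ^ (d - 2) + ENNReal.ofReal (p' - p) * D := by
  have hq0 : 0 < q := hp₁.trans hq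
  have hr : p₁ / q < 1 := (div_lt_one hq0).2 hq
  have hs := summable_pow_mul_geometric_of_norm_lt_one (R := ℝ) (d - 2 + 1)
      (r := p₁ / q) (by rwa [Real.norm_of_nonneg (by positivity)])
  obtain ⟨B, hB⟩ := hs.tendsto_atTop_zero.bddAbove_range
  have hB' : ∀ n : ℕ, (n : ℝ) ^ (d - 2 + 1) * (p₁ / q) ^ n ≤ B := fun n => hB ⟨n, rfl⟩
  have hB0 : 0 ≤ B := le_trans (by positivity) (hB' 0)
  have hbd : ∀ n : ℕ, n * p₁ ^ (n - 1) * ((n : ℝ) + 1) ^ (d - 2) ≤ B * q / p₁ ^ 2 * q ^ n := by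
    intro n
    have h1 := hB' (n + 1)
    rw [div_pow, mul_div_assoc', div_le_iff₀ (by positivity)] at h1
    rw [div_mul_eq_mul_div, le_div_iff₀ (by positivity)]
    rcases n with _ | n
    · simp
      positivity
    · push_cast at h1 ⊢
      calc ((n : ℝ) + 1) * p₁ ^ n * (n + 1 + 1) ^ (d - 2) * p₁ ^ 2
          ≤ (n + 1 + 1) * p₁ ^ n * (n + 1 + 1) ^ (d - 2) * p₁ ^ 2 := by gcongr; linarith
        _ = (n + 1 + 1) ^ (d - 2 + 1) * p₁ ^ (n + 1 + 1) := by ring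
        _ ≤ _ := h1.trans (le_of_eq (by ring))
  let g : List (Fin d × Bool) → ℝ≥0∞ := fun ω => ENNReal.ofReal (latW d β ω) *
    (ENNReal.ofReal (ω.length * p₁ ^ (ω.length - 1)) * jb (disp (wsawStep d) ω) ^ (d - 2))
  refine ⟨∑' ω, g ω, ?_, fun p p' hp hpp hp' x => ?_⟩
  · refine ne_top_of_le_ne_top (b := ENNReal.ofReal (B * q / p₁ ^ 2) * suscept d β q)
      (ENNReal.mul_ne_top ENNReal.ofReal_ne_top hχ) ?_
    rw [suscept, ← ENNReal.tsum_mul_left]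
    refine ENNReal.tsum_le_tsum fun ω => ?_
    simp only [g, wt, latW]
    rw [mul_left_comm (ENNReal.ofReal (B * q / p₁ ^ 2))]
    refine mul_le_mul' le_rfl ?_
    refine (mul_le_mul' le_rfl (pow_le_pow_left' (jb_disp_le ω) (d - 2))).trans ?_
    rw [← ENNReal.ofReal_pow (by positivity), ← ENNReal.ofReal_natCast (ω.length + 1),
      ← ENNReal.ofReal_pow (by positivity), ← ENNReal.ofReal_mul (by positivity),
      ← ENNReal.ofReal_mul (by positivity)]
    apply ENNReal.ofReal_le_ofReal
    have := hbd ω.length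
    push_cast
    exact this
  · unfold green
    have hp'0 := hp.trans hpp
    rw [← pushF_mul (disp (wsawStep d)) _ (fun x => jb x ^ (d - 2)) x,
      ← pushF_mul (disp (wsawStep d)) _ (fun x => jb x ^ (d - 2)) x, ← ENNReal.tsum_mul_left]
    classical
    unfold pushF
    rw [← ENNReal.tsum_add]
    refine ENNReal.tsum_le_tsum fun ω => ?_
    split_ifs
    · simp only [wt, g, latW]
      rw [mul_assoc, mul_assoc, mul_left_comm (ENNReal.ofReal (p' - p)), ← mul_add,
        ← mul_assoc (ENNReal.ofReal (p' - p)), ← add_mul]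
      gcongr
      rw [← ENNReal.ofReal_pow hp, ← ENNReal.ofReal_pow hp'0,
        ← ENNReal.ofReal_mul (by linarith), ← ENNReal.ofReal_add (by positivity) (by
          have : 0 ≤ p' - p := by linarith
          positivity)]
      apply ENNReal.ofReal_le_ofReal
      have h1 : p' ^ ω.length - p ^ ω.length ≤ (p' - p) * (ω.length * p₁ ^ (ω.length - 1)) := by
        rw [← Commute.mul_geom_sum₂ (Commute.all p' p)]
        have h2 : ∑ i ∈ Finset.range ω.length, p' ^ i * p ^ (ω.length - 1 - i) ≤
            ω.length * p₁ ^ (ω.length - 1) := by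
          refine (Finset.sum_le_card_nsmul _ _ (p₁ ^ (ω.length - 1)) fun i hi => ?_).trans
            (le_of_eq (by simp))
          rw [Finset.mem_range] at hi
          calc p' ^ i * p ^ (ω.length - 1 - i) ≤ p₁ ^ i * p₁ ^ (ω.length - 1 - i) := by
                gcongr
                linarith
            _ = _ := by rw [← pow_add]; congr 1; omega
        gcongr
      linarith
    · exact zero_le

lemma suscept_mono (β : ℝ) {p q : ℝ} (h : p ≤ q) : suscept d β p ≤ suscept d β q := by
  unfold suscept wt
  gcongr

/-- The bootstrap: uniform decay of the two-point function below the critical point, and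
smallness of the irreducible sums. -/
theorem exists_bootstrap (hd : 5 ≤ d) : ∃ K : ℝ, 0 ≤ K ∧ ∀ ε : ℝ≥0∞, ε ≠ 0 →
    ∃ β₁ : ℝ, 0 < β₁ ∧ β₁ ≤ 1 / 2 ∧ ∀ β, 0 ≤ β → β ≤ β₁ → ∀ p q : ℝ, 1 / (4 * d) ≤ p → p < q →
      suscept d β q ≠ ⊤ → (∀ x, green d β p x * jb x ^ (d - 2) ≤ ENNReal.ofReal K) ∧
      momSum d β p ≤ ENNReal.ofReal (1 / (8 * d ^ 3)) ∧
      ∑' ω : List (Fin d × Bool), (if 2 ≤ ω.length then ENNReal.ofReal |latJ d β ω| *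
        ENNReal.ofReal p ^ ω.length * ω.length else 0) ≤ ε := by
  have hd' : (5 : ℝ) ≤ d := by exact_mod_cast hd
  obtain ⟨K₁, hK₁, H1⟩ := exists_decay_of_small hd
  obtain ⟨K₀, hK₀, H0⟩ := exists_decay_start hd
  have hK : 0 < max K₀ K₁ + 1 := by positivity
  set K := max K₀ K₁ + 1 with hKd
  refine ⟨K, hK.le, fun ε hε => ?_⟩
  obtain ⟨b, hb, Hb⟩ := exists_small_of_decay hd (A := ENNReal.ofReal (2 * K))
    (ε := min ε (ENNReal.ofReal (1 / (8 * d ^ 3)))) ENNReal.ofReal_ne_top (by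
      rw [← pos_iff_ne_zero, lt_min_iff, pos_iff_ne_zero]
      exact ⟨hε, ENNReal.ofReal_pos.2 (by positivity)⟩)
  refine ⟨min b (1 / 2), by positivity, min_le_right _ _, fun β h0 hβ p q hp hpq hχ => ?_⟩
  have hβ1 := hβ.trans (min_le_left _ _)
  have hβ2 : β ≤ 1 := (hβ.trans (min_le_right _ _)).trans (by norm_num)
  have hp0 : 0 < p := lt_of_lt_of_le (by positivity) hp
  obtain ⟨D, hD, HD⟩ := exists_green_lipschitz hp0 hpq hχ
  obtain ⟨δ, hδ, Hδ⟩ := exists_ofReal_mul_le hD (ε := ENNReal.ofReal K)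
    (ENNReal.ofReal_pos.2 hK).ne'
  have hstep : ∀ k : ℕ, ∀ x, green d β (min (1 / (4 * d) + k * δ) p) x * jb x ^ (d - 2) ≤
      ENNReal.ofReal K := by
    intro k
    induction k with
    | zero =>
      intro x
      rw [Nat.cast_zero, zero_mul, add_zero, min_eq_left hp]
      refine (H0 β h0 hβ2 x).trans (ENNReal.ofReal_le_ofReal ?_)
      linarith [le_max_left K₀ K₁]
    | succ k ih =>
      intro x
      have h2 : 1 / (4 * (d : ℝ)) ≤ min (1 / (4 * d) + (k + 1 : ℕ) * δ) p :=
        le_min (by linarith [mul_nonneg (Nat.cast_nonneg (α := ℝ) (k + 1)) hδ.le]) hp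
      have h3 : 0 ≤ min (1 / (4 * d) + k * δ) p :=
        le_min (by positivity) hp0.le
      have h4 : ∀ x, green d β (min (1 / (4 * d) + (k + 1 : ℕ) * δ) p) x * jb x ^ (d - 2) ≤
          ENNReal.ofReal (2 * K) := by
        intro x
        refine (HD _ _ h3 ?_ (min_le_right _ _) x).trans ?_
        · push_cast
          gcongr
          linarith
        · rw [two_mul, ENNReal.ofReal_add hK.le hK.le]
          refine add_le_add (ih x) (Hδ _ ?_)
          rw [sub_le_iff_le_add, ← min_add_add_left]
          refine min_le_min ?_ (by linarith)
          push_cast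
          linarith
      have h5 := (Hb β h0 hβ1 _ h4).1.trans (min_le_right _ _)
      refine (H1 β _ h0 hβ2 h2 ?_ h5 x).trans (ENNReal.ofReal_le_ofReal ?_)
      · exact ne_top_of_le_ne_top hχ (suscept_mono β ((min_le_right _ _).trans hpq.le))
      · linarith [le_max_right K₀ K₁]
  have hfin : ∀ x, green d β p x * jb x ^ (d - 2) ≤ ENNReal.ofReal K := by
    obtain ⟨k, hk⟩ := exists_nat_gt (p / δ)
    have h2 := hstep k
    rw [min_eq_right] at h2
    · exact h2
    · rw [div_lt_iff₀ hδ] at hk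
      have : 0 < 1 / (4 * (d : ℝ)) := by positivity
      linarith
  have h6 := Hb β h0 hβ1 p fun x => (hfin x).trans (ENNReal.ofReal_le_ofReal (by linarith))
  exact ⟨hfin, h6.1.trans (min_le_right _ _), h6.2.trans (min_le_left _ _)⟩

end Bootstrap

section Torus

variable {d : ℕ}

/-- The projection from the lattice to the torus. -/
def modHom (d r : ℕ) : (Fin d → ℤ) →+ (Fin d → ZMod r) where
  toFun x i := (x i : ZMod r)
  map_zero' := by
    funext i
    simp
  map_add' x y := by
    funext i
    simp

lemma modHom_eq_iff {r : ℕ} (x y : Fin d → ℤ) :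
    modHom d r y = modHom d r x ↔ ∀ i, ((y i - x i : ℤ) : ZMod r) = 0 := by
  rw [funext_iff]
  refine forall_congr' fun i => ?_
  rw [Int.cast_sub, sub_eq_zero]
  rfl

lemma le_norm_of_modHom_eq_zero {r : ℕ} (x : Fin d → ℤ) (h : modHom d r x = 0) (hx : x ≠ 0) :
    (r : ℝ) ≤ ‖x‖ := by
  obtain ⟨i, hi⟩ := Function.ne_iff.1 hx
  refine le_trans ?_ (norm_le_pi_norm x i)
  have h1 : ((x i : ℤ) : ZMod r) = 0 := congrFun h i
  rw [ZMod.intCast_zmod_eq_zero_iff_dvd] at h1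
  have h2 := Int.le_of_dvd (abs_pos.2 hi) ((dvd_abs _ _).2 h1)
  rw [Int.norm_eq_abs]
  exact_mod_cast h2

lemma modHom_surjective (d r : ℕ) : Function.Surjective (modHom d r) := fun x => by
  refine ⟨fun i => (x i).cast, funext fun i => ?_⟩
  exact ZMod.intCast_zmod_cast (x i)

lemma pushF_comp {α ι κ : Type*} (π : α → ι) (φ : ι → κ) (f : α → ℝ≥0∞) (x : κ) :
    pushF (fun a => φ (π a)) f x = pushF φ (pushF π f) x := by
  classical
  have := tsum_pushF π f (fun y => if φ y = x then 1 else 0)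
  simp only [mul_ite, mul_one, mul_zero] at this
  exact this.symm

/-- The part of the torus two-point function from long walks. -/
lemma exists_pushF_longInd_le (hd : 5 ≤ d) : ∃ C : ℝ, 0 ≤ C ∧ ∀ β p : ℝ, 0 ≤ β → β ≤ 1 →
    1 / (4 * d) ≤ p → suscept d β p ≠ ⊤ → momSum d β p ≤ ENNReal.ofReal (1 / (8 * d ^ 3)) →
    ∀ (r : ℕ) (T : ℝ) (x), 0 < T → 1 ≤ r → T ≤ 4 * r →
      pushF (fun γ => modHom d r (disp (wsawStep d) γ))
        (fun γ => longInd (wsawStep d) T γ * wt (wsawStep d) β (ENNReal.ofReal p) γ) x ≤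
        ENNReal.ofReal (C * ((T ^ (d - 2))⁻¹ + (suscept d β p).toReal / r ^ d)) := by
  have hd' : (5 : ℝ) ≤ d := by exact_mod_cast hd
  obtain ⟨C, hC, H⟩ := GreenPair.exists_tsum_far_le hd (M := 2 * 2 ^ d + 1) (c := 1 / (16 * d))
    (by positivity) (by positivity)
  refine ⟨C, hC, fun β p h0 h1 hp hχ hm r T x hT hr hTr => ?_⟩
  have hp0 : 0 ≤ p := le_trans (by positivity) hp
  have h := H _ _ (greenPair hd h0 h1 hp hχ hm) r T
  rw [tsum_greenR h0 h1 hp0 hχ] at h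
  obtain ⟨x, rfl⟩ := modHom_surjective d r x
  refine le_trans (le_of_eq ?_) (h x hT hr hTr)
  have h2 : ∀ y : Fin d → ℤ, pushF (disp (wsawStep d)) (fun γ => longInd (wsawStep d) T γ *
      wt (wsawStep d) β (ENNReal.ofReal p) γ) y = if T ≤ ‖y‖ then green d β p y else 0 := by
    intro y
    have := pushF_mul (disp (wsawStep d)) (wt (wsawStep d) β (ENNReal.ofReal p))
      (fun y => if T ≤ ‖y‖ then 1 else 0) y
    unfold longInd
    simp_rw [mul_comm _ (wt _ _ _ _)]
    rw [this, green, mul_ite, mul_one, mul_zero]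
  rw [pushF_comp (disp (wsawStep d)) (modHom d r)]
  classical
  unfold pushF
  refine tsum_congr fun y => ?_
  have := h2 y
  unfold pushF at this
  rw [this, ofReal_greenR h0 h1 hp0 hχ]
  simp only [modHom_eq_iff]
  split_ifs <;> simp_all

lemma add_sq_le_two_mul_add_two_mul (a b : ℝ≥0∞) : (a + b) ^ 2 ≤ 2 * a ^ 2 + 2 * b ^ 2 := by
  wlog h : a ≤ b generalizing a b
  · rw [add_comm a b, add_comm (2 * a ^ 2)]
    exact this b a (le_of_not_ge h)
  obtain ⟨t, rfl⟩ := exists_add_of_le h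
  calc (a + (a + t)) ^ 2 ≤ (a + (a + t)) ^ 2 + t ^ 2 := le_self_add
    _ = _ := by ring

/-- Square summability on the torus: close walks are counted by the lattice two-point function. -/
lemma tsum_sq_torus_le {β p : ℝ} {r : ℕ} (hr : 1 ≤ r) {c : ℝ≥0∞}
    (hc : ∀ x, pushF (fun γ => modHom d r (disp (wsawStep d) γ))
      (fun γ => longInd (wsawStep d) (r / 4) γ * wt (wsawStep d) β (ENNReal.ofReal p) γ) x ≤ c) :
    ∑' x, pushF (fun γ => modHom d r (disp (wsawStep d) γ))
      (wt (wsawStep d) β (ENNReal.ofReal p)) x ^ 2 ≤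
      2 * ∑' y, green d β p y ^ 2 + 2 * (c * suscept d β p) := by
  classical
  have hr' : (1 : ℝ) ≤ r := by exact_mod_cast hr
  set far := pushF (fun γ => modHom d r (disp (wsawStep d) γ))
      (fun γ => longInd (wsawStep d) (r / 4) γ * wt (wsawStep d) β (ENNReal.ofReal p) γ) with hfar
  let g : (Fin d → ℤ) → ℝ≥0∞ := fun y => if ‖y‖ < r / 4 then green d β p y else 0
  set near := pushF (modHom d r) g with hnear
  have hsplit : ∀ x, pushF (fun γ => modHom d r (disp (wsawStep d) γ))
      (wt (wsawStep d) β (ENNReal.ofReal p)) x = near x + far x := by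
    intro x
    have h1 : near = pushF (fun γ => modHom d r (disp (wsawStep d) γ)) (fun γ =>
        wt (wsawStep d) β (ENNReal.ofReal p) γ *
          if ‖disp (wsawStep d) γ‖ < r / 4 then 1 else 0) := by
      funext x
      rw [pushF_comp (disp (wsawStep d)) (modHom d r), hnear]
      congr 1
      funext y
      rw [pushF_mul (disp (wsawStep d)) _ (fun y => if ‖y‖ < r / 4 then 1 else 0) y]
      simp only [g, green, mul_ite, mul_one, mul_zero]
    rw [h1, hfar]
    unfold pushF
    rw [← ENNReal.tsum_add]
    refine tsum_congr fun γ => ?_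
    unfold longInd
    by_cases h2 : ‖disp (wsawStep d) γ‖ < r / 4
    · simp [h2, not_le.2 h2]
    · simp [h2, not_lt.1 h2]
  have hn : ∑' x, near x ^ 2 ≤ ∑' y, green d β p y ^ 2 := by
    simp_rw [pow_two]
    rw [hnear, tsum_pushF (modHom d r) g]
    refine ENNReal.tsum_le_tsum fun y => ?_
    by_cases hy : ‖y‖ < r / 4
    · have h3 : pushF (modHom d r) g (modHom d r y) = g y := by
        unfold pushF
        rw [tsum_eq_single y, if_pos rfl]
        intro z hz
        split_ifs with h4
        · by_contra h5
          have h6 : ‖z‖ < r / 4 := by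
            by_contra h6
            exact h5 (if_neg h6)
          have h7 := le_norm_of_modHom_eq_zero (r := r) (z - y) (by rw [map_sub, h4, sub_self])
            (sub_ne_zero.2 hz)
          have h8 := norm_sub_le z y
          linarith
        · rfl
      rw [h3]
      simp [g, hy]
    · simp [g, hy]
  have hf : ∑' x, far x ^ 2 ≤ c * suscept d β p := by
    calc ∑' x, far x ^ 2 ≤ ∑' x, c * far x := by
          refine ENNReal.tsum_le_tsum fun x => ?_
          rw [pow_two]
          gcongr
          exact hc x
      _ = c * ∑' x, far x := ENNReal.tsum_mul_left
      _ ≤ _ := by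
          gcongr
          have h9 := tsum_pushF (fun γ => modHom d r (disp (wsawStep d) γ))
            (fun γ => longInd (wsawStep d) (r / 4) γ *
              wt (wsawStep d) β (ENNReal.ofReal p) γ) 1
          simp only [Pi.one_apply, mul_one] at h9
          rw [hfar, h9, suscept]
          refine ENNReal.tsum_le_tsum fun γ => mul_le_of_le_one_left zero_le ?_
          unfold longInd
          split_ifs <;> simp
  calc _ = ∑' x, (near x + far x) ^ 2 := tsum_congr fun x => by rw [hsplit]
    _ ≤ ∑' x, (2 * near x ^ 2 + 2 * far x ^ 2) := by
        refine ENNReal.tsum_le_tsum fun x => ?_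
        exact add_sq_le_two_mul_add_two_mul _ _
    _ = 2 * ∑' x, near x ^ 2 + 2 * ∑' x, far x ^ 2 := by
        rw [ENNReal.tsum_add, ENNReal.tsum_mul_left, ENNReal.tsum_mul_left]
    _ ≤ _ := by gcongr

end Torus

section Compare

variable {d : ℕ}

lemma sq_le_sqrt_pow (hd : 4 ≤ d) {r : ℝ} (hr : 1 ≤ r) : r ^ 2 ≤ Real.sqrt (r ^ d) := by
  apply Real.le_sqrt_of_sq_le
  rw [← pow_mul]
  exact pow_le_pow_right₀ hr hd

/-- The irreducible weight of a walk on the torus. -/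
noncomputable def torJ (d r : ℕ) (β : ℝ) (ω : List (Fin d × Bool)) : ℝ :=
  irrInt (wsawStep d) (contactW (modHom d r) β) ω

/-- Comparison of the irreducible weights on the torus and on the lattice. -/
theorem exists_torJ_sub_latJ_le (hd : 5 ≤ d) {K B : ℝ} (hB : 0 ≤ B) :
    ∃ C β₂ : ℝ, 0 ≤ C ∧ 0 < β₂ ∧ β₂ ≤ 1 / 2 ∧ ∀ β p : ℝ, 0 ≤ β → β ≤ β₂ → 1 / (4 * d) ≤ p →
      suscept d β p ≠ ⊤ → momSum d β p ≤ ENNReal.ofReal (1 / (8 * d ^ 3)) →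
      (∀ x, green d β p x * jb x ^ (d - 2) ≤ ENNReal.ofReal K) → ∀ r : ℕ, 1 ≤ r →
      (suscept d β p).toReal ≤ B * Real.sqrt ((r : ℝ) ^ d) →
      ∑' ω, ENNReal.ofReal |torJ d r β ω - latJ d β ω| * ENNReal.ofReal p ^ ω.length ≤
        ENNReal.ofReal (C * β * (((r : ℝ) ^ 2 + (suscept d β p).toReal) / r ^ d)) := by
  obtain ⟨S, hS, -, HS⟩ := exists_sqSumLE_of_decay hd
  obtain ⟨C₁, hC₁, H1⟩ := exists_pushF_longInd_le hd
  set A := ENNReal.ofReal K with hA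
  have hAt : A ≠ ⊤ := ENNReal.ofReal_ne_top
  let b : ℝ≥0∞ := 1 + (2 * (A * S) ^ 2 + 2 * ENNReal.ofReal (C₁ * (4 ^ (d - 2) * B + B ^ 2)))
  have hb : b ≠ ⊤ := by
    have := ENNReal.mul_ne_top hAt hS
    simp only [b]
    finiteness
  have hb1 : 1 ≤ b := le_self_add
  obtain ⟨b2, hb2, H2⟩ := exists_ofReal_mul_le (X := 64 * 3 ^ (d - 2) * (b ^ 2) ^ 2)
    (ε := 1 / 2) (by finiteness) (by simp)
  refine ⟨64 * C₁ * b.toReal ^ 2, min b2 (1 / 2), by positivity, by positivity, min_le_right _ _,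
    fun β p h0 hβ hp hχ hm hdec r hr hχr => ?_⟩
  have hβ1 : β ≤ 1 / 2 := hβ.trans (min_le_right _ _)
  have hr' : (1 : ℝ) ≤ r := by exact_mod_cast hr
  have hp0 : 0 ≤ p := le_trans (by positivity) hp
  set χ := (suscept d β p).toReal with hχd
  have hχ0 : 0 ≤ χ := ENNReal.toReal_nonneg
  have hχe : suscept d β p = ENNReal.ofReal χ := (ENNReal.ofReal_toReal hχ).symm
  set s := Real.sqrt ((r : ℝ) ^ d) with hsd
  have hss : (r : ℝ) ^ d = s * s := (Real.mul_self_sqrt (by positivity)).symm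
  have hs2 : (r : ℝ) ^ 2 ≤ s := sq_le_sqrt_pow (by omega) hr'
  have hs0 : 0 < s := lt_of_lt_of_le (by positivity) hs2
  have hrd : ((r : ℝ) ^ (d - 2))⁻¹ = r ^ 2 / r ^ d := by
    rw [eq_div_iff (by positivity), inv_mul_eq_iff_eq_mul₀ (by positivity), ← pow_add]
    congr 1
    omega
  have hlong := fun T x => H1 β p h0 (by linarith) hp hχ hm r T x
  have hfar : ∀ x, pushF (fun γ => modHom d r (disp (wsawStep d) γ))
      (fun γ => longInd (wsawStep d) (r / 4) γ * wt (wsawStep d) β (ENNReal.ofReal p) γ) x ≤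
      ENNReal.ofReal (C₁ * (4 ^ (d - 2) * (r ^ 2 / r ^ d) + χ / r ^ d)) := fun x => by
    have := hlong (r / 4) x (by positivity) hr (by linarith)
    rwa [div_pow, inv_div, div_eq_mul_inv (4 ^ (d - 2)), hrd] at this
  have hf : SqSumLE (pushF (fun γ => modHom d r (disp (wsawStep d) γ))
      (wt (wsawStep d) β (ENNReal.ofReal p))) b := by
    refine (tsum_sq_torus_le hr hfar).trans ?_
    refine le_trans ?_ (le_self_pow hb1 (by norm_num : 2 ≠ 0))
    refine le_trans ?_ le_add_self
    have hsq : ∑' y, green d β p y ^ 2 ≤ (A * S) ^ 2 := sqSumLE_green_of_decay (HS _ _ hdec)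
    gcongr
    rw [hχe, ← ENNReal.ofReal_mul (by positivity)]
    apply ENNReal.ofReal_le_ofReal
    rw [mul_assoc]
    gcongr
    rw [add_mul, hss]
    have h1 : r ^ 2 / (s * s) * χ ≤ B := by
      rw [div_mul_eq_mul_div, div_le_iff₀ (by positivity)]
      calc (r : ℝ) ^ 2 * χ ≤ s * (B * s) := by gcongr
        _ = _ := by ring
    have h2 : χ / (s * s) * χ ≤ B ^ 2 := by
      rw [div_mul_eq_mul_div, div_le_iff₀ (by positivity)]
      calc χ * χ ≤ (B * s) * (B * s) := by gcongr
        _ = _ := by ring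
    rw [mul_assoc]
    gcongr
  have hc : ∀ (N : ℕ) (x), pushF (fun γ => modHom d r (disp (wsawStep d) γ))
      (fun γ => longInd (wsawStep d) (r / (2 * N + 1)) γ *
        wt (wsawStep d) β (ENNReal.ofReal p) γ) x ≤
      ENNReal.ofReal (C₁ * ((r ^ 2 + χ) / r ^ d)) * (3 ^ (d - 2)) ^ N := by
    intro N x
    have h1 : (r : ℝ) / (2 * N + 1) ≤ 4 * r := by
      rw [div_le_iff₀ (by positivity)]
      nlinarith [mul_nonneg (Nat.cast_nonneg (α := ℝ) N) (zero_le_one.trans hr')]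
    refine (hlong (r / (2 * N + 1)) x (by positivity) hr h1).trans ?_
    have h3 : ((3 : ℝ≥0∞) ^ (d - 2)) ^ N = ENNReal.ofReal ((3 ^ (d - 2)) ^ N) := by
      rw [ENNReal.ofReal_pow (by positivity), ENNReal.ofReal_pow (by positivity)]
      simp
    rw [h3, ← ENNReal.ofReal_mul (by positivity)]
    apply ENNReal.ofReal_le_ofReal
    rw [mul_assoc, div_pow, inv_div, div_eq_mul_inv (_ ^ (d - 2)), hrd, add_div, add_mul]
    have h4 : 2 * (N : ℝ) + 1 ≤ 3 ^ N := by
      have := one_add_mul_le_pow (a := (2 : ℝ)) (by norm_num) N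
      norm_num at this
      linarith
    have h5 : (1 : ℝ) ≤ (3 ^ (d - 2)) ^ N := one_le_pow₀ (one_le_pow₀ (by norm_num))
    gcongr ?_ * (?_ + ?_)
    · rw [mul_comm, ← pow_mul, mul_comm (d - 2) N, pow_mul]
      gcongr
    · exact le_mul_of_one_le_right (by positivity) h5
  have h := irrInt_sub_sum_le (st := wsawStep d) (q := ENNReal.ofReal p) (modHom d r) h0 hβ1
    (R := r) (by linarith) (fun x => le_norm_of_modHom_eq_zero x) hb1 hf hc
    (H2 β (hβ.trans (min_le_left _ _)))
  refine h.trans (le_of_eq ?_)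
  rw [← ENNReal.ofReal_toReal hb, ← ENNReal.ofReal_pow ENNReal.toReal_nonneg,
    ← ENNReal.ofReal_mul (by positivity), show (64 : ℝ≥0∞) = ENNReal.ofReal 64 by simp,
    ← ENNReal.ofReal_mul (by positivity), ← ENNReal.ofReal_mul (by positivity)]
  congr 1
  rw [ENNReal.toReal_ofReal ENNReal.toReal_nonneg]
  ring

end Compare

section Weights

lemma prod_pairs (F : ℕ → ℕ → ℝ) (n : ℕ) :
    ∏ p ∈ (Finset.range (n + 1) ×ˢ Finset.range (n + 1)).filter (fun p => p.1 < p.2), F p.1 p.2 =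
      ∏ j ∈ Finset.range (n + 1), ∏ i ∈ Finset.range j, F i j := by
  rw [Finset.prod_filter, Finset.prod_product_right]
  refine Finset.prod_congr rfl fun j hj => ?_
  rw [← Finset.prod_filter]
  refine Finset.prod_congr ?_ fun _ _ => rfl
  ext i
  simp only [Finset.mem_filter, Finset.mem_range] at *
  omega

lemma prod_pairs_succ (F : ℕ → ℕ → ℝ) (n : ℕ) :
    ∏ j ∈ Finset.range (n + 1 + 1), ∏ i ∈ Finset.range j, F i j =
      (∏ k ∈ Finset.range (n + 1), F 0 (k + 1)) *
        ∏ j ∈ Finset.range (n + 1), ∏ i ∈ Finset.range j, F (i + 1) (j + 1) := by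
  rw [Finset.prod_range_succ', Finset.range_zero, Finset.prod_empty, mul_one,
    ← Finset.prod_mul_distrib]
  refine Finset.prod_congr rfl fun j _ => ?_
  rw [Finset.prod_range_succ', mul_comm]

variable {σ M : Type*} [AddCommGroup M] {st : σ → M} {w : M → ℝ}

lemma crossInt_singleton_eq_prod (e : σ) (c : M) (C : List σ) :
    crossInt st w [e] c C =
      ∏ k ∈ Finset.range C.length, (1 - w (st e + (c + disp st (C.take (k + 1))))) := by
  induction C generalizing c with
  | nil => simp [crossInt]
  | cons f C ih =>
    rw [crossInt, ih, List.length_cons, Finset.prod_range_succ', mul_comm]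
    simp [pointInt, add_assoc]

/-- The weight of a walk is a product over all pairs of times. -/
lemma walkInt_eq_prod (hw : ∀ e, w (st e) = 0) (ω : List σ) :
    walkInt st w ω = ∏ j ∈ Finset.range (ω.length + 1), ∏ i ∈ Finset.range j,
      (1 - w (disp st (ω.take j) - disp st (ω.take i))) := by
  induction ω with
  | nil => simp [walkInt]
  | cons e ω ih =>
    rw [walkInt, ih, List.length_cons,
      prod_pairs_succ fun i j => 1 - w (disp st ((e :: ω).take j) - disp st ((e :: ω).take i)),
      crossInt_singleton_eq_prod]
    congr 1
    · rw [Finset.prod_range_succ']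
      simp [hw]
    · simp

variable {d : ℕ}

lemma wsawPos_eq_disp {n : ℕ} (s : Fin n → Fin d × Bool) (k : ℕ) :
    wsawPos s k = disp (wsawStep d) ((List.ofFn s).take k) := by
  induction n generalizing k with
  | zero => simp [wsawPos]
  | succ n ih =>
    rcases k with _ | k
    · simp [wsawPos]
    · rw [List.ofFn_succ, List.take_succ_cons, disp_cons, ← ih]
      simp [wsawPos, Finset.sum_filter, Fin.sum_univ_succ]

/-- The weight of a walk on the torus. -/
noncomputable def torW (d r : ℕ) (β : ℝ) (ω : List (Fin d × Bool)) : ℝ :=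
  walkInt (wsawStep d) (contactW (modHom d r) β) ω

lemma contactW_wsawStep {A : Type*} [AddCommGroup A] {φ : (Fin d → ℤ) →+ A} {β : ℝ}
    (h : ∀ e : Fin d × Bool, φ (wsawStep d e) ≠ 0) (e : Fin d × Bool) :
    contactW φ β (wsawStep d e) = 0 := if_neg (h e)

lemma modHom_wsawStep_ne_zero {r : ℕ} (hr : 3 ≤ r) (e : Fin d × Bool) :
    modHom d r (wsawStep d e) ≠ 0 := fun h => by
  have h1 := le_norm_of_modHom_eq_zero _ h (wsawStep_ne_zero e)
  rw [norm_wsawStep] at h1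
  have : r ≤ 1 := by exact_mod_cast h1
  omega

lemma latW_ofFn {n : ℕ} (β : ℝ) (s : Fin n → Fin d × Bool) :
    latW d β (List.ofFn s) = wsawWeight β n s := by
  rw [latW, walkInt_eq_prod (contactW_wsawStep fun e => wsawStep_ne_zero e), wsawWeight,
    prod_pairs fun i j => 1 + β * (if wsawPos s i = wsawPos s j then (-1 : ℝ) else 0),
    List.length_ofFn]
  refine Finset.prod_congr rfl fun j _ => Finset.prod_congr rfl fun i _ => ?_
  rw [← wsawPos_eq_disp, ← wsawPos_eq_disp]
  simp only [contactW, AddMonoidHom.id_apply, sub_eq_zero]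
  by_cases h : wsawPos s i = wsawPos s j
  · simp [h, sub_eq_add_neg]
  · simp [h, Ne.symm h]

lemma torW_ofFn {r n : ℕ} (hr : 3 ≤ r) (β : ℝ) (s : Fin n → Fin d × Bool) :
    torW d r β (List.ofFn s) = wsawWeightT r β n s := by
  rw [torW, walkInt_eq_prod (contactW_wsawStep fun e => modHom_wsawStep_ne_zero hr e), wsawWeightT,
    prod_pairs fun i j => 1 + β * (if wsawPosT r s i = wsawPosT r s j then (-1 : ℝ) else 0),
    List.length_ofFn]
  refine Finset.prod_congr rfl fun j _ => Finset.prod_congr rfl fun i _ => ?_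
  have hT : ∀ k, modHom d r (wsawPos s k) = wsawPosT r s k := fun k => rfl
  rw [← wsawPos_eq_disp, ← wsawPos_eq_disp]
  simp only [contactW, map_sub, sub_eq_zero, hT]
  by_cases h : wsawPosT r s i = wsawPosT r s j
  · simp [h, sub_eq_add_neg]
  · simp [h, Ne.symm h]

lemma torW_mem {r : ℕ} {β : ℝ} (h0 : 0 ≤ β) (h1 : β ≤ 1) (ω : List (Fin d × Bool)) :
    0 ≤ torW d r β ω ∧ torW d r β ω ≤ 1 :=
  walkInt_mem _ (contactW_mem _ h0 h1) ω

lemma torW_le_latW {r : ℕ} {β : ℝ} (h0 : 0 ≤ β) (h1 : β ≤ 1) (ω : List (Fin d × Bool)) :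
    torW d r β ω ≤ latW d β ω := by
  have := ofReal_walkInt_le (st := wsawStep d) (modHom d r) h0 h1 ω
  exact (ENNReal.ofReal_le_ofReal_iff (latW_mem h0 h1 ω).1).1 this

lemma cZ_eq (β : ℝ) (n : ℕ) : cZ d β n = ∑ s : Fin n → Fin d × Bool, latW d β (List.ofFn s) :=
  Finset.sum_congr rfl fun s _ => (latW_ofFn β s).symm

lemma cT_eq {r : ℕ} (hr : 3 ≤ r) (β : ℝ) (n : ℕ) :
    cT d r β n = ∑ s : Fin n → Fin d × Bool, torW d r β (List.ofFn s) :=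
  Finset.sum_congr rfl fun s _ => (torW_ofFn hr β s).symm

lemma suscept_eq_tsum {β : ℝ} (h0 : 0 ≤ β) (h1 : β ≤ 1) (p : ℝ) :
    suscept d β p = ∑' n : ℕ, ENNReal.ofReal (cZ d β n) * ENNReal.ofReal p ^ n := by
  rw [suscept, tsum_list]
  refine tsum_congr fun n => ?_
  rw [cZ_eq, ENNReal.ofReal_sum_of_nonneg fun s _ => (latW_mem h0 h1 _).1, Finset.sum_mul]
  refine Finset.sum_congr rfl fun s _ => ?_
  simp [wt, latW]

/-- Sums over walks of a function with geometric dependence on the length. -/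
lemma hasSum_ofFn {E : Type*} [NormedAddCommGroup E] [CompleteSpace E]
    {F : List (Fin d × Bool) → E} (hF : Summable F) :
    HasSum (fun n => ∑ s : Fin n → Fin d × Bool, F (List.ofFn s)) (∑' ω, F ω) := by
  have h := ((List.equivSigmaTuple (α := Fin d × Bool)).symm.hasSum_iff.2 hF.hasSum)
  refine h.sigma fun n => ?_
  exact hasSum_fintype _

end Weights

section Critical

variable {d : ℕ} {β μ : ℝ}

lemma disp_replicate {σ M : Type*} [AddCommGroup M] (st : σ → M) (e : σ) (n : ℕ) :
    disp st (List.replicate n e) = n • st e := by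
  simp [disp]

lemma latW_replicate (e : Fin d × Bool) (n : ℕ) : latW d β (List.replicate n e) = 1 := by
  rw [latW, walkInt_eq_prod (contactW_wsawStep fun e => wsawStep_ne_zero e)]
  refine Finset.prod_eq_one fun j hj => Finset.prod_eq_one fun i hi => ?_
  simp only [Finset.mem_range, List.length_replicate] at hi hj
  rw [List.take_replicate, List.take_replicate, min_eq_left (by omega), min_eq_left (by omega),
    disp_replicate, disp_replicate, ← natCast_zsmul, ← natCast_zsmul, ← sub_smul, contactW,
    if_neg, sub_zero]
  rw [AddMonoidHom.id_apply, smul_eq_zero, not_or]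
  exact ⟨by omega, wsawStep_ne_zero e⟩

lemma one_le_cZ (hd : 1 ≤ d) (h0 : 0 ≤ β) (h1 : β ≤ 1) (n : ℕ) : 1 ≤ cZ d β n := by
  rw [cZ_eq]
  let e : Fin d × Bool := (⟨0, hd⟩, true)
  calc (1 : ℝ) = latW d β (List.ofFn fun _ : Fin n => e) := by
        rw [List.ofFn_const, latW_replicate]
    _ ≤ _ := Finset.single_le_sum (f := fun s : Fin n → Fin d × Bool => latW d β (List.ofFn s))
        (fun s _ => (latW_mem h0 h1 _).1) (Finset.mem_univ _)

lemma cZ_le (h0 : 0 ≤ β) (h1 : β ≤ 1) (n : ℕ) : cZ d β n ≤ (2 * d) ^ n := by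
  rw [cZ_eq]
  refine (Finset.sum_le_sum fun s _ => (latW_mem h0 h1 (List.ofFn s)).2).trans (le_of_eq ?_)
  simp [mul_comm]

lemma cZ_add_le (h0 : 0 ≤ β) (h1 : β ≤ 1) (m n : ℕ) :
    cZ d β (m + n) ≤ cZ d β m * cZ d β n := by
  simp_rw [cZ_eq]
  rw [Finset.sum_mul_sum, ← Finset.sum_product', Finset.univ_product_univ,
    ← (Fin.appendEquiv m n).sum_comp]
  refine Finset.sum_le_sum fun s _ => ?_
  have : List.ofFn (Fin.appendEquiv m n s) = List.ofFn s.1 ++ List.ofFn s.2 :=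
    List.ofFn_fin_append _ _
  rw [this]
  exact walkInt_append_le _ (contactW_mem _ h0 h1) _ _

lemma cZ_zero : cZ d β 0 = 1 := by
  simp [cZ_eq, latW, walkInt]

lemma cZ_mul_le (h0 : 0 ≤ β) (h1 : β ≤ 1) (hd : 1 ≤ d) (n m : ℕ) :
    cZ d β (n * m) ≤ cZ d β n ^ m := by
  induction m with
  | zero => simp [cZ_zero]
  | succ m ih =>
    rw [Nat.mul_succ, pow_succ]
    refine (cZ_add_le h0 h1 _ _).trans ?_
    have := one_le_cZ hd h0 h1 n
    gcongr

lemma one_le_growth (hd : 1 ≤ d) (h0 : 0 ≤ β) (h1 : β ≤ 1) (hμ : HasGrowthConst d β μ) :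
    1 ≤ μ :=
  ge_of_tendsto hμ (Filter.Eventually.of_forall fun n =>
    Real.one_le_rpow (one_le_cZ hd h0 h1 n) (by positivity))

lemma growth_le (hd : 1 ≤ d) (h0 : 0 ≤ β) (h1 : β ≤ 1) (hμ : HasGrowthConst d β μ) :
    μ ≤ 2 * d := by
  refine le_of_tendsto hμ ?_
  filter_upwards [Filter.eventually_gt_atTop 0] with n hn
  have := one_le_cZ hd h0 h1 n
  refine (Real.rpow_le_rpow (by linarith) (cZ_le h0 h1 n) (by positivity)).trans (le_of_eq ?_)
  rw [Real.pow_rpow_inv_natCast (by positivity) hn.ne']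

lemma pow_le_cZ (hd : 1 ≤ d) (h0 : 0 ≤ β) (h1 : β ≤ 1) (hμ : HasGrowthConst d β μ) (n : ℕ) :
    μ ^ n ≤ cZ d β n := by
  rcases Nat.eq_zero_or_pos n with rfl | hn
  · simp [cZ_zero]
  have hc := one_le_cZ hd h0 h1 n
  have hlim : Filter.Tendsto (fun m : ℕ => (cZ d β (n * m)) ^ (((n * m : ℕ) : ℝ)⁻¹))
      Filter.atTop (nhds μ) :=
    hμ.comp (Filter.tendsto_id.const_mul_atTop' hn)
  have hle : μ ≤ cZ d β n ^ ((n : ℝ)⁻¹) := by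
    refine le_of_tendsto hlim ?_
    filter_upwards [Filter.eventually_gt_atTop 0] with m hm
    have := one_le_cZ hd h0 h1 (n * m)
    refine (Real.rpow_le_rpow (by linarith) (cZ_mul_le h0 h1 hd n m) (by positivity)).trans
      (le_of_eq ?_)
    rw [← Real.rpow_natCast, ← Real.rpow_mul (by linarith)]
    congr 1
    push_cast
    field_simp
  have hμ0 := one_le_growth hd h0 h1 hμ
  calc μ ^ n ≤ (cZ d β n ^ ((n : ℝ)⁻¹)) ^ n := by gcongr
    _ = _ := Real.rpow_inv_natCast_pow (by linarith) hn.ne'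

lemma summable_cZ_mul_pow (hd : 1 ≤ d) (h0 : 0 ≤ β) (h1 : β ≤ 1) (hμ : HasGrowthConst d β μ)
    {p : ℝ} (hp : 0 ≤ p) (hpμ : p < μ⁻¹) : Summable fun n => cZ d β n * p ^ n := by
  have hμ0 := one_le_growth hd h0 h1 hμ
  obtain ⟨q, hpq, hqμ⟩ := exists_between hpμ
  have hq : 0 < q := hp.trans_lt hpq
  have hlt : μ < q⁻¹ := by rwa [lt_inv_comm₀ (by linarith) hq]
  have hr : p / q < 1 := (div_lt_one hq).2 hpq
  refine Summable.of_norm_bounded_eventually_nat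
    (summable_geometric_of_lt_one (by positivity) hr) ?_
  filter_upwards [hμ.eventually (Iio_mem_nhds hlt), Filter.eventually_gt_atTop 0] with n hn hn0
  have hc := one_le_cZ hd h0 h1 n
  have h2 : cZ d β n ≤ (q⁻¹) ^ n := by
    calc cZ d β n = (cZ d β n ^ ((n : ℝ)⁻¹)) ^ n :=
          (Real.rpow_inv_natCast_pow (by linarith) hn0.ne').symm
      _ ≤ _ := by gcongr
  rw [Real.norm_of_nonneg (by positivity), div_eq_mul_inv, mul_pow, mul_comm]
  gcongr

lemma suscept_eq_ofReal (hd : 1 ≤ d) (h0 : 0 ≤ β) (h1 : β ≤ 1) (hμ : HasGrowthConst d β μ)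
    {p : ℝ} (hp : 0 ≤ p) (hpμ : p < μ⁻¹) : suscept d β p = ENNReal.ofReal (chiR d β p) := by
  have hc := one_le_cZ hd h0 h1
  rw [suscept_eq_tsum h0 h1, chiR, ENNReal.ofReal_tsum_of_nonneg
    (fun n => mul_nonneg (zero_le_one.trans (hc n)) (pow_nonneg hp n))
    (summable_cZ_mul_pow hd h0 h1 hμ hp hpμ)]
  refine tsum_congr fun n => ?_
  rw [ENNReal.ofReal_mul (zero_le_one.trans (hc n)), ENNReal.ofReal_pow hp]

lemma inv_le_chiR (hd : 1 ≤ d) (h0 : 0 ≤ β) (h1 : β ≤ 1) (hμ : HasGrowthConst d β μ)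
    {p : ℝ} (hp : 0 ≤ p) (hpμ : p < μ⁻¹) : (1 - p * μ)⁻¹ ≤ chiR d β p := by
  have hμ0 := one_le_growth hd h0 h1 hμ
  have hlt : p * μ < 1 := by
    calc p * μ < μ⁻¹ * μ := mul_lt_mul_of_pos_right hpμ (by linarith)
      _ = 1 := inv_mul_cancel₀ (by linarith)
  rw [← tsum_geometric_of_lt_one (by positivity) hlt]
  refine (summable_geometric_of_lt_one (by positivity) hlt).tsum_le_tsum (fun n => ?_)
    (summable_cZ_mul_pow hd h0 h1 hμ hp hpμ)
  rw [mul_pow, mul_comm]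
  have := pow_le_cZ hd h0 h1 hμ n
  gcongr

/-- The reciprocal of the susceptibility decreases at a linear rate. -/
lemma mul_sub_le_tsum_latJ {p q : ℝ} (hd : 1 ≤ d) (hp : 0 ≤ p) (hpq : p ≤ q)
    (hq : 1 / (4 * d) ≤ q)
    (hjp : Summable fun ω : List (Fin d × Bool) => latJ d β ω * p ^ ω.length)
    (hjq : Summable fun ω : List (Fin d × Bool) => latJ d β ω * q ^ ω.length)
    (hl : ∑' ω : List (Fin d × Bool), (if 2 ≤ ω.length then ENNReal.ofReal |latJ d β ω| *
        ENNReal.ofReal q ^ ω.length * ω.length else 0) ≤ ENNReal.ofReal (1 / 4)) :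
    d * (q - p) ≤ ∑' ω : List (Fin d × Bool), latJ d β ω * q ^ ω.length -
      ∑' ω : List (Fin d × Bool), latJ d β ω * p ^ ω.length := by
  have hd' : (1 : ℝ) ≤ d := by exact_mod_cast hd
  have hq0 : 0 < q := lt_of_lt_of_le (by positivity) hq
  have ht0 : 0 ≤ p / q := by positivity
  have ht1 : p / q ≤ 1 := (div_le_one hq0).2 hpq
  have h := le_tsum_latJ_mul (β := β) hq0.le (fun ω : List (Fin d × Bool) => 1 - (p / q) ^ ω.length)
    (ε := (1 - p / q) * (1 / 4)) (by nlinarith) (by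
      rw [ENNReal.ofReal_mul (by linarith)]
      refine le_trans ?_ (mul_le_mul' le_rfl hl)
      rw [← ENNReal.tsum_mul_left]
      refine ENNReal.tsum_le_tsum fun ω => ?_
      split_ifs
      · rw [mul_comm, mul_left_comm (ENNReal.ofReal (1 - p / q)),
          mul_comm (ENNReal.ofReal |1 - _|)]
        gcongr
        rw [← ENNReal.ofReal_natCast, ← ENNReal.ofReal_mul (by linarith)]
        apply ENNReal.ofReal_le_ofReal
        rw [abs_of_nonneg (by linarith [pow_le_one₀ (n := ω.length) ht0 ht1])]
        have := one_add_mul_le_pow (a := p / q - 1) (by linarith) ω.length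
        rw [add_sub_cancel] at this
        linarith
      · simp)
  have h2 : ∑' ω : List (Fin d × Bool), latJ d β ω * q ^ ω.length * (1 - (p / q) ^ ω.length) =
      ∑' ω : List (Fin d × Bool), latJ d β ω * q ^ ω.length -
      ∑' ω : List (Fin d × Bool), latJ d β ω * p ^ ω.length := by
    rw [← hjq.tsum_sub hjp]
    refine tsum_congr fun ω => ?_
    rw [div_pow]
    have : q ^ ω.length ≠ 0 := by positivity
    field_simp
  rw [← h2]
  refine le_trans ?_ h
  have h3 : q * (1 - p / q) = q - p := by field_simp
  have h4 : (1 - p / q) = (q - p) / q := by field_simp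
  simp only [List.length_cons, List.length_nil, zero_add, pow_one, Finset.sum_const,
    Finset.card_univ, Fintype.card_prod, Fintype.card_fin, Fintype.card_bool, nsmul_eq_mul,
    Nat.cast_mul, Nat.cast_ofNat]
  have h5 : (1 - p / q) * (1 / 4) ≤ d * (q - p) := by
    rw [h4, div_mul_eq_mul_div, div_le_iff₀ hq0]
    rw [div_le_iff₀ (by positivity)] at hq
    nlinarith [mul_le_mul_of_nonneg_left hq (sub_nonneg.2 hpq)]
  calc d * (q - p) ≤ d * 2 * (q - p) - (1 - p / q) * (1 / 4) := by linarith
    _ = _ := by rw [← h3]; ring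

end Critical

section Final

variable {d : ℕ} {β μ : ℝ}

lemma norm_mul_pow_le {σ : Type*} (D : List σ → ℝ) {p : ℝ} {w : ℂ} (hw : ‖w‖ ≤ p) (ω : List σ) :
    ‖(D ω : ℂ) * w ^ ω.length‖ ≤ |D ω| * p ^ ω.length := by
  rw [norm_mul, Complex.norm_real, Real.norm_eq_abs, norm_pow]
  gcongr

/-- Cauchy's estimate for a power series indexed by walks. -/
lemma norm_deriv_tsum_le {σ : Type*} (D : List σ → ℝ) {p A : ℝ} (hA : 0 ≤ A)
    (hD : ∑' ω, ENNReal.ofReal |D ω| * ENNReal.ofReal p ^ ω.length ≤ ENNReal.ofReal A) {z : ℂ}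
    (hz : ‖z‖ < p) :
    ‖deriv (fun w : ℂ => ∑' ω, (D ω : ℂ) * w ^ ω.length) z‖ ≤ A / (p - ‖z‖) := by
  have hp : 0 ≤ p := (norm_nonneg z).trans hz.le
  have hE : ∑' ω, ENNReal.ofReal (|D ω| * p ^ ω.length) ≤ ENNReal.ofReal A := by
    refine le_trans (le_of_eq (tsum_congr fun ω => ?_)) hD
    rw [ENNReal.ofReal_mul (abs_nonneg _), ENNReal.ofReal_pow hp]
  have hnn : ∀ ω, 0 ≤ |D ω| * p ^ ω.length := fun ω => by positivity
  have hu : Summable fun ω => |D ω| * p ^ ω.length :=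
    summable_of_tsum_ofReal_ne_top (by
      simp_rw [abs_of_nonneg (hnn _)]
      exact ne_top_of_le_ne_top ENNReal.ofReal_ne_top hE)
  have hA' : ∑' ω, |D ω| * p ^ ω.length ≤ A := by
    rw [← ENNReal.ofReal_tsum_of_nonneg hnn hu] at hE
    exact (ENNReal.ofReal_le_ofReal_iff hA).1 hE
  have hmem : ∀ w ∈ Metric.closedBall z (p - ‖z‖), ‖w‖ ≤ p := fun w hw => by
    rw [mem_closedBall_iff_norm] at hw
    linarith [norm_le_norm_add_norm_sub' w z]
  have hcl : closure (Metric.ball z (p - ‖z‖)) ⊆ Metric.closedBall z (p - ‖z‖) :=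
    Metric.closure_ball_subset_closedBall
  refine Complex.norm_deriv_le_of_forall_mem_sphere_norm_le (sub_pos.2 hz) ⟨?_, ?_⟩ fun w hw => ?_
  · exact Complex.differentiableOn_tsum_of_summable_norm hu
      (fun ω => (differentiable_id.pow _).const_mul _ |>.differentiableOn) Metric.isOpen_ball
      fun ω w hw => norm_mul_pow_le D (hmem w (Metric.ball_subset_closedBall hw)) ω
  · exact continuousOn_tsum (fun ω => by fun_prop) hu
      fun ω w hw => norm_mul_pow_le D (hmem w (hcl hw)) ω
  · exact (tsum_of_norm_bounded hu.hasSum fun ω =>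
      norm_mul_pow_le D (hmem w (Metric.sphere_subset_closedBall hw)) ω).trans hA'

lemma chi_eq_tsum {w : ℂ} (hs : Summable fun ω : List (Fin d × Bool) =>
    (latW d β ω : ℂ) * w ^ ω.length) :
    chi d β w = ∑' ω : List (Fin d × Bool), (latW d β ω : ℂ) * w ^ ω.length := by
  rw [chi, ← (hasSum_ofFn hs).tsum_eq]
  refine tsum_congr fun n => ?_
  simp [cZ_eq, Finset.sum_mul]

lemma chiT_eq_tsum {r : ℕ} (hr : 3 ≤ r) {w : ℂ} (hs : Summable fun ω : List (Fin d × Bool) =>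
    (torW d r β ω : ℂ) * w ^ ω.length) :
    chiT d r β w = ∑' ω : List (Fin d × Bool), (torW d r β ω : ℂ) * w ^ ω.length := by
  rw [chiT, ← (hasSum_ofFn hs).tsum_eq]
  refine tsum_congr fun n => ?_
  simp [cT_eq hr, Finset.sum_mul]

lemma chi_mul_one_sub (h0 : 0 ≤ β) (h1 : β ≤ 1) {p : ℝ} (hp : 0 ≤ p) (hχ : suscept d β p ≠ ⊤)
    (hj : Summable fun ω : List (Fin d × Bool) => latJ d β ω * p ^ ω.length) {w : ℂ}
    (hw : ‖w‖ ≤ p) :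
    chi d β w * (1 - ∑' ω : List (Fin d × Bool), (latJ d β ω : ℂ) * w ^ ω.length) = 1 := by
  rw [chi_eq_tsum (Summable.of_norm_bounded (summable_latW h0 h1 hp hχ) fun ω => ?_)]
  · refine latW_mul_one_sub_latJ h0 h1 hp hχ hj _ (by simp) (fun u v => by simp [pow_add])
      fun ω => ?_
    rw [norm_pow]
    gcongr
  · simpa only [abs_of_nonneg (latW_mem h0 h1 ω).1] using norm_mul_pow_le (latW d β) hw ω

lemma chiT_mul_one_sub {r : ℕ} (hr : 3 ≤ r) (h0 : 0 ≤ β) (h1 : β ≤ 1) {p : ℝ} (hp : 0 ≤ p)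
    (hχ : suscept d β p ≠ ⊤)
    (hj : Summable fun ω : List (Fin d × Bool) => torJ d r β ω * p ^ ω.length) {w : ℂ}
    (hw : ‖w‖ ≤ p) :
    chiT d r β w * (1 - ∑' ω : List (Fin d × Bool), (torJ d r β ω : ℂ) * w ^ ω.length) = 1 := by
  have hb : ∀ ω, ‖(torW d r β ω : ℂ) * w ^ ω.length‖ ≤ latW d β ω * p ^ ω.length := fun ω => by
    refine (norm_mul_pow_le (torW d r β) hw ω).trans ?_
    rw [abs_of_nonneg (torW_mem h0 h1 ω).1]
    exact mul_le_mul_of_nonneg_right (torW_le_latW h0 h1 ω) (pow_nonneg hp _)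
  have hs := summable_latW h0 h1 hp hχ
  rw [chiT_eq_tsum hr (Summable.of_norm_bounded hs hb)]
  refine tsum_mul_one_sub_tsum_eq_one (walkInt_renewal _ _) (by simp)
    (fun u v => by simp [pow_add]) ?_ ?_
  · exact Summable.of_nonneg_of_le (fun _ => norm_nonneg _) hb hs
  · refine Summable.of_nonneg_of_le (fun _ => norm_nonneg _) (fun ω => ?_) hj.abs
    rw [abs_mul, abs_of_nonneg (pow_nonneg hp _)]
    exact norm_mul_pow_le (torJ d r β) hw ω

lemma chiR_eq_tsum (h0 : 0 ≤ β) (h1 : β ≤ 1) (hd : 1 ≤ d) (hμ : HasGrowthConst d β μ) {p : ℝ}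
    (hp : 0 ≤ p) (hpμ : p < μ⁻¹) :
    chiR d β p = ∑' ω : List (Fin d × Bool), latW d β ω * p ^ ω.length := by
  have hχ := suscept_eq_ofReal hd h0 h1 hμ hp hpμ
  have hs : suscept d β p ≠ ⊤ := hχ ▸ ENNReal.ofReal_ne_top
  rw [chiR, ← (hasSum_ofFn (summable_latW h0 h1 hp hs)).tsum_eq]
  refine tsum_congr fun n => ?_
  simp [cZ_eq, Finset.sum_mul]

/-- The bootstrap conclusions hold throughout the subcritical phase, and the susceptibility
diverges at most linearly. -/
lemma exists_subcritical (hd : 5 ≤ d) : ∃ K β₁ : ℝ, 0 < β₁ ∧ β₁ ≤ 1 / 2 ∧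
    ∀ β μ : ℝ, 0 ≤ β → β ≤ β₁ → HasGrowthConst d β μ → ∀ p : ℝ, 1 / (4 * d) ≤ p → p < μ⁻¹ →
      (∀ x, green d β p x * jb x ^ (d - 2) ≤ ENNReal.ofReal K) ∧
      momSum d β p ≤ ENNReal.ofReal (1 / (8 * d ^ 3)) ∧ chiR d β p ≤ 2 / (1 - p * μ) := by
  obtain ⟨K, -, hK⟩ := exists_bootstrap hd
  obtain ⟨β₁, hβ₁, hβ₁', H⟩ := hK (ENNReal.ofReal (1 / 4)) (by simp)
  refine ⟨K, β₁, hβ₁, hβ₁', fun β μ h0 hβ hμ => ?_⟩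
  have h1 : β ≤ 1 := by linarith
  have hd1 : 1 ≤ d := by omega
  have hd' : (5 : ℝ) ≤ d := by exact_mod_cast hd
  have hμ1 := one_le_growth hd1 h0 h1 hμ
  have hμ2 := growth_le hd1 h0 h1 hμ
  have hpos : ∀ {p : ℝ}, 1 / (4 * d) ≤ p → 0 < p := fun h =>
    lt_of_lt_of_le (by positivity) h
  have hfin : ∀ {p : ℝ}, 1 / (4 * d) ≤ p → p < μ⁻¹ → suscept d β p ≠ ⊤ := fun hp hpμ => by
    rw [suscept_eq_ofReal hd1 h0 h1 hμ (hpos hp).le hpμ]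
    exact ENNReal.ofReal_ne_top
  have HH := fun {p : ℝ} (hp : 1 / (4 * d) ≤ p) (hpμ : p < μ⁻¹) =>
    have hq := (exists_between hpμ).choose_spec
    H β h0 hβ p _ hp hq.1 (hfin (hp.trans hq.1.le) hq.2)
  have hsum : ∀ {p : ℝ}, 1 / (4 * d) ≤ p → p < μ⁻¹ →
      Summable fun ω : List (Fin d × Bool) => latJ d β ω * p ^ ω.length := fun hp hpμ =>
    summable_latJ_of_momSum hd (hpos hp).le
      (ne_top_of_le_ne_top ENNReal.ofReal_ne_top (HH hp hpμ).2.1)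
  intro p hp hpμ
  refine ⟨(HH hp hpμ).1, (HH hp hpμ).2.1, ?_⟩
  have hlin : ∀ q ∈ Set.Ioo p μ⁻¹,
      d * (q - p) ≤ 1 - ∑' ω : List (Fin d × Bool), latJ d β ω * p ^ ω.length := fun q hq => by
    have hq' := hp.trans hq.1.le
    have h := mul_sub_le_tsum_latJ hd1 (hpos hp).le hq.1.le hq' (hsum hp hpμ) (hsum hq' hq.2)
      (HH hq' hq.2).2.2
    have := one_sub_tsum_latJ_pos h0 h1 (hpos hq').le (hfin hq' hq.2) (hsum hq' hq.2)
    linarith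
  have hlim : d * (μ⁻¹ - p) ≤ 1 - ∑' ω : List (Fin d × Bool), latJ d β ω * p ^ ω.length := by
    have ht : Filter.Tendsto (fun q : ℝ => d * (q - p)) (nhdsWithin μ⁻¹ (Set.Iio μ⁻¹))
        (nhds (d * (μ⁻¹ - p))) :=
      ((by fun_prop : Continuous fun q : ℝ => d * (q - p)).tendsto _).mono_left
        nhdsWithin_le_nhds
    refine le_of_tendsto ht ?_
    filter_upwards [Ioo_mem_nhdsLT hpμ] with q hq using hlin q hq
  have hren := tsum_latW_mul_eq_one h0 h1 (hpos hp).le (hfin hp hpμ) (hsum hp hpμ)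
  rw [← chiR_eq_tsum h0 h1 hd1 hμ (hpos hp).le hpμ] at hren
  have hμi : μ * μ⁻¹ = 1 := mul_inv_cancel₀ (by linarith)
  have hgap : 0 < μ⁻¹ - p := sub_pos.2 hpμ
  have hlt : 1 - p * μ = μ * (μ⁻¹ - p) := by rw [mul_sub, hμi, mul_comm]
  have hχ : 0 ≤ chiR d β p := by
    rw [chiR_eq_tsum h0 h1 hd1 hμ (hpos hp).le hpμ]
    exact tsum_nonneg (latW_mul_pow_nonneg h0 h1 (hpos hp).le)
  rw [le_div_iff₀ (by rw [hlt]; positivity)]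
  have hhalf : 1 - p * μ ≤
      2 * (1 - ∑' ω : List (Fin d × Bool), latJ d β ω * p ^ ω.length) := by
    rw [hlt]
    nlinarith [mul_le_mul_of_nonneg_right hμ2 hgap.le]
  nlinarith [mul_le_mul_of_nonneg_left hhalf hχ]

/-- Comparison of the torus and lattice susceptibilities in a disk where the lattice
susceptibility is controlled by the square root of the volume. -/
lemma exists_inv_sub_inv_le (hd : 5 ≤ d) {B : ℝ} (hB : 0 ≤ B) :
    ∃ C β₁ : ℝ, 0 ≤ C ∧ 0 < β₁ ∧ ∀ β μ : ℝ, 0 ≤ β → β ≤ β₁ → HasGrowthConst d β μ →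
      1 ≤ μ ∧ μ ≤ 2 * d ∧
      ∀ p : ℝ, 1 / (4 * d) ≤ p → p < μ⁻¹ → chiR d β p ≤ 2 / (1 - p * μ) ∧
        (∀ q, 0 ≤ q → q < μ⁻¹ → (1 - q * μ)⁻¹ ≤ chiR d β q) ∧
        ∀ r : ℕ, 3 ≤ r → chiR d β p ≤ B * Real.sqrt ((r : ℝ) ^ d) → ∀ z : ℂ, ‖z‖ < p →
          chi d β z ≠ 0 ∧ chiT d r β z ≠ 0 ∧
          ‖deriv (fun w => (chiT d r β w)⁻¹ - (chi d β w)⁻¹) z‖ ≤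
            C * β * (((r : ℝ) ^ 2 + chiR d β p) / r ^ d) / (p - ‖z‖) := by
  obtain ⟨K, β₁, hβ₁, hβ₁', H1⟩ := exists_subcritical hd
  obtain ⟨C, β₂, hC, hβ₂, -, H2⟩ := exists_torJ_sub_latJ_le hd (K := K) hB
  refine ⟨C, min β₁ β₂, hC, lt_min hβ₁ hβ₂, fun β μ h0 hβ hμ => ?_⟩
  have h1 : β ≤ 1 := by linarith [hβ.trans (min_le_left _ _)]
  have hd1 : 1 ≤ d := by omega
  have hd' : (5 : ℝ) ≤ d := by exact_mod_cast hd
  refine ⟨one_le_growth hd1 h0 h1 hμ, growth_le hd1 h0 h1 hμ, fun p hp hpμ => ?_⟩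
  obtain ⟨hg, hm, hχ⟩ := H1 β μ h0 (hβ.trans (min_le_left _ _)) hμ p hp hpμ
  refine ⟨hχ, fun q hq hqμ => inv_le_chiR hd1 h0 h1 hμ hq hqμ, fun r hr hχr z hz => ?_⟩
  have hp0 : 0 ≤ p := le_trans (by positivity) hp
  have hs := suscept_eq_ofReal hd1 h0 h1 hμ hp0 hpμ
  have hfin : suscept d β p ≠ ⊤ := hs ▸ ENNReal.ofReal_ne_top
  have hχ0 : 0 ≤ chiR d β p := by
    rw [chiR_eq_tsum h0 h1 hd1 hμ hp0 hpμ]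
    exact tsum_nonneg (latW_mul_pow_nonneg h0 h1 hp0)
  have hsr : (suscept d β p).toReal = chiR d β p := by rw [hs, ENNReal.toReal_ofReal hχ0]
  have hdiff := H2 β p h0 (hβ.trans (min_le_right _ _)) hp hfin hm hg r (by omega)
    (by rwa [hsr])
  rw [hsr] at hdiff
  have hjL := summable_latJ_of_momSum hd hp0 (ne_top_of_le_ne_top ENNReal.ofReal_ne_top hm)
  have hjD : Summable fun ω : List (Fin d × Bool) =>
      (torJ d r β ω - latJ d β ω) * p ^ ω.length := by
    refine summable_of_tsum_ofReal_ne_top (ne_top_of_le_ne_top ENNReal.ofReal_ne_top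
      (le_trans (le_of_eq (tsum_congr fun ω => ?_)) hdiff))
    rw [abs_mul, abs_of_nonneg (pow_nonneg hp0 _), ENNReal.ofReal_mul (abs_nonneg _),
      ENNReal.ofReal_pow hp0]
  have hjT : Summable fun ω : List (Fin d × Bool) => torJ d r β ω * p ^ ω.length :=
    (hjD.add hjL).congr fun ω => by ring
  have hL := fun {w : ℂ} (hw : ‖w‖ ≤ p) => chi_mul_one_sub h0 h1 hp0 hfin hjL hw
  have hT := fun {w : ℂ} (hw : ‖w‖ ≤ p) => chiT_mul_one_sub hr h0 h1 hp0 hfin hjT hw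
  refine ⟨left_ne_zero_of_mul_eq_one (hL hz.le), left_ne_zero_of_mul_eq_one (hT hz.le), ?_⟩
  have hsumm : ∀ {D : List (Fin d × Bool) → ℝ} {w : ℂ}, ‖w‖ ≤ p →
      (Summable fun ω => D ω * p ^ ω.length) → Summable fun ω => (D ω : ℂ) * w ^ ω.length :=
    fun {D} {w} hw h => Summable.of_norm_bounded h.abs fun ω => by
      rw [abs_mul, abs_of_nonneg (pow_nonneg hp0 _)]
      exact norm_mul_pow_le D hw ω
  have hΔ : (fun w => (chiT d r β w)⁻¹ - (chi d β w)⁻¹) =ᶠ[nhds z] fun w =>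
      ∑' ω : List (Fin d × Bool), ((latJ d β ω - torJ d r β ω : ℝ) : ℂ) * w ^ ω.length := by
    filter_upwards [(continuous_norm.tendsto z).eventually (Iio_mem_nhds hz)] with w hw
    have hw : ‖w‖ ≤ p := le_of_lt hw
    rw [← eq_inv_of_mul_eq_one_right (hL hw), ← eq_inv_of_mul_eq_one_right (hT hw),
      sub_sub_sub_cancel_left, ← (hsumm hw hjL).tsum_sub (hsumm hw hjT)]
    refine tsum_congr fun ω => ?_
    push_cast
    ring
  rw [hΔ.deriv_eq]
  refine norm_deriv_tsum_le _ (by positivity) (le_trans (le_of_eq (tsum_congr fun ω => ?_)) hdiff)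
    hz
  rw [abs_sub_comm]

end Final

end WSAW

/-- for `|z| ≤ ζ = z_c(1 - V^{-1/2})`, both susceptibilities are nonzero
and `Δ(z) = 1/χ^𝕋(z) - 1/χ(z)` satisfies `|z Δ'(z)| ≤ C β χ(|z|)(r² + χ(|z|))/V`. -/
theorem statement12 (d : ℕ) (hd : 4 < d) :
    ∃ β0 C : ℝ, 0 < β0 ∧ 0 < C ∧
      ∀ β : ℝ, 0 < β → β ≤ β0 →
        ∀ μ : ℝ, HasGrowthConst d β μ →
          ∀ r : ℕ, 3 ≤ r →
            ∀ z : ℂ, ‖z‖ ≤ μ⁻¹ * (1 - (Real.sqrt ((r : ℝ) ^ d))⁻¹) →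
              chi d β z ≠ 0 ∧ chiT d r β z ≠ 0 ∧
              ‖z * deriv (fun w => (chiT d r β w)⁻¹ - (chi d β w)⁻¹) z‖ ≤
                C * β * chiR d β ‖z‖ * ((r : ℝ) ^ 2 + chiR d β ‖z‖) / (r : ℝ) ^ d := by
  obtain ⟨C, β₁, hC, hβ₁, H⟩ := WSAW.exists_inv_sub_inv_le hd (B := 4) (by norm_num)
  refine ⟨β₁, 8 * C + 1, hβ₁, by positivity, fun β h0 hβ μ hμ r hr z hz => ?_⟩
  obtain ⟨hμ1, hμ2, H⟩ := H β μ h0.le hβ hμ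
  have hμ0 : 0 < μ := by linarith
  have hd' : (4 : ℝ) < d := by exact_mod_cast hd
  have hr0 : (0 : ℝ) < r := by exact_mod_cast (by omega : 0 < r)
  have hV : 0 < Real.sqrt ((r : ℝ) ^ d) := Real.sqrt_pos.2 (by positivity)
  set V := Real.sqrt ((r : ℝ) ^ d)
  have hx0 := norm_nonneg z
  set x := ‖z‖ with hx
  have hxV : V⁻¹ ≤ 1 - x * μ := by
    have := mul_le_mul_of_nonneg_right hz hμ0.le
    rw [mul_right_comm, inv_mul_cancel₀ hμ0.ne', one_mul] at this
    linarith
  have hpos : 0 < 1 - x * μ := (inv_pos.2 hV).trans_le hxV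
  have hxμ : x < μ⁻¹ := by
    rw [← one_div, lt_div_iff₀ hμ0]
    linarith
  let p := (x + μ⁻¹) / 2
  have hp : 1 / (4 * d) ≤ p := by
    have : (2 * (d : ℝ))⁻¹ ≤ μ⁻¹ := inv_anti₀ hμ0 hμ2
    have h4 : 1 / (4 * (d : ℝ)) = (2 * (d : ℝ))⁻¹ / 2 := by field_simp; norm_num
    rw [h4]
    simp only [p]
    linarith
  have hpμ : p < μ⁻¹ := by simp only [p]; linarith
  have hxp : x < p := by simp only [p]; linarith
  have hp1 : 1 - p * μ = (1 - x * μ) / 2 := by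
    simp only [p]
    field_simp
    ring
  obtain ⟨hχp, hinv, H⟩ := H p hp hpμ
  have hχx := hinv x hx0 hxμ
  have hχp' : chiR d β p ≤ 4 * (1 - x * μ)⁻¹ := by
    refine hχp.trans (le_of_eq ?_)
    rw [hp1]
    field_simp
    norm_num
  have hχV : chiR d β p ≤ 4 * V := by
    refine hχp'.trans ?_
    rw [mul_le_mul_iff_right₀ (by norm_num)]
    exact inv_le_of_inv_le₀ hV hxV
  obtain ⟨h1, h2, h3⟩ := H r hr hχV z hxp
  refine ⟨h1, h2, ?_⟩
  have hχp0 : 0 ≤ chiR d β p := by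
    refine le_trans ?_ (hinv p (hx0.trans hxp.le) hpμ)
    rw [hp1]
    positivity
  have hχ0 : 0 ≤ chiR d β x := le_trans (by positivity) hχx
  have hgap : p - x = (1 - x * μ) / (2 * μ) := by
    simp only [p]
    field_simp
    ring
  have hratio : x / (p - x) ≤ 2 * chiR d β x := by
    rw [hgap, div_div_eq_mul_div, div_eq_mul_inv]
    have : x * (2 * μ) ≤ 2 := by linarith
    exact mul_le_mul this hχx (by positivity) (by norm_num)
  rw [norm_mul]
  calc x * ‖deriv (fun w => (chiT d r β w)⁻¹ - (chi d β w)⁻¹) z‖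
      ≤ x * (C * β * (((r : ℝ) ^ 2 + chiR d β p) / r ^ d) / (p - x)) := by gcongr
    _ = x / (p - x) * (C * β * (((r : ℝ) ^ 2 + chiR d β p) / r ^ d)) := by ring
    _ ≤ 2 * chiR d β x * (C * β * ((4 * ((r : ℝ) ^ 2 + chiR d β x)) / r ^ d)) := by
        gcongr
        nlinarith [sq_nonneg (r : ℝ)]
    _ = 8 * C * β * chiR d β x * ((r : ℝ) ^ 2 + chiR d β x) / r ^ d := by ring
    _ ≤ _ := by
        gcongr
        linarith
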